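/- Let k ≥ 1 and m ≥ 3 be integers, let λ_0, …, λ_k be integers with λ_j ≠ 0 for at least one index j, and let R be a union of primes in at least k·φ(m)/(k+1) residue classes in the reduced residue system modulo m. Assume RH and GRH_m. Let α_1, …, α_k be pairwise distinct non-zero integers, set R′ := R ∩ [2, k·(max{1865, m^{φ(m)}, max_{1≤j≤k}|α_j|} + 2)], and assume c_2(ᾱ;R′) < (k·e^{1+6.550·φ(m)}·m^{φ(m)})^{−k}. Write D := D(m,k,ᾱ;R′). Suppose H is a real number with max_{0≤i≤k}|λ_i| ≤ H and (log H)/D ≥ max{1866, m^{φ(m)}+1, max_{1≤j≤k}|α_j|+1, e^{2(2.539kφ(m)+5.724k+0.054)/D}+1}. Then for some prime number p ∈ R ∩ [2, 2k·log H/D + 2k) one has |λ_0 + λ_1·F_p(α_1) + λ_2·F_p(α_2) + … + λ_k·F_p(α_k)|_p > H^{−(0.0008k² + 0.055k + 0.675)·(log log H)²}. -/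

import Mathlib

open scoped BigOperators
open Filter Real
open scoped Nat

noncomputable section

/-- The Riemann Hypothesis: every zero of the Riemann zeta function in the
critical strip lies on the critical line. -/
def RH : Prop :=
  ∀ s : ℂ, riemannZeta s = 0 → 0 < s.re → s.re < 1 → s.re = 1 / 2

/-- GRH for Dirichlet L-functions modulo `m` (equivalently, for the `m`-th
cyclotomic Dedekind zeta function). -/
def GRH (m : ℕ) : Prop :=
  ∀ (_ : NeZero m) (χ : DirichletCharacter ℂ m) (s : ℂ),
    DirichletCharacter.LFunction χ s = 0 → 0 < s.re → s.re < 1 → s.re = 1 / 2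

/-- Euler's factorial series `F_p(t) = ∑ n! tⁿ` in `ℚ_p`. -/
def eulerF (p : ℕ) [Fact p.Prime] (t : ℤ) : ℚ_[p] :=
  ∑' n : ℕ, (n ! : ℚ_[p]) * (t : ℚ_[p]) ^ n

/-- `max_{1≤j≤k} |α_j|` as a natural number. -/
def maxAbs {k : ℕ} (α : Fin k → ℤ) : ℕ :=
  Finset.univ.sup fun j => (α j).natAbs

/-- `max_{1≤j≤k} |α_j|_p`. -/
def padicMaxAbs (p : ℕ) {k : ℕ} (α : Fin k → ℤ) : ℝ :=
  ⨆ j, ((padicNorm p ((α j : ℚ))) : ℝ)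

/-- `c₁ = 2^k (max |α_j|)^k`. -/
def c1val (k : ℕ) (α : Fin k → ℤ) : ℝ := 2 ^ k * (maxAbs α : ℝ) ^ k

/-- `c₂(ᾱ; R) = c₁ ∏_{p ∈ R} (max_i |α_i|_p)^{k+1}`. -/
def c2val (k : ℕ) (α : Fin k → ℤ) (R : Set ℕ) : ℝ :=
  c1val k α * ∏' p : R, padicMaxAbs (p : ℕ) α ^ (k + 1)

/-- `D(m,k,ᾱ;R)`. -/
def Dval (m k : ℕ) (α : Fin k → ℤ) (R : Set ℕ) : ℝ :=
  -(Real.log (c2val k α R) + k * (Real.log k + (Real.log m + 6.550) * m.totient + 1))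

namespace EulerPade

open Polynomial

/-- The formal Euler factorial series `∑ n! aⁿ Xⁿ`. -/
def eulerSeries (a : ℤ) : PowerSeries ℤ := PowerSeries.mk fun n => (n ! : ℤ) * a ^ n

/-- The common denominator attached to a polynomial `P` of degree at most `N`. -/
def denom (N : ℕ) (P : ℤ[X]) : ℤ[X] :=
  ∑ h ∈ Finset.range (N + 1), C (P.coeff (N - h) * (N.descFactorial h : ℤ)) * X ^ h

lemma denom_coeff (N : ℕ) (P : ℤ[X]) (h : ℕ) :
    (denom N P).coeff h = P.coeff (N - h) * (N.descFactorial h : ℤ) := by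
  simp only [denom, finsetSum_coeff, coeff_C_mul, coeff_X_pow, mul_ite, mul_one, mul_zero,
    Finset.sum_ite_eq, Finset.mem_range]
  split_ifs with hh
  · rfl
  · rw [Nat.descFactorial_of_lt (by omega)]; simp

/-- The `n`-th coefficient of `denom N P * eulerSeries a`. -/
def prodCoeff (N : ℕ) (P : ℤ[X]) (a : ℤ) (n : ℕ) : ℤ :=
  PowerSeries.coeff n ((denom N P : PowerSeries ℤ) * eulerSeries a)

lemma prodCoeff_eq (N : ℕ) (P : ℤ[X]) (a : ℤ) (n : ℕ) :
    prodCoeff N P a n = ∑ h ∈ Finset.range (n + 1),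
      P.coeff (N - h) * (N.descFactorial h : ℤ) * (((n - h)! : ℤ) * a ^ (n - h)) := by
  rw [prodCoeff, PowerSeries.coeff_mul, Finset.Nat.sum_antidiagonal_eq_sum_range_succ_mk]
  simp [eulerSeries, denom_coeff]

lemma prodCoeff_add (N : ℕ) (P : ℤ[X]) (a : ℤ) (d : ℕ) :
    prodCoeff N P a (N + d) = ∑ s ∈ Finset.range (N + 1),
      (N ! : ℤ) * d ! * ((s + d).choose d : ℤ) * (P.coeff s * a ^ (s + d)) := by
  rw [prodCoeff_eq, show N + d + 1 = (N + 1) + d by ring, Finset.sum_range_add,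
    add_eq_left.mpr (Finset.sum_eq_zero fun x _ => by
      rw [Nat.descFactorial_of_lt (by omega)]; simp), ← Finset.sum_range_reflect]
  refine Finset.sum_congr rfl fun s hs => ?_
  have hs : s ≤ N := by simpa [Nat.lt_succ_iff] using hs
  have e1 : N - (N + 1 - 1 - s) = s := by omega
  have e2 : N + d - (N + 1 - 1 - s) = s + d := by omega
  have e3 : N + 1 - 1 - s = N - s := by omega
  rw [e1, e2, e3]
  have h1 : ((s ! : ℤ)) * N.descFactorial (N - s) = N ! := by
    have := Nat.factorial_mul_descFactorial (n := N) (k := N - s) (by omega)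
    rw [show N - (N - s) = s by omega] at this
    exact_mod_cast this
  have h2 : ((s + d).choose d : ℤ) * s ! * d ! = (s + d)! := by
    have := Nat.add_choose_mul_factorial_mul_factorial s d
    exact_mod_cast this
  rw [← h2, ← h1]; ring

lemma prodCoeff_add_eq_hasseDeriv {N : ℕ} {P : ℤ[X]} (hP : P.natDegree ≤ N) (a : ℤ) (d : ℕ) :
    prodCoeff N P a (N + d) =
      (N ! : ℤ) * d ! * a ^ d * (hasseDeriv d (X ^ d * P)).eval a := by
  have hdeg : (hasseDeriv d (X ^ d * P)).natDegree < N + 1 := by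
    rw [Nat.lt_succ_iff, natDegree_le_iff_coeff_eq_zero]
    intro n hn
    rw [hasseDeriv_coeff, mul_comm (X ^ d), coeff_mul_X_pow,
      coeff_eq_zero_of_natDegree_lt (by omega), mul_zero]
  rw [prodCoeff_add, eval_eq_sum_range' hdeg, Finset.mul_sum]
  refine Finset.sum_congr rfl fun s _ => ?_
  rw [hasseDeriv_coeff, mul_comm (X ^ d), coeff_mul_X_pow, pow_add]
  ring

lemma taylor_coeff_eq {P Q : ℤ[X]} {a : ℤ} {l : ℕ} (hPQ : P = (X - C a) ^ l * Q) (d : ℕ) :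
    (hasseDeriv d (X ^ d * P)).eval a =
      if d < l then 0 else (taylor a (X ^ d * Q)).coeff (d - l) := by
  rw [← taylor_coeff, hPQ, show X ^ d * ((X - C a) ^ l * Q) = (X - C a) ^ l * (X ^ d * Q) by ring,
    taylor_mul, taylor_pow]
  have : taylor a (X - C a) = X := by rw [map_sub, taylor_X, taylor_C]; ring
  rw [this, coeff_X_pow_mul']
  split_ifs <;> first | rfl | omega

/-- The numerator polynomial approximating `denom N P * eulerSeries a`. -/
def numer (N : ℕ) (P : ℤ[X]) (a : ℤ) : ℤ[X] :=
  PowerSeries.trunc N ((denom N P : PowerSeries ℤ) * eulerSeries a)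

lemma numer_eval_one (N : ℕ) (P : ℤ[X]) (a : ℤ) :
    (numer N P a).eval 1 = ∑ n ∈ Finset.range N, prodCoeff N P a n := by
  rw [numer, ← eval₂_id, PowerSeries.eval₂_trunc_eq_sum_range]
  simp [prodCoeff]

lemma denom_eval_one (N : ℕ) (P : ℤ[X]) :
    (denom N P).eval 1 =
      ∑ h ∈ Finset.range (N + 1), P.coeff (N - h) * (N.descFactorial h : ℤ) := by
  simp [denom, eval_finsetSum]

lemma denom_natDegree_le (N : ℕ) (P : ℤ[X]) : (denom N P).natDegree ≤ N := by
  rw [natDegree_le_iff_coeff_eq_zero]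
  intro n hn
  rw [denom_coeff, Nat.descFactorial_of_lt hn]; simp

/-- The generating polynomials `Xⁱ ∏ (X - α_j)^l`. -/
def basePoly {k : ℕ} (α : Fin k → ℤ) (l i : ℕ) : ℤ[X] := X ^ i * ∏ j, (X - C (α j)) ^ l

lemma basePoly_monic {k : ℕ} (α : Fin k → ℤ) (l i : ℕ) : (basePoly α l i).Monic :=
  (monic_X_pow i).mul (monic_prod_of_monic _ _ fun _ _ => (monic_X_sub_C _).pow l)

lemma basePoly_natDegree {k : ℕ} (α : Fin k → ℤ) (l i : ℕ) :
    (basePoly α l i).natDegree = i + k * l := by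
  rw [basePoly, (monic_X_pow i).natDegree_mul
    (monic_prod_of_monic _ _ fun _ _ => (monic_X_sub_C _).pow l),
    natDegree_prod_of_monic _ _ fun _ _ => (monic_X_sub_C _).pow l]
  simp only [natDegree_pow, natDegree_X, natDegree_X_sub_C]
  simp

lemma basePoly_eq {k : ℕ} (α : Fin k → ℤ) (l i : ℕ) (j : Fin k) :
    basePoly α l i = (X - C (α j)) ^ l *
      (X ^ i * ∏ j' ∈ Finset.univ.erase j, (X - C (α j')) ^ l) := by
  rw [basePoly, ← Finset.mul_prod_erase _ _ (Finset.mem_univ j)]; ring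

lemma prodCoeff_basePoly_eq_zero {k : ℕ} (α : Fin k → ℤ) {l i N n : ℕ} (hi : i + k * l ≤ N)
    (j : Fin k) (h1 : N ≤ n) (h2 : n < N + l) : prodCoeff N (basePoly α l i) (α j) n = 0 := by
  obtain ⟨d, rfl⟩ := Nat.exists_eq_add_of_le h1
  rw [prodCoeff_add_eq_hasseDeriv (by rw [basePoly_natDegree]; exact hi),
    taylor_coeff_eq (basePoly_eq α l i j), if_pos (by omega), mul_zero]

lemma prodCoeff_basePoly_leading {k : ℕ} (α : Fin k → ℤ) {l i N : ℕ} (hi : i + k * l ≤ N)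
    (j : Fin k) : prodCoeff N (basePoly α l i) (α j) (N + l) =
      (N ! : ℤ) * l ! * α j ^ l * α j ^ l * (∏ j' ∈ Finset.univ.erase j, (α j - α j') ^ l) *
        α j ^ i := by
  rw [prodCoeff_add_eq_hasseDeriv (by rw [basePoly_natDegree]; exact hi),
    taylor_coeff_eq (basePoly_eq α l i j), if_neg (by omega), Nat.sub_self, taylor_coeff_zero]
  simp only [eval_mul, eval_pow, eval_X, eval_prod, eval_sub, eval_C]
  ring

/-- The coefficient of `X ^ s` is divisible by `G ^ (n - s)`. -/
def WeightDvd (G : ℤ) (n : ℕ) (P : ℤ[X]) : Prop := ∀ s, G ^ (n - s) ∣ P.coeff s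

lemma WeightDvd.mul {G : ℤ} {n₁ n₂ : ℕ} {P Q : ℤ[X]} (hP : WeightDvd G n₁ P)
    (hQ : WeightDvd G n₂ Q) : WeightDvd G (n₁ + n₂) (P * Q) := by
  intro s
  rw [coeff_mul]
  refine Finset.dvd_sum fun x hx => ?_
  rw [Finset.HasAntidiagonal.mem_antidiagonal] at hx
  refine (pow_dvd_pow G ?_).trans ((pow_add G _ _).symm ▸ mul_dvd_mul (hP x.1) (hQ x.2))
  omega

lemma WeightDvd.one (G : ℤ) : WeightDvd G 0 1 := fun s => by simp

lemma WeightDvd.X_sub_C {G a : ℤ} (h : G ∣ a) : WeightDvd G 1 (X - C a) := by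
  intro s
  match s with
  | 0 => simpa using h
  | s + 1 => simp

lemma WeightDvd.pow {G : ℤ} {n : ℕ} {P : ℤ[X]} (hP : WeightDvd G n P) (l : ℕ) :
    WeightDvd G (l * n) (P ^ l) := by
  induction l with
  | zero => simpa using WeightDvd.one G
  | succ l ih => rw [pow_succ, Nat.succ_mul]; exact ih.mul hP

lemma WeightDvd.prod {G : ℤ} {ι : Type*} {n : ℕ} (s : Finset ι) {P : ι → ℤ[X]}
    (hP : ∀ i ∈ s, WeightDvd G n (P i)) : WeightDvd G (s.card * n) (∏ i ∈ s, P i) := by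
  classical
  induction s using Finset.induction_on with
  | empty => simpa using WeightDvd.one G
  | insert a s ha ih =>
    rw [Finset.prod_insert ha, Finset.card_insert_of_notMem ha, add_comm, Nat.add_mul, one_mul]
    exact (hP a (by simp)).mul (ih fun i hi => hP i (by simp [hi]))

lemma WeightDvd.X_pow (G : ℤ) (i : ℕ) : WeightDvd G i (X ^ i) := by
  intro s
  rw [coeff_X_pow]
  split_ifs with h
  · simp [h]
  · simp

lemma basePoly_weightDvd {k : ℕ} {α : Fin k → ℤ} {G : ℤ} (hG : ∀ j, G ∣ α j) (l i : ℕ) :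
    WeightDvd G (i + k * l) (basePoly α l i) := by
  refine (WeightDvd.X_pow G i).mul ?_
  have := WeightDvd.prod (G := G) (n := l) Finset.univ (P := fun j => (X - C (α j)) ^ l)
    fun j _ => by simpa using (WeightDvd.X_sub_C (hG j)).pow l
  simpa using this

lemma dvd_prodCoeff {k : ℕ} {α : Fin k → ℤ} {G : ℤ} (hG : ∀ j, G ∣ α j) {l i N n : ℕ}
    (_ : i + k * l ≤ N) (j : Fin k) (hn : N + l ≤ n) :
    (N ! : ℤ) * l ! * G ^ ((k + 1) * l) ∣ prodCoeff N (basePoly α l i) (α j) n := by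
  obtain ⟨d, rfl⟩ := Nat.exists_eq_add_of_le (show N ≤ n by omega)
  rw [prodCoeff_add]
  refine Finset.dvd_sum fun s _ => ?_
  have h1 : (l ! : ℤ) ∣ d ! := by exact_mod_cast Nat.factorial_dvd_factorial (by omega)
  have h2 : G ^ ((k + 1) * l) ∣ (basePoly α l i).coeff s * α j ^ (s + d) := by
    refine (pow_dvd_pow G ?_).trans ((pow_add G (i + k * l - s) (s + d)).symm ▸
      mul_dvd_mul (basePoly_weightDvd hG l i s) (pow_dvd_pow_of_dvd (hG j) _))
    rw [Nat.add_mul, one_mul]; omega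
  refine mul_dvd_mul ((mul_dvd_mul_left _ h1).trans (dvd_mul_right _ _)) h2

/-- Coefficientwise domination by a polynomial with natural coefficients. -/
def Dominated (P : ℤ[X]) (Q : ℕ[X]) : Prop := ∀ s, (P.coeff s).natAbs ≤ Q.coeff s

lemma Dominated.mul {P₁ P₂ : ℤ[X]} {Q₁ Q₂ : ℕ[X]} (h₁ : Dominated P₁ Q₁) (h₂ : Dominated P₂ Q₂) :
    Dominated (P₁ * P₂) (Q₁ * Q₂) := by
  intro s
  rw [coeff_mul, coeff_mul]
  refine (Int.natAbs_sum_le _ _).trans (Finset.sum_le_sum fun x _ => ?_)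
  rw [Int.natAbs_mul]
  exact Nat.mul_le_mul (h₁ _) (h₂ _)

lemma Dominated.one : Dominated 1 1 := by
  intro s
  rw [coeff_one, coeff_one]
  split_ifs <;> simp

lemma Dominated.pow {P : ℤ[X]} {Q : ℕ[X]} (h : Dominated P Q) (l : ℕ) :
    Dominated (P ^ l) (Q ^ l) := by
  induction l with
  | zero => simpa using Dominated.one
  | succ l ih => rw [pow_succ, pow_succ]; exact ih.mul h

lemma Dominated.prod {ι : Type*} (s : Finset ι) {P : ι → ℤ[X]} {Q : ι → ℕ[X]}
    (h : ∀ i ∈ s, Dominated (P i) (Q i)) : Dominated (∏ i ∈ s, P i) (∏ i ∈ s, Q i) := by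
  classical
  induction s using Finset.induction_on with
  | empty => simpa using Dominated.one
  | insert a s ha ih =>
    rw [Finset.prod_insert ha, Finset.prod_insert ha]
    exact (h a (by simp)).mul (ih fun i hi => h i (by simp [hi]))

lemma Dominated.X : Dominated X X := by
  intro s
  rw [coeff_X, coeff_X]
  split_ifs <;> simp

lemma Dominated.X_sub_C {a : ℤ} {M : ℕ} (h : a.natAbs ≤ M) :
    Dominated (Polynomial.X - C a) (Polynomial.X + C M) := by
  intro s
  match s with
  | 0 => simpa using h
  | 1 => rw [coeff_sub, coeff_add, coeff_C_succ, coeff_C_succ]; simp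
  | s + 2 => rw [coeff_sub, coeff_add, coeff_C_succ, coeff_C_succ]; simp [coeff_X]

lemma sum_coeff_basePoly_le {k : ℕ} {α : Fin k → ℤ} {M : ℕ} (hM : ∀ j, (α j).natAbs ≤ M)
    (l i N : ℕ) : ∑ s ∈ Finset.range (N + 1), ((basePoly α l i).coeff s).natAbs * M ^ s ≤
      2 ^ (k * l) * M ^ (i + k * l) := by
  set Q : ℕ[X] := X ^ i * ∏ _j : Fin k, (X + C M) ^ l with hQ
  have hdom : Dominated (basePoly α l i) Q :=
    (Dominated.X.pow i).mul (Dominated.prod _ fun j _ => (Dominated.X_sub_C (hM j)).pow l)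
  have heval : Q.eval M = 2 ^ (k * l) * M ^ (i + k * l) := by
    simp only [hQ, eval_mul, eval_pow, eval_X, eval_add, eval_C, Finset.prod_const,
      Finset.card_univ, Fintype.card_fin]
    rw [← two_mul, ← pow_mul, mul_pow, pow_add, mul_comm l k]; ring
  rw [← heval, eval_eq_sum_range' (n := max (N + 1) (Q.natDegree + 1)) (by omega)]
  refine (Finset.sum_le_sum fun s _ => Nat.mul_le_mul_right _ (hdom s)).trans
    (Finset.sum_le_sum_of_subset ?_)
  exact Finset.range_subset_range.mpr (le_max_left _ _)

lemma natAbs_denom_le {k : ℕ} {α : Fin k → ℤ} {M : ℕ} (hM : ∀ j, (α j).natAbs ≤ M) (hM1 : 1 ≤ M)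
    {l i N : ℕ} (hi : i + k * l ≤ N) : ((denom N (basePoly α l i)).eval 1).natAbs ≤
      N ! * (2 ^ (k * l) * M ^ N) := by
  rw [denom_eval_one, ← Finset.sum_range_reflect]
  refine (Int.natAbs_sum_le _ _).trans ?_
  calc _ ≤ ∑ s ∈ Finset.range (N + 1), N ! * (((basePoly α l i).coeff s).natAbs * M ^ s) := by
        refine Finset.sum_le_sum fun s hs => ?_
        have hs : s ≤ N := by simpa [Nat.lt_succ_iff] using hs
        rw [show N - (N + 1 - 1 - s) = s by omega, Int.natAbs_mul, Int.natAbs_natCast, mul_comm]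
        exact Nat.mul_le_mul (Nat.factorial_mul_descFactorial (show N + 1 - 1 - s ≤ N by omega) ▸
          Nat.le_mul_of_pos_left _ (Nat.factorial_pos _))
          (Nat.le_mul_of_pos_right _ (by positivity))
    _ ≤ _ := by
        rw [← Finset.mul_sum]
        refine Nat.mul_le_mul_left _ ((sum_coeff_basePoly_le hM l i N).trans ?_)
        exact Nat.mul_le_mul_left _ (Nat.pow_le_pow_right hM1 hi)

lemma natAbs_prodCoeff_le {k : ℕ} {α : Fin k → ℤ} {M : ℕ} (hM : ∀ j, (α j).natAbs ≤ M)
    (hM1 : 1 ≤ M) {l i N n : ℕ} (hi : i + k * l ≤ N) (hn : n < N) (j : Fin k) :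
    (prodCoeff N (basePoly α l i) (α j) n).natAbs ≤ N ! * (2 ^ (k * l) * M ^ N) := by
  rw [prodCoeff_eq]
  refine (Int.natAbs_sum_le _ _).trans ?_
  calc _ ≤ ∑ h ∈ Finset.range (n + 1),
        N ! * (((basePoly α l i).coeff (N - h)).natAbs * M ^ (N - h)) := by
        refine Finset.sum_le_sum fun h hh => ?_
        have hh : h ≤ n := by simpa [Nat.lt_succ_iff] using hh
        simp only [Int.natAbs_mul, Int.natAbs_natCast, Int.natAbs_pow]
        have h1 : N.descFactorial h * (n - h)! ≤ N ! := by
          rw [← Nat.factorial_mul_descFactorial (show h ≤ N by omega), mul_comm]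
          exact Nat.mul_le_mul_right _ (Nat.factorial_le (by omega))
        have h2 : (α j).natAbs ^ (n - h) ≤ M ^ (N - h) :=
          (Nat.pow_le_pow_left (hM j) _).trans (Nat.pow_le_pow_right hM1 (by omega))
        calc _ = (N.descFactorial h * (n - h)!) *
              (((basePoly α l i).coeff (N - h)).natAbs * (α j).natAbs ^ (n - h)) := by ring
          _ ≤ _ := Nat.mul_le_mul h1 (Nat.mul_le_mul_left _ h2)
    _ ≤ ∑ h ∈ Finset.range (N + 1),
        N ! * (((basePoly α l i).coeff (N - h)).natAbs * M ^ (N - h)) :=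
        Finset.sum_le_sum_of_subset (Finset.range_subset_range.mpr (by omega))
    _ = ∑ s ∈ Finset.range (N + 1), N ! * (((basePoly α l i).coeff s).natAbs * M ^ s) := by
        rw [← Finset.sum_range_reflect]
        refine Finset.sum_congr rfl fun s hs => ?_
        have hs : s ≤ N := by simpa [Nat.lt_succ_iff] using hs
        rw [show N - (N + 1 - 1 - s) = s by omega]
    _ ≤ _ := by
        rw [← Finset.mul_sum]
        refine Nat.mul_le_mul_left _ ((sum_coeff_basePoly_le hM l i N).trans ?_)
        exact Nat.mul_le_mul_left _ (Nat.pow_le_pow_right hM1 hi)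

end EulerPade

namespace EulerPade

open Polynomial Matrix

section Determinant

variable {k : ℕ} (α : Fin k → ℤ) (l : ℕ)

/-- The matrix of Padé polynomials: denominators in column `0`, numerators in the others. -/
def padeMatrix : Matrix (Fin (k + 1)) (Fin (k + 1)) ℤ[X] := fun i =>
  Fin.cons (denom (k * (l + 1)) (basePoly α l i))
    fun j => numer (k * (l + 1)) (basePoly α l i) (α j)

/-- The remainders `∑ r_{n} X^{n - N - l}`. -/
def tailSeries (i : ℕ) (j : Fin k) : PowerSeries ℤ := PowerSeries.mk fun n =>
  prodCoeff (k * (l + 1)) (basePoly α l i) (α j) (n + (k * (l + 1) + l))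

variable {α l} in
lemma denom_mul_eulerSeries (i : Fin (k + 1)) (j : Fin k) :
    ((denom (k * (l + 1)) (basePoly α l i) : PowerSeries ℤ) * eulerSeries (α j)) =
      (numer (k * (l + 1)) (basePoly α l i) (α j) : PowerSeries ℤ) +
        tailSeries α l i j * PowerSeries.X ^ (k * (l + 1) + l) := by
  have hi : (i : ℕ) + k * l ≤ k * (l + 1) := by rw [mul_add, mul_one]; omega
  ext n
  rw [map_add, PowerSeries.coeff_mul_X_pow', coeff_coe, numer, PowerSeries.coeff_trunc]
  change prodCoeff _ _ _ _ = _
  split_ifs with h1 h2 h2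
  · omega
  · simp [prodCoeff]
  · rw [tailSeries, PowerSeries.coeff_mk, zero_add]; congr 1; omega
  · rw [prodCoeff_basePoly_eq_zero α hi j (by omega) (by omega), add_zero]

/-- The matrix of denominators and remainders. -/
def tailMatrix : Matrix (Fin (k + 1)) (Fin (k + 1)) (PowerSeries ℤ) := fun i =>
  Fin.cons (denom (k * (l + 1)) (basePoly α l i) : PowerSeries ℤ) fun j => - tailSeries α l i j

/-- Column operations turning numerators into remainders. -/
def columnOp : Matrix (Fin (k + 1)) (Fin (k + 1)) (PowerSeries ℤ) := fun i j =>
  Fin.cases (motive := fun _ => PowerSeries ℤ) (if i = 0 then 1 else 0)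
    (fun j => if i = 0 then - eulerSeries (α j) else if i = j.succ then 1 else 0) j

lemma det_columnOp : (columnOp α).det = 1 := by
  rw [det_of_isUpperTriangular]
  · refine Finset.prod_eq_one fun i _ => ?_
    refine Fin.cases ?_ (fun i => ?_) i <;> simp [columnOp]
  · intro i j hij
    simp only [id] at hij
    revert hij
    refine Fin.cases ?_ (fun j => ?_) j
    · intro h; simp [columnOp, h.ne']
    · intro h; simp [columnOp, h.ne', (Fin.succ_pos j |>.trans h).ne']

lemma padeMatrix_mul_columnOp :
    ((padeMatrix α l).map (coeToPowerSeries.ringHom (R := ℤ))) * columnOp α =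
      tailMatrix α l * diagonal (Fin.cons 1 fun _ => PowerSeries.X ^ (k * (l + 1) + l)) := by
  ext1 i j
  rw [mul_apply, mul_diagonal, Fin.sum_univ_succ]
  refine Fin.cases ?_ (fun j => ?_) j
  · simp [columnOp, padeMatrix, tailMatrix]
  · simp only [columnOp, padeMatrix, tailMatrix, map_apply, Fin.cons_zero, Fin.cons_succ,
      Fin.cases_succ, if_true, Fin.succ_ne_zero, if_false, Fin.succ_inj, mul_ite, mul_one,
      mul_zero, Finset.sum_ite_eq', Finset.mem_univ, coeToPowerSeries.ringHom_apply]
    have := denom_mul_eulerSeries (α := α) (l := l) i j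
    rw [mul_neg, this]; ring

lemma coe_det_padeMatrix : ((padeMatrix α l).det : PowerSeries ℤ) =
    (tailMatrix α l).det * PowerSeries.X ^ ((k * (l + 1) + l) * k) := by
  have h := congrArg det (padeMatrix_mul_columnOp α l)
  rw [det_mul, det_columnOp, mul_one, det_mul, det_diagonal, Fin.prod_univ_succ] at h
  rw [← coeToPowerSeries.ringHom_apply, RingHom.map_det, RingHom.mapMatrix_apply, h]
  simp [pow_mul]

lemma natDegree_det_padeMatrix_le (hk : 1 ≤ k) :
    (padeMatrix α l).det.natDegree ≤ (k * (l + 1) + l) * k := by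
  rw [det_apply]
  refine natDegree_sum_le_of_forall_le _ _ fun σ _ => ?_
  refine (natDegree_smul_le _ _).trans ?_
  refine (natDegree_prod_le _ _).trans ?_
  rw [Fin.sum_univ_succ]
  have h0 : (padeMatrix α l (σ 0) 0).natDegree ≤ k * (l + 1) := denom_natDegree_le _ _
  have hN : k * (l + 1) ≠ 0 := by positivity
  have hs : ∀ j : Fin k, (padeMatrix α l (σ j.succ) j.succ).natDegree ≤ k * (l + 1) - 1 := by
    intro j
    obtain ⟨n, hn⟩ : ∃ n, k * (l + 1) = n + 1 := Nat.exists_eq_succ_of_ne_zero hN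
    have := PowerSeries.natDegree_trunc_lt
      ((denom (k * (l + 1)) (basePoly α l (σ j.succ)) : PowerSeries ℤ) * eulerSeries (α j)) n
    simp only [padeMatrix, Fin.cons_succ, numer, hn] at this ⊢
    omega
  refine (Nat.add_le_add h0 (Finset.sum_le_card_nsmul _ _ _ fun j _ => hs j)).trans ?_
  rw [Finset.card_univ, Fintype.card_fin, smul_eq_mul]
  obtain ⟨n, hn⟩ := Nat.exists_eq_succ_of_ne_zero hN
  rw [hn, Nat.succ_sub_one, ← hn, add_mul]
  have : k * (l + 1) = n + 1 := hn
  nlinarith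

lemma constantCoeff_det_tailMatrix_ne_zero (hα : ∀ j, α j ≠ 0) (hinj : Function.Injective α) :
    PowerSeries.constantCoeff (tailMatrix α l).det ≠ 0 := by
  set u : Fin k → ℤ := fun j => -(((k * (l + 1))! : ℤ) * l ! * α j ^ l * α j ^ l *
    (∏ j' ∈ Finset.univ.erase j, (α j - α j') ^ l)) with hu
  have hu0 : ∀ j, u j ≠ 0 := by
    intro j
    refine neg_ne_zero.mpr (mul_ne_zero (mul_ne_zero (mul_ne_zero (mul_ne_zero ?_ ?_) ?_) ?_) ?_)
    · exact_mod_cast Nat.factorial_ne_zero _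
    · exact_mod_cast Nat.factorial_ne_zero _
    · exact pow_ne_zero _ (hα j)
    · exact pow_ne_zero _ (hα j)
    · refine Finset.prod_ne_zero_iff.mpr fun j' hj' => pow_ne_zero _ ?_
      exact sub_ne_zero.mpr fun h => (Finset.ne_of_mem_erase hj') (hinj h).symm
  set T := (PowerSeries.constantCoeff (R := ℤ)).mapMatrix (tailMatrix α l) with hT
  have hTs : ∀ (i : Fin (k + 1)) (j : Fin k), T i j.succ = u j * α j ^ (i : ℕ) := by
    intro i j
    have hi : (i : ℕ) + k * l ≤ k * (l + 1) := by rw [mul_add, mul_one]; omega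
    simp only [hT, RingHom.mapMatrix_apply, map_apply, tailMatrix, Fin.cons_succ, map_neg,
      ← PowerSeries.coeff_zero_eq_constantCoeff_apply, tailSeries, PowerSeries.coeff_mk, zero_add]
    rw [prodCoeff_basePoly_leading α hi j, hu]; ring
  have hT0 : ∀ i : Fin (k + 1), T i 0 = if i = Fin.last k then 1 else 0 := by
    intro i
    simp only [hT, RingHom.mapMatrix_apply, map_apply, tailMatrix, Fin.cons_zero,
      ← PowerSeries.coeff_zero_eq_constantCoeff_apply, coeff_coe, denom_coeff, Nat.sub_zero,
      Nat.descFactorial_zero, Nat.cast_one, mul_one]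
    split_ifs with h
    · have := (basePoly_monic α l i).coeff_natDegree
      subst h
      rwa [basePoly_natDegree, show (Fin.last k : ℕ) + k * l = k * (l + 1) by
        rw [Fin.val_last]; ring] at this
    · refine coeff_eq_zero_of_natDegree_lt ?_
      rw [basePoly_natDegree, mul_add, mul_one]
      have := Fin.val_lt_last h
      omega
  rw [RingHom.map_det, ← hT, det_succ_column_zero, Finset.sum_eq_single (Fin.last k)]
  · refine mul_ne_zero (mul_ne_zero (by simp) (by simp [hT0])) ?_
    have : T.submatrix (Fin.last k).succAbove Fin.succ =
        (vandermonde α)ᵀ * diagonal u := by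
      ext i j
      rw [mul_diagonal, submatrix_apply, Fin.succAbove_last, hTs, transpose_apply,
        vandermonde_apply, Fin.val_castSucc, mul_comm]
    rw [this, det_mul, det_transpose, det_diagonal]
    exact mul_ne_zero (det_vandermonde_ne_zero_iff.mpr hinj)
      (Finset.prod_ne_zero_iff.mpr fun j _ => hu0 j)
  · intro i _ hi
    simp [hT0, hi]
  · simp

lemma eval_det_padeMatrix_ne_zero (hk : 1 ≤ k) (hα : ∀ j, α j ≠ 0)
    (hinj : Function.Injective α) : (padeMatrix α l).det.eval 1 ≠ 0 := by
  have hco : ∀ n, (padeMatrix α l).det.coeff n =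
      if n = (k * (l + 1) + l) * k then PowerSeries.constantCoeff (tailMatrix α l).det else 0 := by
    intro n
    rcases lt_trichotomy n ((k * (l + 1) + l) * k) with h | h | h
    · rw [← coeff_coe, coe_det_padeMatrix, PowerSeries.coeff_mul_X_pow', if_neg (by omega),
        if_neg h.ne]
    · rw [← coeff_coe, coe_det_padeMatrix, PowerSeries.coeff_mul_X_pow', if_pos h.ge, if_pos h, h,
        Nat.sub_self, PowerSeries.coeff_zero_eq_constantCoeff_apply]
    · rw [if_neg h.ne', coeff_eq_zero_of_natDegree_lt]
      exact (natDegree_det_padeMatrix_le α l hk).trans_lt h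
  rw [eval_eq_sum_range' (Nat.lt_succ_of_le (natDegree_det_padeMatrix_le α l hk))]
  simp only [one_pow, mul_one, hco, Finset.sum_ite_eq', Finset.mem_range]
  rw [if_pos (by omega)]
  exact constantCoeff_det_tailMatrix_ne_zero α l hα hinj

end Determinant

end EulerPade

namespace EulerPade

open Polynomial

section Padic

variable {p : ℕ} [Fact p.Prime]

lemma norm_factorial_le (n : ℕ) : ‖(n ! : ℚ_[p])‖ ≤ (p : ℝ) ^ (-((n / p : ℕ) : ℤ)) := by
  have h : p ^ (n / p) ∣ n ! := by
    have hp : p.Prime := Fact.out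
    refine (hp.pow_dvd_factorial_iff (b := Nat.log p n + 2) (by omega)).mpr ?_
    refine le_trans ?_ (Finset.single_le_sum (f := fun i => n / p ^ i) (fun _ _ => Nat.zero_le _)
      (Finset.mem_Ico.mpr ⟨le_refl 1, by omega⟩))
    simp
  rw [← Int.cast_natCast (R := ℚ_[p]), Padic.norm_int_le_pow_iff_dvd]
  exact_mod_cast h

lemma tendsto_factorial_padic : Tendsto (fun n : ℕ => (n ! : ℚ_[p])) atTop (nhds 0) := by
  have hp : 1 < (p : ℝ) := by exact_mod_cast (Fact.out : p.Prime).one_lt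
  refine squeeze_zero_norm (a := fun n : ℕ => ((p : ℝ)⁻¹) ^ (n / p)) (fun n => ?_) ?_
  · refine (norm_factorial_le n).trans_eq ?_
    rw [zpow_neg, zpow_natCast, inv_pow]
  · exact (tendsto_pow_atTop_nhds_zero_of_lt_one (by positivity)
      (inv_lt_one_of_one_lt₀ hp)).comp
      (Nat.tendsto_div_const_atTop (Fact.out : p.Prime).ne_zero)

lemma summable_eulerF (a : ℤ) : Summable fun n : ℕ => (n ! : ℚ_[p]) * (a : ℚ_[p]) ^ n := by
  refine NonarchimedeanAddGroup.summable_of_tendsto_cofinite_zero ?_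
  rw [Nat.cofinite_eq_atTop]
  refine squeeze_zero_norm (fun n => ?_) (tendsto_zero_iff_norm_tendsto_zero.mp
    (tendsto_factorial_padic (p := p)))
  rw [norm_mul, norm_pow]
  exact mul_le_of_le_one_right (norm_nonneg _)
    (pow_le_one₀ (norm_nonneg _) (Padic.norm_int_le_one a))

lemma hasSum_eulerF_shift (a : ℤ) (h : ℕ) :
    HasSum (fun n : ℕ => if h ≤ n then ((n - h)! : ℚ_[p]) * (a : ℚ_[p]) ^ (n - h) else 0)
      (eulerF p a) := by
  rw [← hasSum_nat_add_iff' h]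
  have : ∑ i ∈ Finset.range h,
      (if h ≤ i then ((i - h)! : ℚ_[p]) * (a : ℚ_[p]) ^ (i - h) else 0) = 0 :=
    Finset.sum_eq_zero fun i hi => if_neg (by simpa using hi)
  rw [this, sub_zero]
  simp only [Nat.le_add_left, if_true, Nat.add_sub_cancel]
  exact (summable_eulerF (p := p) a).hasSum

lemma hasSum_prodCoeff (N : ℕ) (P : ℤ[X]) (a : ℤ) :
    HasSum (fun n => (prodCoeff N P a n : ℚ_[p]))
      (((denom N P).eval 1 : ℤ) * eulerF p a) := by
  have h := hasSum_sum (s := Finset.range (N + 1)) fun h _ =>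
    (hasSum_eulerF_shift (p := p) a h).mul_left
    ((P.coeff (N - h) * (N.descFactorial h : ℤ) : ℤ) : ℚ_[p])
  rw [denom_eval_one, Int.cast_sum, Finset.sum_mul]
  refine (congrArg (HasSum · _) (funext fun n => ?_)).mpr h
  rw [prodCoeff_eq, Int.cast_sum]
  have e : ∀ h, (N < h ∨ n < h) →
      ((P.coeff (N - h) * (N.descFactorial h : ℤ) : ℤ) : ℚ_[p]) *
        (if h ≤ n then ((n - h)! : ℚ_[p]) * (a : ℚ_[p]) ^ (n - h) else 0) = 0 := by
    rintro h (hh | hh)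
    · rw [Nat.descFactorial_of_lt hh]; simp
    · rw [if_neg (by omega), mul_zero]
  have t1 := Finset.sum_subset (f := fun h =>
    ((P.coeff (N - h) * (N.descFactorial h : ℤ) : ℤ) : ℚ_[p]) *
        (if h ≤ n then ((n - h)! : ℚ_[p]) * (a : ℚ_[p]) ^ (n - h) else 0))
    (Finset.range_subset_range.mpr (le_max_left (N + 1) (n + 1)))
    fun h _ hh => e h (Or.inl (by simpa using hh))
  have t2 := Finset.sum_subset (f := fun h =>
    ((P.coeff (N - h) * (N.descFactorial h : ℤ) : ℤ) : ℚ_[p]) *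
        (if h ≤ n then ((n - h)! : ℚ_[p]) * (a : ℚ_[p]) ^ (n - h) else 0))
    (Finset.range_subset_range.mpr (le_max_right (N + 1) (n + 1)))
    fun h _ hh => e h (Or.inr (by simpa using hh))
  rw [t1, ← t2]
  refine Finset.sum_congr rfl fun h hh => ?_
  have hh : h ≤ n := by simpa [Nat.lt_succ_iff] using hh
  rw [if_pos hh]; push_cast; ring

lemma norm_denom_mul_sub_numer_le {k : ℕ} {α : Fin k → ℤ} {G : ℤ} (hG : ∀ j, G ∣ α j) {l i N : ℕ}
    (hi : i + k * l ≤ N) (j : Fin k) :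
    ‖(((denom N (basePoly α l i)).eval 1 : ℤ) : ℚ_[p]) * eulerF p (α j) -
        ((numer N (basePoly α l i) (α j)).eval 1 : ℤ)‖ ≤
      ‖(((N ! : ℤ) * l ! * G ^ ((k + 1) * l) : ℤ) : ℚ_[p])‖ := by
  have h := (hasSum_nat_add_iff' N).mpr (hasSum_prodCoeff (p := p) N (basePoly α l i) (α j))
  rw [numer_eval_one, Int.cast_sum]
  refine le_of_tendsto h.tendsto_sum_nat.norm (Eventually.of_forall fun K => ?_)
  refine IsUltrametricDist.norm_sum_le_of_forall_le_of_nonneg (norm_nonneg _) fun n _ => ?_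
  by_cases hn : n < l
  · rw [prodCoeff_basePoly_eq_zero α hi j (by omega) (by omega), Int.cast_zero, norm_zero]
    exact norm_nonneg _
  · obtain ⟨c, hc⟩ := dvd_prodCoeff hG hi j (show N + l ≤ n + N by omega)
    rw [hc, Int.cast_mul, norm_mul]
    exact mul_le_of_le_one_right (norm_nonneg _) (Padic.norm_int_le_one c)

end Padic

/-- Simultaneous Padé approximations: an integer matrix with nonzero determinant, with controlled
entries, whose rows approximate the values of Euler's series at all primes. -/
theorem exists_padeApprox {k : ℕ} (hk : 1 ≤ k) (l : ℕ) {α : Fin k → ℤ} (hα : ∀ j, α j ≠ 0)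
    (hinj : Function.Injective α) {G : ℤ} (hG : ∀ j, G ∣ α j) {M : ℕ}
    (hM : ∀ j, (α j).natAbs ≤ M) :
    ∃ B : Matrix (Fin (k + 1)) (Fin (k + 1)) ℤ, B.det ≠ 0 ∧
      (∀ i c, (B i c).natAbs ≤
        k * (l + 1) * ((k * (l + 1))! * (2 ^ (k * l) * M ^ (k * (l + 1))))) ∧
      ∀ (p : ℕ) [Fact p.Prime], ∀ i j, ‖(B i 0 : ℚ_[p]) * eulerF p (α j) - B i (Fin.succ j)‖ ≤
        ‖((((k * (l + 1))! : ℤ) * l ! * G ^ ((k + 1) * l) : ℤ) : ℚ_[p])‖ := by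
  have hM1 : 1 ≤ M := (Int.natAbs_pos.mpr (hα ⟨0, hk⟩)).trans_le (hM _)
  have hi : ∀ i : Fin (k + 1), (i : ℕ) + k * l ≤ k * (l + 1) := by
    intro i; rw [mul_add, mul_one]; omega
  refine ⟨(padeMatrix α l).map (evalRingHom 1), ?_, ?_, ?_⟩
  · rw [← RingHom.mapMatrix_apply, ← RingHom.map_det]
    exact eval_det_padeMatrix_ne_zero α l hk hα hinj
  · intro i c
    refine Fin.cases ?_ (fun j => ?_) c
    · refine (natAbs_denom_le hM hM1 (hi i)).trans (Nat.le_mul_of_pos_left _ (by positivity))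
    · simp only [padeMatrix, Matrix.map_apply, Fin.cons_succ, coe_evalRingHom, numer_eval_one]
      refine (Int.natAbs_sum_le _ _).trans ((Finset.sum_le_card_nsmul _ _ _ fun n hn =>
        natAbs_prodCoeff_le hM hM1 (hi i) (Finset.mem_range.mp hn) j).trans_eq ?_)
      simp
  · intro p _ i j
    exact norm_denom_mul_sub_numer_le hG (hi i) j

end EulerPade

namespace EulerPade

/-- The logarithm of the part of `n` composed of the primes in `S`. -/
def logPart (S : Finset ℕ) (n : ℕ) : ℝ := ∑ p ∈ S, (n.factorization p : ℝ) * Real.log p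

lemma logPart_mul (S : Finset ℕ) {a b : ℕ} (ha : a ≠ 0) (hb : b ≠ 0) :
    logPart S (a * b) = logPart S a + logPart S b := by
  simp only [logPart, Nat.factorization_mul ha hb, Finsupp.add_apply, Nat.cast_add, add_mul,
    Finset.sum_add_distrib]

lemma logPart_pow (S : Finset ℕ) (a n : ℕ) : logPart S (a ^ n) = n * logPart S a := by
  simp only [logPart, Nat.factorization_pow, Finsupp.smul_apply, smul_eq_mul, Nat.cast_mul,
    Finset.mul_sum, mul_assoc]

lemma logPart_le_of_norm_le {S : Finset ℕ} (hS : ∀ p ∈ S, p.Prime) {n : ℕ} {w : ℤ} (hw : w ≠ 0)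
    (h : ∀ p ∈ S, ∀ _ : Fact p.Prime, ‖(w : ℚ_[p])‖ ≤ ‖(n : ℚ_[p])‖) (hn : n ≠ 0) :
    logPart S n ≤ Real.log w.natAbs := by
  have hd : ∏ p ∈ S, p ^ n.factorization p ∣ w.natAbs := by
    refine Finset.prod_dvd_of_isRelPrime (fun p hp q hq hpq => ?_) fun p hp => ?_
    · exact Nat.coprime_iff_isRelPrime.mp
        (((Nat.coprime_primes (hS p hp) (hS q hq)).mpr hpq).pow _ _)
    · have := Fact.mk (hS p hp)
      have h1 := h p hp this
      have h2 : ‖(n : ℚ_[p])‖ = (p : ℝ) ^ (-(n.factorization p : ℤ)) := by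
        rw [Nat.factorization_def _ (hS p hp), Padic.norm_eq_zpow_neg_valuation
          (by exact_mod_cast hn), Padic.valuation_natCast]
      rw [h2, Padic.norm_int_le_pow_iff_dvd] at h1
      have := Int.natAbs_dvd_natAbs.mpr h1
      simpa using this
  have hw' : 0 < w.natAbs := Int.natAbs_pos.mpr hw
  have hpos : 0 < ∏ p ∈ S, p ^ n.factorization p := Nat.pos_of_dvd_of_pos hd hw'
  have : logPart S n = Real.log (∏ p ∈ S, p ^ n.factorization p : ℕ) := by
    rw [Nat.cast_prod, Real.log_prod fun p hp => by
      have := (hS p hp).ne_zero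
      positivity]
    simp [logPart]
  rw [this]
  exact Real.log_le_log (by exact_mod_cast hpos) (by exact_mod_cast Nat.le_of_dvd hw' hd)

theorem logPart_le_of_forall_small {k : ℕ} (hk : 1 ≤ k) (l : ℕ) {α : Fin k → ℤ}
    (hα : ∀ j, α j ≠ 0) (hinj : Function.Injective α) {G : ℕ} (hG0 : G ≠ 0)
    (hG : ∀ j, (G : ℤ) ∣ α j) {M : ℕ} (hM : ∀ j, (α j).natAbs ≤ M) {lam : Fin (k + 1) → ℤ}
    (hlam : ∃ i, lam i ≠ 0) {H : ℝ} (hH : ∀ i, (|lam i| : ℝ) ≤ H) {S : Finset ℕ}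
    (hS : ∀ p ∈ S, p.Prime)
    (hsmall : ∀ p ∈ S, ∀ _ : Fact p.Prime,
      ‖(lam 0 : ℚ_[p]) + ∑ j : Fin k, (lam j.succ : ℚ_[p]) * eulerF p (α j)‖ ≤
        ‖(((k * (l + 1))! * l ! * G ^ ((k + 1) * l) : ℕ) : ℚ_[p])‖) :
    logPart S ((k * (l + 1))!) + logPart S (l !) + ((k + 1) * l : ℕ) * logPart S G ≤
      Real.log ((k + 1) * H *
        (k * (l + 1) * ((k * (l + 1))! * (2 ^ (k * l) * (M : ℝ) ^ (k * (l + 1)))))) := by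
  obtain ⟨B, hdet, hsize, happ⟩ := exists_padeApprox hk l hα hinj hG hM
  set n : ℕ := (k * (l + 1))! * l ! * G ^ ((k + 1) * l) with hn
  have hn0 : n ≠ 0 := by positivity
  have hne : B.mulVec lam ≠ 0 := fun h =>
    absurd (Matrix.eq_zero_of_mulVec_eq_zero hdet h) (by
      obtain ⟨i, hi⟩ := hlam
      exact fun h0 => hi (congrFun h0 i))
  obtain ⟨i, hi⟩ := Function.ne_iff.mp hne
  set w : ℤ := B.mulVec lam i with hw
  have hw0 : w ≠ 0 := hi
  have hwsum : w = ∑ c, B i c * lam c := rfl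
  have key : logPart S n ≤ Real.log w.natAbs := by
    refine logPart_le_of_norm_le hS hw0 (fun p hp hfact => ?_) hn0
    have e : (w : ℚ_[p]) = (B i 0 : ℚ_[p]) *
        ((lam 0 : ℚ_[p]) + ∑ j : Fin k, (lam j.succ : ℚ_[p]) * eulerF p (α j)) -
        ∑ j : Fin k, (lam j.succ : ℚ_[p]) *
          ((B i 0 : ℚ_[p]) * eulerF p (α j) - B i (Fin.succ j)) := by
      rw [hwsum, Int.cast_sum, Fin.sum_univ_succ, mul_add, Finset.mul_sum, add_sub_assoc,
        ← Finset.sum_sub_distrib]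
      push_cast
      congr 1
      exact Finset.sum_congr rfl fun j _ => by ring
    rw [e, sub_eq_add_neg]
    refine (IsUltrametricDist.norm_add_le_max _ _).trans (max_le ?_ ?_)
    · rw [norm_mul]
      exact (mul_le_of_le_one_left (norm_nonneg _) (Padic.norm_int_le_one _)).trans
        (hsmall p hp hfact)
    · rw [norm_neg]
      refine IsUltrametricDist.norm_sum_le_of_forall_le_of_nonneg (norm_nonneg _) fun j _ => ?_
      rw [norm_mul]
      refine (mul_le_of_le_one_left (norm_nonneg _) (Padic.norm_int_le_one _)).trans ?_
      refine (happ p i j).trans_eq ?_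
      rw [hn]; push_cast; rfl
  have hfac : ∀ a : ℕ, a ! ≠ 0 := Nat.factorial_ne_zero
  rw [← logPart_pow, ← logPart_mul S (hfac _) (hfac _), ← logPart_mul S (by positivity)
    (by positivity)]
  refine key.trans (Real.log_le_log (by exact_mod_cast Int.natAbs_pos.mpr hw0) ?_)
  have hH0 : 0 ≤ H := (abs_nonneg _).trans (hH 0)
  have hterm : ∀ c, |((B i c * lam c : ℤ) : ℝ)| ≤
      H * (k * (l + 1) * ((k * (l + 1))! * (2 ^ (k * l) * (M : ℝ) ^ (k * (l + 1))))) := by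
    intro c
    rw [Int.cast_mul, abs_mul, mul_comm]
    refine mul_le_mul (hH c) ?_ (abs_nonneg _) hH0
    have := hsize i c
    rw [← Int.cast_abs, Int.abs_eq_natAbs]
    exact_mod_cast this
  calc ((w.natAbs : ℕ) : ℝ) = |(w : ℝ)| := by rw [Nat.cast_natAbs, Int.cast_abs]
    _ ≤ ∑ c, |((B i c * lam c : ℤ) : ℝ)| := by
        rw [hwsum, Int.cast_sum]; exact Finset.abs_sum_le_sum_abs _ _
    _ ≤ _ := (Finset.sum_le_card_nsmul _ _ _ fun c _ => hterm c)
    _ = _ := by rw [Finset.card_univ, Fintype.card_fin, nsmul_eq_mul]; push_cast; ring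

/-- The greatest common divisor of the `α_j`. -/
def gcdAbs {k : ℕ} (α : Fin k → ℤ) : ℕ := Finset.univ.gcd fun j => (α j).natAbs

lemma gcdAbs_dvd {k : ℕ} (α : Fin k → ℤ) (j : Fin k) : (gcdAbs α : ℤ) ∣ α j :=
  Int.natCast_dvd.mpr (Finset.gcd_dvd (Finset.mem_univ j))

lemma natAbs_le_maxAbs {k : ℕ} (α : Fin k → ℤ) (j : Fin k) : (α j).natAbs ≤ maxAbs α :=
  Finset.le_sup (f := fun j => (α j).natAbs) (Finset.mem_univ j)

lemma gcdAbs_ne_zero {k : ℕ} (hk : 1 ≤ k) {α : Fin k → ℤ} (hα : ∀ j, α j ≠ 0) : gcdAbs α ≠ 0 := by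
  intro h
  have := gcdAbs_dvd α ⟨0, hk⟩
  rw [h, Nat.cast_zero, zero_dvd_iff] at this
  exact hα _ this

lemma gcdAbs_le_maxAbs {k : ℕ} (hk : 1 ≤ k) {α : Fin k → ℤ} (hα : ∀ j, α j ≠ 0) :
    gcdAbs α ≤ maxAbs α :=
  (Nat.le_of_dvd (Int.natAbs_pos.mpr (hα ⟨0, hk⟩)) (Int.natCast_dvd.mp (gcdAbs_dvd α _))).trans
    (natAbs_le_maxAbs α ⟨0, hk⟩)

lemma zpow_factorization_gcdAbs_le {k : ℕ} (hk : 1 ≤ k) {α : Fin k → ℤ} (hα : ∀ j, α j ≠ 0) {p : ℕ}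
    (hp : p.Prime) : (p : ℝ) ^ (-((gcdAbs α).factorization p : ℤ)) ≤ padicMaxAbs p α := by
  have := Fact.mk hp
  set v := (gcdAbs α).factorization p with hv
  obtain ⟨j, hj⟩ : ∃ j, ¬ p ^ (v + 1) ∣ (α j).natAbs := by
    by_contra! h
    have h1 : p ^ (v + 1) ∣ gcdAbs α := Finset.dvd_gcd fun j _ => h j
    rw [hp.pow_dvd_iff_le_factorization (gcdAbs_ne_zero hk hα)] at h1
    omega
  have hj' : padicValInt p (α j) ≤ v := by
    rw [padicValInt, ← Nat.factorization_def _ hp]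
    rw [hp.pow_dvd_iff_le_factorization (Int.natAbs_ne_zero.mpr (hα j))] at hj
    omega
  refine le_trans ?_ (le_ciSup (f := fun j => ((padicNorm p ((α j : ℚ))) : ℝ))
    (Set.finite_range _).bddAbove j)
  rw [padicNorm.eq_zpow_of_nonzero (by exact_mod_cast hα j), padicValRat.of_int]
  push_cast
  exact zpow_le_zpow_right₀ (by exact_mod_cast hp.one_lt.le) (by omega)

lemma log_c2val_ge {k : ℕ} (hk : 1 ≤ k) {α : Fin k → ℤ} (hα : ∀ j, α j ≠ 0) {S : Finset ℕ}
    (hS : ∀ p ∈ S, p.Prime) {R : Set ℕ} (hR : R.Finite) (hRp : ∀ p ∈ R, p.Prime)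
    (hRS : ∀ p ∈ R, p ≤ maxAbs α → p ∈ S) :
    0 < c2val k α R ∧ k * Real.log 2 + k * Real.log (maxAbs α) - (k + 1) * logPart S (gcdAbs α) ≤
      Real.log (c2val k α R) := by
  have hM : 0 < maxAbs α := (Int.natAbs_pos.mpr (hα ⟨0, hk⟩)).trans_le (natAbs_le_maxAbs α _)
  obtain ⟨T, rfl⟩ := hR.exists_finset_coe
  have hpos : ∀ p ∈ T, 0 < padicMaxAbs p α := fun p hp => by
    have := (hRp p hp).pos
    exact lt_of_lt_of_le (by positivity) (zpow_factorization_gcdAbs_le hk hα (hRp p hp))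
  have hprod : ∏' p : (T : Set ℕ), padicMaxAbs (p : ℕ) α ^ (k + 1) =
      ∏ p ∈ T, padicMaxAbs p α ^ (k + 1) :=
    Finset.tprod_subtype T fun p => padicMaxAbs p α ^ (k + 1)
  have hP : 0 < ∏ p ∈ T, padicMaxAbs p α ^ (k + 1) :=
    Finset.prod_pos fun p hp => pow_pos (hpos p hp) _
  rw [c2val, c1val, hprod]
  refine ⟨by positivity, ?_⟩
  rw [Real.log_mul (by positivity) hP.ne', Real.log_mul (by positivity) (by positivity),
    Real.log_pow, Real.log_pow, Real.log_prod fun p hp => (pow_pos (hpos p hp) _).ne']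
  have hsum : - logPart S (gcdAbs α) ≤ ∑ p ∈ T, Real.log (padicMaxAbs p α) := by
    rw [logPart, neg_le]
    calc -∑ p ∈ T, Real.log (padicMaxAbs p α)
        ≤ ∑ p ∈ T, ((gcdAbs α).factorization p : ℝ) * Real.log p := by
          rw [← Finset.sum_neg_distrib]
          refine Finset.sum_le_sum fun p hp => ?_
          have h0 := (hRp p hp).pos
          have := Real.log_le_log (by positivity) (zpow_factorization_gcdAbs_le hk hα (hRp p hp))
          rw [Real.log_zpow] at this
          push_cast at this
          linarith
      _ ≤ ∑ p ∈ T ∩ S, ((gcdAbs α).factorization p : ℝ) * Real.log p := by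
          refine (Finset.sum_subset Finset.inter_subset_left fun p hp hpS => ?_).ge
          rw [Nat.factorization_eq_zero_of_not_dvd, Nat.cast_zero, zero_mul]
          intro hd
          refine hpS (Finset.mem_inter.mpr ⟨hp, hRS p hp ?_⟩)
          exact (Nat.le_of_dvd (Nat.pos_of_ne_zero (gcdAbs_ne_zero hk hα)) hd).trans
            (gcdAbs_le_maxAbs hk hα)
      _ ≤ _ := Finset.sum_le_sum_of_subset_of_nonneg Finset.inter_subset_right fun p hp _ =>
          mul_nonneg (Nat.cast_nonneg _) (Real.log_nonneg (by exact_mod_cast (hS p hp).one_lt.le))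
  simp only [Real.log_pow, ← Finset.mul_sum]
  push_cast
  nlinarith

lemma factorization_factorial_mul_log_le {p : ℕ} (hp : p.Prime) (n : ℕ) :
    ((n !).factorization p : ℝ) * Real.log p ≤ n := by
  have := Fact.mk hp
  have h1 : (p - 1) * (n !).factorization p ≤ n := by
    rw [Nat.factorization_def _ hp, sub_one_mul_padicValNat_factorial]
    exact Nat.sub_le _ _
  have h2 : Real.log p ≤ ((p - 1 : ℕ) : ℝ) := by
    rw [Nat.cast_pred hp.pos]
    exact Real.log_le_sub_one_of_pos (by exact_mod_cast hp.pos)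
  calc _ ≤ ((n !).factorization p : ℝ) * ((p - 1 : ℕ) : ℝ) :=
        mul_le_mul_of_nonneg_left h2 (Nat.cast_nonneg _)
    _ ≤ n := by rw [mul_comm]; exact_mod_cast h1

lemma factorization_mul_log_le {p : ℕ} (hp : p.Prime) {n : ℕ} (hn : n ≠ 0) :
    (n.factorization p : ℝ) * Real.log p ≤ Real.log n := by
  have hp0 : (0 : ℝ) < p := by exact_mod_cast hp.pos
  rw [← Real.log_pow]
  exact Real.log_le_log (by positivity) (by exact_mod_cast Nat.ordProj_le p hn)

lemma neg_log_norm_le {p : ℕ} [Fact p.Prime] (N l e : ℕ) {G M : ℕ} (hG : G ≠ 0) (hGM : G ≤ M) :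
    Real.exp (-(N + l + e * Real.log M)) ≤ ‖((N ! * l ! * G ^ e : ℕ) : ℚ_[p])‖ := by
  have hp : p.Prime := Fact.out
  have hp0 : (0 : ℝ) < p := by exact_mod_cast hp.pos
  have hn : N ! * l ! * G ^ e ≠ 0 := by positivity
  have h2 : ‖((N ! * l ! * G ^ e : ℕ) : ℚ_[p])‖ =
      (p : ℝ) ^ (-((N ! * l ! * G ^ e).factorization p : ℤ)) := by
    rw [Nat.factorization_def _ hp, Padic.norm_eq_zpow_neg_valuation
      (by exact_mod_cast hn), Padic.valuation_natCast]
  rw [h2, ← Real.exp_log (zpow_pos hp0 _), Real.log_zpow, Real.exp_le_exp,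
    Nat.factorization_mul (by positivity) (by positivity),
    Nat.factorization_mul (by positivity) (by positivity), Nat.factorization_pow]
  simp only [Finsupp.add_apply, Finsupp.smul_apply, smul_eq_mul]
  push_cast
  have h3 := factorization_factorial_mul_log_le hp N
  have h4 := factorization_factorial_mul_log_le hp l
  have h5 : (G.factorization p : ℝ) * Real.log p ≤ Real.log M :=
    (factorization_mul_log_le hp hG).trans (Real.log_le_log (by positivity) (by exact_mod_cast hGM))
  have h6 := mul_le_mul_of_nonneg_left h5 (Nat.cast_nonneg (α := ℝ) e)
  nlinarith

lemma log_factorial_le {n : ℕ} (hn : 1 ≤ n) :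
    Real.log (n !) ≤ n * Real.log n - n + Real.log n + 1 := by
  induction n, hn using Nat.le_induction with
  | base => simp
  | succ n hn ih =>
    have hn0 : (0 : ℝ) < n := by exact_mod_cast hn
    rw [Nat.factorial_succ, Nat.cast_mul, Real.log_mul (by positivity) (by positivity)]
    have h : 1 / ((n : ℝ) + 1) ≤ Real.log (n + 1) - Real.log n := by
      have := Real.log_le_sub_one_of_pos (x := (n : ℝ) / (n + 1)) (by positivity)
      rw [Real.log_div (by positivity) (by positivity)] at this
      have e : (n : ℝ) / (n + 1) - 1 = - (1 / (n + 1)) := by field_simp; ring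
      linarith
    have h' := mul_le_mul_of_nonneg_left h (show (0 : ℝ) ≤ n + 1 by positivity)
    rw [mul_one_div_cancel (by positivity)] at h'
    push_cast
    nlinarith

lemma log_ge_of_ge {L : ℝ} (hL : 1866 ≤ L) : 6.93 ≤ Real.log L := by
  have h : Real.log (2 ^ 10) ≤ Real.log L := Real.log_le_log (by norm_num) (by linarith)
  rw [Real.log_pow] at h
  have := Real.log_two_gt_d9
  norm_num at h ⊢
  linarith

lemma log_le_of_ge {L : ℝ} (hL : 1866 ≤ L) : Real.log L ≤ L / 1866 + 6.63 := by
  have h1 := Real.log_le_sub_one_of_pos (x := L / 1866) (by positivity)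
  rw [Real.log_div (by positivity) (by norm_num)] at h1
  have h : Real.log 1866 ≤ Real.log (2 ^ 11) := Real.log_le_log (by norm_num) (by norm_num)
  rw [Real.log_pow] at h
  have := Real.log_two_lt_d9
  norm_num at h ⊢
  linarith

lemma smallness_bound {k t D L h N l B : ℝ} (hk : 1 ≤ k) (ht : 2 ≤ t) (hD : 0 < D)
    (hh : h = L * D) (hL : 1866 ≤ L)
    (hexp : 2 * (2.539 * k * t + 5.724 * k + 0.054) / D ≤ Real.log L) (hN : N ≤ k * (2 * L + 1))
    (hl0 : 0 ≤ l) (hl : l ≤ 2 * L) (hB : B ≤ Real.log L) :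
    N + l + (k + 1) * l * B ≤
      (0.0008 * k ^ 2 + 0.055 * k + 0.675) * Real.log h ^ 2 * h := by
  set x := Real.log L with hx
  have hx0 : 6.93 ≤ x := log_ge_of_ge hL
  have hLpos : 0 < L := by linarith
  have hhpos : 0 < h := by rw [hh]; positivity
  have hxD : 21.6 * k ≤ x * D := by
    rw [div_le_iff₀ hD] at hexp
    nlinarith
  have h1 : k * L * 21.6 ≤ x * h := by rw [hh]; nlinarith
  have h2 : N + l + (k + 1) * l * B ≤ 4.6 * (k * L * x) := by
    have e1 : (k + 1) * l * B ≤ (k + 1) * (2 * L) * x := by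
      refine mul_le_mul_of_nonneg (by gcongr) hB (by positivity) (by linarith)
    have e2 : 0 ≤ (k - 1) * L * x := by
      have : 0 ≤ k - 1 := by linarith
      positivity
    have e3 : 0 ≤ (k - 1) * L := mul_nonneg (by linarith) hLpos.le
    have e4 : 6.93 * (k * L) ≤ k * L * x := by nlinarith [mul_pos (by linarith : 0 < k) hLpos]
    nlinarith [mul_pos (by linarith : 0 < k) hLpos]
  have h3 : x - Real.log h ≤ x / 20 := by
    have e1 : Real.log h = x + Real.log D := by
      rw [hh, Real.log_mul hLpos.ne' hD.ne']
    have e2 : -Real.log D ≤ x / 21.6 := by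
      have hD' : 21.6 / x ≤ D := by
        rw [div_le_iff₀ (by linarith)]; nlinarith
      have e3 := Real.log_le_log (by positivity) hD'
      rw [Real.log_div (by norm_num) (by linarith)] at e3
      have e4 := Real.log_le_sub_one_of_pos (x := x / 21.6) (by positivity)
      rw [Real.log_div (by linarith) (by norm_num)] at e4
      linarith
    rw [e1]
    have : x / 21.6 ≤ x / 20 := by gcongr; linarith
    linarith
  set y := Real.log h with hy
  have h4 : x ^ 2 ≤ 1.12 * y ^ 2 := by
    have : 0.95 * x ≤ y := by linarith
    nlinarith
  calc N + l + (k + 1) * l * B ≤ 4.6 * (k * L * x) := h2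
    _ ≤ 0.22 * (x ^ 2 * h) := by
        have := mul_le_mul_of_nonneg_right h1 (show 0 ≤ x by linarith)
        nlinarith
    _ ≤ 0.22 * (1.12 * y ^ 2 * h) := by gcongr
    _ ≤ _ := by
        have : 0 ≤ y ^ 2 * h := by positivity
        have h5 : 0.675 ≤ 0.0008 * k ^ 2 + 0.055 * k + 0.675 := by nlinarith
        nlinarith

set_option maxHeartbeats 2000000 in
lemma contradiction_bound {k Φ D L h N l B P₁ P₂ P₃ F : ℝ} (hk : 1 ≤ k) (hD : 0 < D)
    (hh : h = L * D) (hL : 1866 ≤ L) (hΦ : Φ ≤ 7.55 * Real.log L)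
    (hΦ0 : 0 ≤ Φ)
    (hN : N = k * (l + 1)) (hl : l ≤ 2 * L) (hl' : 2 * L - 1 ≤ l) (hB : B ≤ Real.log L)
    (h₁ : k / (k + 1) * N * (Real.log N - (Φ + 1.9)) ≤ P₁)
    (h₂ : k / (k + 1) * l * (Real.log l - (Φ + 1.9)) ≤ P₂)
    (h₃ : k * Real.log 2 + k * B + D + k * (Real.log k + Φ + 1) ≤ (k + 1) * P₃)
    (hF : F ≤ N * Real.log N - N + Real.log N + 1)
    (hmain : P₁ + P₂ + (k + 1) * l * P₃ ≤
      Real.log (k + 1) + h + (Real.log N + (F + (k * l * Real.log 2 + N * B)))) : False := by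
  set x := Real.log L with hx
  have hk0 : 0 < k := by linarith
  have hl0 : 0 < l := by linarith
  have hlogk : 0 ≤ Real.log k := Real.log_nonneg hk
  have hlogl : 0 ≤ Real.log l := Real.log_nonneg (by linarith)
  have hNl : Real.log N = Real.log k + Real.log (l + 1) := by
    rw [hN, Real.log_mul hk0.ne' (by positivity)]
  have e1 : l * (Real.log (l + 1) - Real.log l) ≤ 1 := by
    have := Real.log_le_sub_one_of_pos (x := (l + 1) / l) (by positivity)
    rw [Real.log_div (by positivity) hl0.ne'] at this
    have h' := mul_le_mul_of_nonneg_left this hl0.le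
    have e : l * ((l + 1) / l - 1) = 1 := by field_simp; ring
    linarith
  have e2 : Real.log (l + 1) ≤ x + 0.7 := by
    have e3 : Real.log (l + 1) ≤ Real.log (2 * L * (1 + 1 / 3000)) :=
      Real.log_le_log (by positivity) (by nlinarith)
    rw [Real.log_mul (by positivity) (by norm_num),
      Real.log_mul (by norm_num) (by positivity)] at e3
    have e4 := Real.log_le_sub_one_of_pos (x := (1 : ℝ) + 1 / 3000) (by norm_num)
    have := Real.log_two_lt_d9
    linarith
  have e5 : Real.log k ≤ k - 1 := Real.log_le_sub_one_of_pos hk0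
  have e6 : Real.log (k + 1) ≤ k := by
    have := Real.log_le_sub_one_of_pos (x := k + 1) (by positivity)
    linarith
  have hxL := log_le_of_ge hL
  set κ := k / (k + 1) with hκ
  have hκ0 : 0 ≤ κ := by positivity
  have hκ1 : κ ≤ 1 := by rw [hκ, div_le_one (by positivity)]; linarith
  have hκk : κ * k = k - κ := by rw [hκ]; field_simp; ring
  set y := Real.log (l + 1) with hy
  set z := Real.log l with hz
  set q := Real.log k with hq
  have f1 : κ * N = (k - κ) * (l + 1) := by rw [hN, ← hκk]; ring
  have f2 : κ * (l * (y - z)) ≤ κ * 1 := mul_le_mul_of_nonneg_left e1 hκ0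
  have f3 : l * (k * Real.log 2 + k * B + D + k * (q + Φ + 1)) ≤ (k + 1) * l * P₃ := by
    have := mul_le_mul_of_nonneg_left h₃ hl0.le
    linarith
  have hy0 : 0 ≤ y := Real.log_nonneg (by linarith)
  have f4 : κ * (q + y + 1) ≤ 1 * (q + y + 1) := by gcongr
  have f5 : 0 ≤ l * q * (k - κ) := mul_nonneg (mul_nonneg hl0.le hlogk) (by linarith)
  have f6 : 0 ≤ κ * (Φ + 1.9) := mul_nonneg hκ0 (by linarith)
  rw [hNl] at h₁ hF hmain
  have g1 : (k - κ) * (l + 1) * (q + y - (Φ + 1.9)) + κ * l * (z - (Φ + 1.9)) +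
      l * (k * Real.log 2 + k * B + D + k * (q + Φ + 1)) ≤
      Real.log (k + 1) + h + (q + y + ((N * (q + y) - N + (q + y) + 1) +
        (k * l * Real.log 2 + N * B))) := by
    rw [f1] at h₁
    linarith only [h₁, h₂, f3, hmain, hF]
  have g2 : 0.1 * (k * l) + (l * D - h) ≤
      Real.log (k + 1) + 3 * (q + y) + 2 + k * Φ + 0.9 * k + k * B := by
    rw [hN] at g1
    have := Real.log_two_gt_d9
    linarith only [g1, f2, f4, f5, f6]
  have g3 : 0 ≤ l * D - h := by
    rw [hh]; nlinarith
  have g4 : k * (2 * L - 1) ≤ k * l := by gcongr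
  have g5 : k * Φ ≤ k * (7.55 * x) := by gcongr
  have g6 : k * B ≤ k * x := by gcongr
  have g7 : 3 * x + 1.1 ≤ k * (3 * x + 1.1) := by
    have := log_ge_of_ge hL
    nlinarith
  have g8 : 0.1 * (k * (2 * L - 1)) ≤ k * (11.55 * x + 6) := by nlinarith
  have g9 : 0.1 * (2 * L - 1) ≤ 11.55 * x + 6 := by
    refine le_of_mul_le_mul_left ?_ hk0
    linarith
  linarith

set_option maxHeartbeats 2000000 in
/-- The Padé part of the argument, given a lower bound for the `R`-part of factorials. -/
theorem exists_prime_of_logPart_ge (k m : ℕ) (hk : 1 ≤ k) (hm : 3 ≤ m)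
    (lam : Fin (k + 1) → ℤ) (hlam : ∃ i, lam i ≠ 0)
    (A : Finset ℕ)
    (R : Set ℕ) (hR : R = {p : ℕ | p.Prime ∧ p % m ∈ A})
    (hkey : ∀ (S : Finset ℕ) (n : ℕ), 1 ≤ n →
      (∀ p : ℕ, p.Prime → p ≤ n → p % m ∈ A → p ∈ S) → (∀ p ∈ S, p.Prime) →
      (k : ℝ) / (k + 1) * n * (Real.log n - ((Real.log m + 6.550) * m.totient + 1.9)) ≤
        logPart S (n !))
    (α : Fin k → ℤ) (hα : ∀ j, α j ≠ 0) (hαinj : Function.Injective α)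
    (R' : Set ℕ)
    (hR' : R' = R ∩ Set.Icc 2 (k * (max (max 1865 (m ^ m.totient)) (maxAbs α) + 2)))
    (hc2 : c2val k α R' <
      ((k : ℝ) * Real.exp (1 + 6.550 * m.totient) * (m : ℝ) ^ m.totient) ^ (-(k : ℤ)))
    (D : ℝ) (hD : D = Dval m k α R')
    (H : ℝ) (hH : ∀ i, (|lam i| : ℝ) ≤ H)
    (hlogH : Real.log H / D ≥
      max (max 1866 ((m : ℝ) ^ m.totient + 1))
        (max ((maxAbs α : ℝ) + 1)
          (Real.exp (2 * (2.539 * k * m.totient + 5.724 * k + 0.054) / D) + 1))) :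
    ∃ p ∈ R ∩ {p : ℕ | 2 ≤ p ∧ (p : ℝ) < 2 * k * Real.log H / D + 2 * k},
      ∃ _ : Fact p.Prime,
      H ^ (-((0.0008 * k ^ 2 + 0.055 * k + 0.675) * Real.log (Real.log H) ^ 2)) <
        ‖(lam 0 : ℚ_[p]) + ∑ j : Fin k, (lam j.succ : ℚ_[p]) * eulerF p (α j)‖ := by
  set L := Real.log H / D with hLdef
  have hL : 1866 ≤ L := ((le_max_left _ _).trans (le_max_left _ _)).trans hlogH
  have hLm : (m : ℝ) ^ m.totient + 1 ≤ L := ((le_max_right _ _).trans (le_max_left _ _)).trans hlogH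
  have hLM : (maxAbs α : ℝ) + 1 ≤ L := ((le_max_left _ _).trans (le_max_right _ _)).trans hlogH
  have hLe : Real.exp (2 * (2.539 * k * m.totient + 5.724 * k + 0.054) / D) + 1 ≤ L :=
    ((le_max_right _ _).trans (le_max_right _ _)).trans hlogH
  have hL0 : 0 < L := by linarith
  have hk1 : (1 : ℝ) ≤ k := by exact_mod_cast hk
  have hm3 : (3 : ℝ) ≤ m := by exact_mod_cast hm
  have hM1 : 1 ≤ maxAbs α := (Int.natAbs_pos.mpr (hα ⟨0, hk⟩)).trans_le (natAbs_le_maxAbs α _)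
  have hM1' : (1 : ℝ) ≤ maxAbs α := by exact_mod_cast hM1
  set l := ⌊2 * L⌋₊ with hl
  set N := k * (l + 1) with hN
  have hl1 : (l : ℝ) ≤ 2 * L := Nat.floor_le (by positivity)
  have hl2 : 2 * L - 1 ≤ l := by
    have := Nat.lt_floor_add_one (2 * L)
    linarith
  have hNr : (N : ℝ) = k * (l + 1) := by rw [hN]; push_cast; ring
  set S : Finset ℕ := (Finset.range (N + 1)).filter fun p => p.Prime ∧ p % m ∈ A with hS
  have hSp : ∀ p ∈ S, p.Prime := fun p hp => (Finset.mem_filter.mp hp).2.1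
  have hSmem : ∀ p : ℕ, p.Prime → p ≤ N → p % m ∈ A → p ∈ S := fun p h1 h2 h3 =>
    Finset.mem_filter.mpr ⟨Finset.mem_range.mpr (by omega), h1, h3⟩
  have hMN : maxAbs α ≤ N := by
    have : (maxAbs α : ℝ) ≤ N := by rw [hNr]; nlinarith
    exact_mod_cast this
  obtain ⟨hc2pos, hc2log⟩ := log_c2val_ge hk hα hSp (R := R')
    ((Set.finite_Icc _ _).subset (hR' ▸ Set.inter_subset_right))
    (fun p hp => by rw [hR', hR] at hp; exact hp.1.1)
    (fun p hp hpM => by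
      rw [hR', hR] at hp
      exact hSmem p hp.1.1 (hpM.trans hMN) hp.1.2)
  set Φ : ℝ := (Real.log m + 6.550) * m.totient with hΦ
  have hDe : D = -(Real.log (c2val k α R') + k * (Real.log k + Φ + 1)) := hD
  have hD0 : 0 < D := by
    have h1 := Real.log_lt_log hc2pos hc2
    rw [Real.log_zpow, Real.log_mul (by positivity) (by positivity),
      Real.log_mul (by positivity) (by positivity), Real.log_exp, Real.log_pow] at h1
    push_cast at h1
    rw [hDe, hΦ]
    nlinarith
  have hhL : Real.log H = L * D := by rw [hLdef]; field_simp
  have hh0 : 0 < Real.log H := by rw [hhL]; positivity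
  have hH0 : 0 < H := by
    refine lt_of_le_of_ne ((abs_nonneg _).trans (hH 0)) fun h => ?_
    rw [← h, Real.log_zero] at hh0
    exact lt_irrefl _ hh0
  have hφ : 2 ≤ m.totient := by
    have h1 : 0 < m.totient := Nat.totient_pos.mpr (by omega)
    obtain ⟨c, hc⟩ := Nat.totient_even (n := m) (by omega)
    omega
  have hφ' : (2 : ℝ) ≤ m.totient := by exact_mod_cast hφ
  have hBL : Real.log (maxAbs α) ≤ Real.log L := Real.log_le_log (by positivity) (by linarith)
  have hexp : 2 * (2.539 * k * m.totient + 5.724 * k + 0.054) / D ≤ Real.log L := by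
    rw [Real.le_log_iff_exp_le hL0]; linarith
  have hlogm : (1 : ℝ) ≤ Real.log m := by
    rw [Real.le_log_iff_exp_le (by linarith)]
    have := Real.exp_one_lt_d9
    linarith
  have hφm : m.totient * Real.log m ≤ Real.log L := by
    rw [← Real.log_pow]
    exact Real.log_le_log (by positivity) (by linarith)
  have hΦL : Φ ≤ 7.55 * Real.log L := by
    rw [hΦ]; nlinarith
  have hΦ0 : 0 ≤ Φ := by rw [hΦ]; positivity
  by_contra! hcon
  have hsmall : ∀ p ∈ S, ∀ _ : Fact p.Prime,
      ‖(lam 0 : ℚ_[p]) + ∑ j : Fin k, (lam j.succ : ℚ_[p]) * eulerF p (α j)‖ ≤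
        ‖(((k * (l + 1))! * l ! * gcdAbs α ^ ((k + 1) * l) : ℕ) : ℚ_[p])‖ := by
    intro p hp hfact
    obtain ⟨h1, h2, h3⟩ := Finset.mem_filter.mp hp
    refine (hcon p ⟨by rw [hR]; exact ⟨h2, h3⟩, h2.two_le, ?_⟩ hfact).trans ?_
    · have : (p : ℝ) ≤ N := by exact_mod_cast (Nat.lt_succ_iff.mp (Finset.mem_range.mp h1))
      rw [mul_div_assoc, ← hLdef]
      rw [hNr] at this
      nlinarith
    · refine le_trans ?_ (neg_log_norm_le N l ((k + 1) * l) (gcdAbs_ne_zero hk hα)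
        (gcdAbs_le_maxAbs hk hα))
      rw [Real.rpow_def_of_pos hH0, Real.exp_le_exp]
      have := smallness_bound hk1 hφ' hD0 hhL hL hexp (N := N) (by rw [hNr]; gcongr)
        (Nat.cast_nonneg l) hl1 hBL
      push_cast
      linarith
  have hmain := logPart_le_of_forall_small hk l hα hαinj (gcdAbs_ne_zero hk hα) (gcdAbs_dvd α)
    (natAbs_le_maxAbs α) hlam hH hSp hsmall
  have hl3 : 1 ≤ l := by
    have : (1 : ℝ) ≤ l := by linarith
    exact_mod_cast this
  have hN1 : 1 ≤ N := Nat.mul_pos hk (Nat.succ_pos l)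
  have hlN : l ≤ N := (Nat.le_succ l).trans (Nat.le_mul_of_pos_left _ hk)
  have h1 := hkey S N hN1 hSmem hSp
  have h2 := hkey S l hl3 (fun p hp hpl => hSmem p hp (hpl.trans hlN)) hSp
  have hlpos : (0 : ℝ) < l := by exact_mod_cast hl3
  rw [← hN, ← hNr, Real.log_mul (by positivity) (by positivity),
    Real.log_mul (by positivity) (by positivity), Real.log_mul (by positivity) (by positivity),
    Real.log_mul (by positivity) (by positivity), Real.log_mul (by positivity) (by positivity),
    Real.log_pow, Real.log_pow] at hmain
  push_cast at hmain
  refine contradiction_bound hk1 hD0 hhL hL hΦL hΦ0 hNr hl1 hl2 hBL h1 h2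
    (P₃ := logPart S (gcdAbs α)) ?_ (log_factorial_le hN1) ?_
  · rw [hDe]; linarith
  · rw [hNr] at hmain ⊢
    linarith

open Complex Metric in
lemma integral_circleMap_mul_exp_neg {f : ℂ → ℂ} {c : ℂ} {r : ℝ} (hr : 0 < r)
    (hf : DifferentiableOn ℂ f (closedBall c r)) (n : ℕ) :
    ∫ θ in (0 : ℝ)..2 * π, f (circleMap c r θ) * cexp (-(n * θ * I)) =
      2 * π * r ^ n / (n ! : ℂ) * iteratedDeriv n f c := by
  have h := DifferentiableOn.circleIntegral_one_div_sub_center_pow_smul hr n hf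
  have hr' : (r : ℂ) ≠ 0 := by exact_mod_cast hr.ne'
  rw [circleIntegral] at h
  have h2 : ∀ θ : ℝ, deriv (circleMap c r) θ • (1 / (circleMap c r θ - c) ^ (n + 1)) •
      f (circleMap c r θ) =
      (I / r ^ n) * (f (circleMap c r θ) * cexp (-(n * θ * I))) := by
    intro θ
    have he : cexp (θ * I) ≠ 0 := Complex.exp_ne_zero _
    have : cexp (-(n * θ * I)) = 1 / (cexp (θ * I)) ^ n := by
      rw [← Complex.exp_nat_mul, one_div, ← Complex.exp_neg, mul_assoc]
    rw [deriv_circleMap, this]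
    simp only [circleMap, zero_add, add_sub_cancel_left, smul_eq_mul]
    field_simp
    ring
  simp_rw [h2] at h
  rw [intervalIntegral.integral_const_mul, smul_eq_mul] at h
  have hI : I ≠ 0 := I_ne_zero
  have hn : (n ! : ℂ) ≠ 0 := by exact_mod_cast Nat.factorial_ne_zero n
  field_simp at h ⊢
  linear_combination h

open Complex Metric in
lemma integral_circleMap_mul_exp {f : ℂ → ℂ} {c : ℂ} {r : ℝ} (hr : 0 < r)
    (hf : DifferentiableOn ℂ f (closedBall c r)) (n : ℕ) :
    ∫ θ in (0 : ℝ)..2 * π, f (circleMap c r θ) * cexp ((n + 1) * θ * I) = 0 := by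
  have hd : DifferentiableOn ℂ (fun z => (z - c) ^ n * f z) (closedBall c r) := by fun_prop
  have h := DiffContOnCl.circleIntegral_eq_zero hr.le (hd.diffContOnCl_ball subset_rfl)
  have hr' : (r : ℂ) ≠ 0 := by exact_mod_cast hr.ne'
  rw [circleIntegral] at h
  have h2 : ∀ θ : ℝ, deriv (circleMap c r) θ • ((circleMap c r θ - c) ^ n *
      f (circleMap c r θ)) =
      (I * r ^ (n + 1)) * (f (circleMap c r θ) * cexp ((n + 1) * θ * I)) := by
    intro θ
    have : cexp ((n + 1) * θ * I) = (cexp (θ * I)) ^ (n + 1) := by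
      rw [← Complex.exp_nat_mul, mul_assoc]; push_cast; rfl
    rw [deriv_circleMap, this]
    simp only [circleMap, zero_add, add_sub_cancel_left, smul_eq_mul]
    ring
  simp_rw [h2] at h
  rw [intervalIntegral.integral_const_mul] at h
  exact (mul_eq_zero.mp h).resolve_left (mul_ne_zero I_ne_zero (pow_ne_zero _ hr'))

open Complex Metric in
/-- Carathéodory's coefficient inequality on a closed disc. -/
lemma pow_mul_norm_iteratedDeriv_le {f : ℂ → ℂ} {c : ℂ} {r M : ℝ} (hr : 0 < r)
    (hf : DifferentiableOn ℂ f (closedBall c r)) (h0 : f c = 0)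
    (hM : ∀ z ∈ closedBall c r, (f z).re ≤ M) (n : ℕ) :
    r ^ (n + 1) * (‖iteratedDeriv (n + 1) f c‖ / (n + 1)!) ≤ 2 * M := by
  set g : ℝ → ℂ := fun θ => f (circleMap c r θ) with hg
  have hmem : ∀ θ, circleMap c r θ ∈ closedBall c r := circleMap_mem_closedBall c hr.le
  have hgc : Continuous g :=
    continuousOn_univ.mp (hf.continuousOn.comp (continuous_circleMap c r).continuousOn
      fun θ _ => hmem θ)
  have hmean : ∫ θ in (0 : ℝ)..2 * π, g θ = 0 := by
    have := integral_circleMap_mul_exp_neg hr hf 0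
    simpa [h0] using this
  have hre : ∫ θ in (0 : ℝ)..2 * π, (g θ).re = 0 := by
    have h := Complex.reCLM.intervalIntegral_comp_comm
      (hgc.intervalIntegrable (μ := MeasureTheory.volume) 0 (2 * π))
    rw [hmean] at h
    simpa using h
  set e : ℝ → ℂ := fun θ => cexp (-((n + 1 : ℕ) * θ * I)) with he
  have hec : Continuous e := by fun_prop
  have h1 : ∫ θ in (0 : ℝ)..2 * π, g θ * e θ =
      2 * π * r ^ (n + 1) / ((n + 1)! : ℂ) * iteratedDeriv (n + 1) f c :=
    integral_circleMap_mul_exp_neg hr hf (n + 1)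
  have h2 : ∫ θ in (0 : ℝ)..2 * π, (starRingEnd ℂ) (g θ) * e θ = 0 := by
    have h := integral_circleMap_mul_exp hr hf n
    have h' := congrArg (starRingEnd ℂ) h
    rw [← intervalIntegral.intervalIntegral_conj, map_zero] at h'
    rw [← h']
    congr 1
    ext θ
    rw [map_mul, ← Complex.exp_conj]
    simp [hg, he]
  have h3 : ∫ θ in (0 : ℝ)..2 * π, e θ = 0 := by
    have := integral_circleMap_mul_exp_neg (f := fun _ => 1) (c := c) hr
      (differentiableOn_const _) (n + 1)
    simpa [he, iteratedDeriv_const] using this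
  have h4 : ∫ θ in (0 : ℝ)..2 * π, ((2 * (M - (g θ).re) : ℝ) : ℂ) * e θ =
      -(2 * π * r ^ (n + 1) / ((n + 1)! : ℂ) * iteratedDeriv (n + 1) f c) := by
    have : ∀ θ, ((2 * (M - (g θ).re) : ℝ) : ℂ) * e θ =
        2 * M * e θ - (g θ * e θ + (starRingEnd ℂ) (g θ) * e θ) := by
      intro θ
      have := Complex.add_conj (g θ)
      push_cast at this ⊢
      linear_combination e θ * this
    simp_rw [this]
    have i1 : Continuous fun θ => (starRingEnd ℂ) (g θ) * e θ :=
      (Complex.continuous_conj.comp hgc).mul hec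
    rw [intervalIntegral.integral_sub
      (Continuous.intervalIntegrable (by fun_prop) _ _)
      (Continuous.intervalIntegrable (by fun_prop) _ _),
      intervalIntegral.integral_add (Continuous.intervalIntegrable (by fun_prop) _ _)
      (i1.intervalIntegrable _ _), intervalIntegral.integral_const_mul, h1, h2, h3]
    ring
  have h5 : ‖∫ θ in (0 : ℝ)..2 * π, ((2 * (M - (g θ).re) : ℝ) : ℂ) * e θ‖ ≤
      ∫ θ in (0 : ℝ)..2 * π, 2 * (M - (g θ).re) := by
    refine intervalIntegral.norm_integral_le_of_norm_le two_pi_pos.le ?_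
      (Continuous.intervalIntegrable (by fun_prop) _ _)
    refine Eventually.of_forall fun θ _ => ?_
    have hen : ‖e θ‖ = 1 := by
      rw [he]
      have : -(((n + 1 : ℕ) : ℂ) * θ * I) = ((-((n + 1 : ℕ) * θ) : ℝ) : ℂ) * I := by
        push_cast; ring
      simp only [this, Complex.norm_exp_ofReal_mul_I]
    rw [norm_mul, hen, mul_one, Complex.norm_real, Real.norm_eq_abs, abs_of_nonneg]
    linarith [hM _ (hmem θ)]
  have h6 : ∫ θ in (0 : ℝ)..2 * π, 2 * (M - (g θ).re) = 2 * π * (2 * M) := by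
    rw [intervalIntegral.integral_const_mul, intervalIntegral.integral_sub
      (by simp) (Continuous.intervalIntegrable (by fun_prop) _ _), hre]
    simp
    ring
  rw [h4, h6, norm_neg, norm_mul, norm_div, norm_mul, norm_mul, norm_pow] at h5
  simp only [Complex.norm_ofNat, Complex.norm_real, Complex.norm_natCast, Real.norm_eq_abs,
    abs_of_pos pi_pos, abs_of_pos hr] at h5
  refine le_of_mul_le_mul_left ?_ two_pi_pos
  calc 2 * π * (r ^ (n + 1) * (‖iteratedDeriv (n + 1) f c‖ / (n + 1)!)) =
      2 * π * r ^ (n + 1) / (n + 1)! * ‖iteratedDeriv (n + 1) f c‖ := by ring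
    _ ≤ _ := h5

open Complex Metric in
/-- Carathéodory's coefficient inequality on an open disc. -/
lemma pow_mul_norm_iteratedDeriv_le_of_ball {f : ℂ → ℂ} {c : ℂ} {R M : ℝ} (hR : 0 < R)
    (hf : DifferentiableOn ℂ f (ball c R)) (h0 : f c = 0)
    (hM : ∀ z ∈ ball c R, (f z).re ≤ M) (n : ℕ) :
    R ^ (n + 1) * (‖iteratedDeriv (n + 1) f c‖ / (n + 1)!) ≤ 2 * M := by
  have ht : Tendsto (fun r : ℝ => r ^ (n + 1) * (‖iteratedDeriv (n + 1) f c‖ / (n + 1)!))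
      (nhdsWithin R (Set.Iio R))
      (nhds (R ^ (n + 1) * (‖iteratedDeriv (n + 1) f c‖ / (n + 1)!))) :=
    (Continuous.tendsto (by fun_prop) R).mono_left nhdsWithin_le_nhds
  refine le_of_tendsto ht ?_
  filter_upwards [Ioo_mem_nhdsLT hR] with r hr
  exact pow_mul_norm_iteratedDeriv_le hr.1 (hf.mono (closedBall_subset_ball hr.2)) h0
    (fun z hz => hM z (closedBall_subset_ball hr.2 hz)) n

variable {m : ℕ}

lemma sum_range_dirichletCharacter [NeZero m] {χ : DirichletCharacter ℂ m} (hχ : χ ≠ 1) :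
    ∑ k ∈ Finset.range m, χ (k : ZMod m) = 0 := by
  rw [← MulChar.sum_eq_zero_of_ne_one hχ]
  refine Finset.sum_bij (fun k _ => (k : ZMod m)) (by simp) ?_ ?_ (by simp)
  · intro a ha b hb h
    rw [ZMod.natCast_eq_natCast_iff'] at h
    rwa [Nat.mod_eq_of_lt (Finset.mem_range.1 ha), Nat.mod_eq_of_lt (Finset.mem_range.1 hb)] at h
  · intro b _
    exact ⟨b.val, Finset.mem_range.2 (ZMod.val_lt b), by simp⟩

lemma norm_sum_dirichletCharacter_le_card (χ : DirichletCharacter ℂ m) (s : Finset ℕ) :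
    ‖∑ k ∈ s, χ (k : ZMod m)‖ ≤ (s.filter (fun k => m.Coprime k)).card := by
  calc ‖∑ k ∈ s, χ (k : ZMod m)‖ ≤ ∑ k ∈ s, ‖χ (k : ZMod m)‖ := norm_sum_le _ _
    _ ≤ ∑ k ∈ s, if m.Coprime k then 1 else 0 := by
        refine Finset.sum_le_sum fun k _ => ?_
        split_ifs with h
        · exact χ.norm_le_one _
        · rw [χ.map_nonunit (by rwa [ZMod.isUnit_iff_coprime, Nat.coprime_comm]), norm_zero]
    _ = _ := by simp

/-- Partial sums of a nontrivial Dirichlet character are at most half the totient. -/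
lemma norm_sum_range_dirichletCharacter_le [NeZero m] {χ : DirichletCharacter ℂ m} (hχ : χ ≠ 1)
    (N : ℕ) : ‖∑ k ∈ Finset.range N, χ (k : ZMod m)‖ ≤ (φ m : ℝ) / 2 := by
  have hper : Function.Periodic (fun N => ∑ k ∈ Finset.range N, χ (k : ZMod m)) m := by
    intro N
    simp only
    rw [add_comm N m, Finset.sum_range_add, sum_range_dirichletCharacter hχ, zero_add]
    simp
  have h1 := hper.map_mod_nat N
  rw [← h1]
  set r := N % m
  have hr : r ≤ m := (Nat.mod_lt _ (NeZero.pos m)).le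
  have h2 := norm_sum_dirichletCharacter_le_card χ (Finset.range r)
  have h3 := norm_sum_dirichletCharacter_le_card χ (Finset.Ico r m)
  have h4 := Finset.sum_range_add_sum_Ico (fun k : ℕ => χ (k : ZMod m)) hr
  rw [sum_range_dirichletCharacter hχ] at h4
  rw [← neg_eq_of_add_eq_zero_right h4, norm_neg] at h3
  have h5 : ((Finset.range r).filter (fun k => m.Coprime k)).card +
      ((Finset.Ico r m).filter (fun k => m.Coprime k)).card = φ m := by
    rw [Nat.totient_eq_card_coprime, Finset.card_filter, Finset.card_filter, Finset.card_filter]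
    exact Finset.sum_range_add_sum_Ico _ hr
  have h6 : (((Finset.range r).filter (fun k => m.Coprime k)).card : ℝ) +
      ((Finset.Ico r m).filter (fun k => m.Coprime k)).card = φ m := by exact_mod_cast h5
  linarith

lemma norm_sum_Icc_dirichletCharacter_le (hm : 1 < m) {χ : DirichletCharacter ℂ m} (hχ : χ ≠ 1)
    (N : ℕ) : ‖∑ k ∈ Finset.Icc 1 N, χ (k : ZMod m)‖ ≤ (φ m : ℝ) / 2 := by
  have : NeZero m := ⟨by omega⟩
  have : Fact (1 < m) := ⟨hm⟩
  have h := norm_sum_range_dirichletCharacter_le hχ (N + 1)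
  rw [Finset.sum_range_succ'] at h
  simp only [Nat.cast_zero, MulChar.map_zero, add_zero] at h
  rw [Finset.range_eq_Ico, Finset.sum_Ico_add' (fun k : ℕ => χ (k : ZMod m)) 0 N 1] at h
  exact h

open Set in
/-- The integral representation of a Dirichlet `L`-function on the right half plane. -/
lemma LFunction_eq_mul_integral (hm : 1 < m) {χ : DirichletCharacter ℂ m} (hχ : χ ≠ 1)
    [NeZero m] {s : ℂ} (hs : 0 < s.re) :
    χ.LFunction s =
      s * ∫ t in Ioi (1 : ℝ), (∑ k ∈ Finset.Icc 1 ⌊t⌋₊, χ (k : ZMod m)) * (t : ℂ) ^ (-(s + 1)) := by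
  set g : ℝ → ℂ := fun t => ∑ k ∈ Finset.Icc 1 ⌊t⌋₊, χ (k : ZMod m) with hg
  have hgb : ∀ t, ‖g t‖ ≤ (φ m : ℝ) / 2 := fun t => norm_sum_Icc_dirichletCharacter_le hm hχ _
  have hgm : Measurable g :=
    (measurable_from_nat (f := fun n => ∑ k ∈ Finset.Icc 1 n, χ (k : ZMod m))).comp
      Nat.measurable_floor
  have hg0 : ∀ t, t < 1 → g t = 0 := by
    intro t ht
    simp [hg, Nat.floor_eq_zero.2 ht]
  have hmel : ∀ z : ℂ, mellin g (-z) = ∫ t in Ioi (1 : ℝ), g t * (t : ℂ) ^ (-(z + 1)) := by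
    intro z
    rw [mellin, MeasureTheory.setIntegral_eq_of_subset_of_forall_sdiff_eq_zero measurableSet_Ioi
      (s := Ici 1) (fun t ht => lt_of_lt_of_le zero_lt_one ht)
      (fun t ht => by rw [hg0 t (not_le.1 ht.2), smul_zero]),
      MeasureTheory.integral_Ici_eq_integral_Ioi]
    refine MeasureTheory.setIntegral_congr_fun measurableSet_Ioi fun t _ => ?_
    simp only [smul_eq_mul]
    rw [mul_comm]
    congr 2
    ring
  have hdiff : ∀ z : ℂ, 0 < z.re → DifferentiableAt ℂ (mellin g) (-z) := by
    intro z hz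
    refine mellin_differentiableAt_of_isBigO_rpow (a := 0) (b := (-z).re - 1) ?_ ?_ (by simpa) ?_
      (by linarith)
    · refine (MeasureTheory.LocallyIntegrable.mono
        (MeasureTheory.locallyIntegrable_const ((φ m : ℝ) / 2)) hgm.aestronglyMeasurable
        (Eventually.of_forall fun t => ?_)).locallyIntegrableOn _
      exact (hgb t).trans (le_abs_self _)
    · refine Asymptotics.IsBigO.of_bound ((φ m : ℝ) / 2) (Eventually.of_forall fun t => ?_)
      simpa using hgb t
    · refine Asymptotics.IsBigO.of_bound 1 ?_
      filter_upwards [Ioo_mem_nhdsGT (show (0 : ℝ) < 1 by norm_num)] with t ht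
      rw [hg0 t ht.2, norm_zero]
      positivity
  have hopen : IsOpen {z : ℂ | 0 < z.re} := isOpen_lt continuous_const Complex.continuous_re
  have hpre : IsPreconnected {z : ℂ | 0 < z.re} :=
    (convex_halfSpace_re_gt 0).isPreconnected
  have h1 : AnalyticOnNhd ℂ χ.LFunction {z : ℂ | 0 < z.re} :=
    (DirichletCharacter.differentiable_LFunction hχ).differentiableOn.analyticOnNhd hopen
  have h2 : AnalyticOnNhd ℂ (fun z => z * mellin g (-z)) {z : ℂ | 0 < z.re} := by
    refine DifferentiableOn.analyticOnNhd (fun z hz => ?_) hopen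
    exact (differentiableAt_id.mul
      ((hdiff z hz).comp z differentiableAt_id.neg)).differentiableWithinAt
  rw [← hmel]
  refine h1.eqOn_of_preconnected_of_eventuallyEq h2 hpre (z₀ := 2) (by simp) ?_ hs
  have hopen1 : IsOpen {z : ℂ | 1 < z.re} := isOpen_lt continuous_const Complex.continuous_re
  filter_upwards [hopen1.mem_nhds (show (2 : ℂ) ∈ {z : ℂ | 1 < z.re} by simp)] with z hz
  rw [DirichletCharacter.LFunction_eq_LSeries χ hz, hmel,
    LSeries_eq_mul_integral (fun n : ℕ => χ (n : ZMod m)) le_rfl (lt_trans zero_lt_one hz)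
    (DirichletCharacter.LSeriesSummable_of_one_lt_re χ hz)]
  refine Asymptotics.IsBigO.of_bound ((φ m : ℝ) / 2) (Eventually.of_forall fun t => ?_)
  simpa using norm_sum_Icc_dirichletCharacter_le hm hχ t

open Set in
lemma norm_LFunction_le (hm : 1 < m) {χ : DirichletCharacter ℂ m} (hχ : χ ≠ 1)
    [NeZero m] {s : ℂ} (hs : 0 < s.re) :
    ‖χ.LFunction s‖ ≤ ‖s‖ * ((φ m : ℝ) / 2 / s.re) := by
  rw [LFunction_eq_mul_integral hm hχ hs, norm_mul]
  gcongr
  have hlt : -(s.re + 1) < -1 := by linarith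
  have h := integral_Ioi_rpow_of_lt hlt zero_lt_one
  have hint := integrableOn_Ioi_rpow_of_lt hlt zero_lt_one
  calc _ ≤ ∫ t in Ioi (1 : ℝ), (φ m : ℝ) / 2 * t ^ (-(s.re + 1)) := by
        refine MeasureTheory.norm_integral_le_of_norm_le (hint.const_mul _) ?_
        refine (MeasureTheory.ae_restrict_mem measurableSet_Ioi).mono fun t ht => ?_
        rw [norm_mul, Complex.norm_cpow_eq_rpow_re_of_pos (lt_trans zero_lt_one ht)]
        have := norm_sum_Icc_dirichletCharacter_le hm hχ ⌊t⌋₊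
        have ht0 : 0 < t := lt_trans zero_lt_one ht
        simp only [Complex.neg_re, Complex.add_re, Complex.one_re]
        gcongr
    _ = _ := by
        rw [MeasureTheory.integral_const_mul, h]
        simp
        field_simp

end EulerPade

namespace EulerPade

open Metric in
/-- Coefficient bounds for the logarithmic derivative of a zero-free function on a disc. -/
lemma norm_iteratedDeriv_logDeriv_le {L : ℂ → ℂ} {c : ℂ} {R B : ℝ} (hR : 0 < R)
    (hL : DifferentiableOn ℂ L (ball c R)) (h0 : ∀ z ∈ ball c R, L z ≠ 0)
    (hB : ∀ z ∈ ball c R, ‖L z‖ ≤ ‖L c‖ * Real.exp B) (n : ℕ) :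
    ‖iteratedDeriv n (logDeriv L) c‖ / n ! ≤ (n + 1) * (2 * B / R ^ (n + 1)) := by
  have hc : c ∈ ball c R := mem_ball_self hR
  have hg : DifferentiableOn ℂ (logDeriv L) (ball c R) :=
    (hL.deriv isOpen_ball).div hL h0
  obtain ⟨f₀, hf₀⟩ := hg.isExactOn_ball
  set f : ℂ → ℂ := fun z => f₀ z - f₀ c with hf
  have hfd : ∀ z ∈ ball c R, HasDerivAt f (logDeriv L z) z := fun z hz =>
    (hf₀ z hz).sub_const _
  have hfc : f c = 0 := sub_self _
  have hexp : ∀ z ∈ ball c R, L z * Complex.exp (-f z) = L c := by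
    have hd : ∀ z ∈ ball c R, HasDerivAt (fun z => L z * Complex.exp (-f z)) 0 z := by
      intro z hz
      have h1 := ((hL.differentiableAt (isOpen_ball.mem_nhds hz)).hasDerivAt).mul
        (hfd z hz).neg.cexp
      refine h1.congr_deriv ?_
      have := h0 z hz
      rw [logDeriv_apply]
      field_simp
      simp
    intro z hz
    have h2 := isOpen_ball.is_const_of_deriv_eq_zero (convex_ball c R).isPreconnected
      (fun z hz => (hd z hz).differentiableAt.differentiableWithinAt)
      (fun z hz => (hd z hz).deriv) hz hc
    simpa [hfc] using h2
  have hre : ∀ z ∈ ball c R, (f z).re ≤ B := by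
    intro z hz
    have h1 := hexp z hz
    rw [Complex.exp_neg, ← div_eq_mul_inv, div_eq_iff (Complex.exp_ne_zero _)] at h1
    have h2 := hB z hz
    rw [h1, norm_mul, Complex.norm_exp] at h2
    exact Real.exp_le_exp.1 (le_of_mul_le_mul_left h2 (norm_pos_iff.2 (h0 c hc)))
  have h3 := pow_mul_norm_iteratedDeriv_le_of_ball hR
    (fun z hz => (hfd z hz).differentiableAt.differentiableWithinAt) hfc hre n
  have h4 : iteratedDeriv (n + 1) f c = iteratedDeriv n (logDeriv L) c := by
    rw [iteratedDeriv_succ']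
    refine Filter.EventuallyEq.iteratedDeriv_eq n ?_
    filter_upwards [isOpen_ball.mem_nhds hc] with z hz using (hfd z hz).deriv
  rw [h4, Nat.factorial_succ, Nat.cast_mul] at h3
  have hn : (0 : ℝ) < n ! := by exact_mod_cast Nat.factorial_pos n
  have hRn : 0 < R ^ (n + 1) := by positivity
  rw [← mul_div_assoc, div_le_iff₀ (by positivity)] at h3
  rw [← mul_div_assoc, div_le_div_iff₀ hn hRn]
  push_cast at h3
  nlinarith

lemma hasSum_add_mul_geometric {r : ℝ} (hr0 : 0 ≤ r) (hr1 : r < 1) (K : ℕ) :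
    HasSum (fun n : ℕ => ((n + K : ℕ) + 1) * r ^ (n + K))
      (r ^ K * ((K + 1) / (1 - r) + r / (1 - r) ^ 2)) := by
  have h1 := hasSum_coe_mul_geometric_of_norm_lt_one (𝕜 := ℝ) (r := r)
    (by rwa [Real.norm_eq_abs, abs_of_nonneg hr0])
  have h2 := (hasSum_geometric_of_lt_one hr0 hr1).mul_left ((K : ℝ) + 1)
  have h3 := (h2.add h1).mul_left (r ^ K)
  rw [← div_eq_mul_inv] at h3
  refine h3.congr_fun fun n => ?_
  rw [pow_add]
  push_cast
  ring

open Metric in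
/-- Taylor remainder for the logarithmic derivative of a zero-free function on a disc. -/
lemma norm_logDeriv_sub_taylor_le {L : ℂ → ℂ} {c s : ℂ} {R B : ℝ} (hR : 0 < R)
    (hL : DifferentiableOn ℂ L (ball c R)) (h0 : ∀ z ∈ ball c R, L z ≠ 0)
    (hB : ∀ z ∈ ball c R, ‖L z‖ ≤ ‖L c‖ * Real.exp B) (hs : s ∈ ball c R) (K : ℕ) :
    ‖logDeriv L s - ∑ n ∈ Finset.range K,
        (n ! : ℂ)⁻¹ * (s - c) ^ n * iteratedDeriv n (logDeriv L) c‖ ≤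
      2 * B / R * ((‖s - c‖ / R) ^ K *
        ((K + 1) / (1 - ‖s - c‖ / R) + ‖s - c‖ / R / (1 - ‖s - c‖ / R) ^ 2)) := by
  have hg : DifferentiableOn ℂ (logDeriv L) (ball c R) :=
    (hL.deriv isOpen_ball).div hL h0
  have hT := Complex.hasSum_taylorSeries_on_ball (r := R.toNNReal)
    (by rw [Real.coe_toNNReal _ hR.le]; exact hg) (by rw [Real.coe_toNNReal _ hR.le]; exact hs)
  simp only [smul_eq_mul, ← mul_assoc] at hT
  have hsR : ‖s - c‖ < R := by rwa [← dist_eq_norm]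
  have hG := (hasSum_add_mul_geometric (r := ‖s - c‖ / R) (by positivity)
    (by rwa [div_lt_one hR]) K).mul_left (2 * B / R)
  have h1 := (hasSum_nat_add_iff' K).2 hT
  rw [← h1.tsum_eq]
  refine tsum_of_norm_bounded hG fun n => ?_
  have h2 := norm_iteratedDeriv_logDeriv_le hR hL h0 hB (n + K)
  rw [norm_mul, norm_mul, norm_inv, norm_pow, Complex.norm_natCast]
  calc _ = ‖s - c‖ ^ (n + K) *
        (‖iteratedDeriv (n + K) (logDeriv L) c‖ / (n + K)!) := by ring
    _ ≤ ‖s - c‖ ^ (n + K) * (((n + K : ℕ) + 1) * (2 * B / R ^ (n + K + 1))) := by gcongr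
    _ = _ := by
      rw [div_pow, pow_succ]
      field_simp

/-- The probability that a Poisson variable of mean `η t` is less than `K`. -/
def poissonWeight (η : ℝ) (K : ℕ) (t : ℝ) : ℝ :=
  Real.exp (-(η * t)) * ∑ j ∈ Finset.range K, (η * t) ^ j / j !

lemma iterate_logMul (f : ℕ → ℂ) (j d : ℕ) :
    LSeries.logMul^[j] f d = (Real.log d : ℂ) ^ j * f d := by
  induction j with
  | zero => simp
  | succ j ih =>
    rw [Function.iterate_succ', Function.comp_apply, LSeries.logMul, ih, Complex.natCast_log]
    ring

/-- A Taylor polynomial of a Dirichlet series as a smoothed Dirichlet series. -/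
lemma hasSum_mul_poissonWeight {f : ℕ → ℂ} {η : ℝ}
    (hf : LSeries.abscissaOfAbsConv f < ((1 + η : ℝ) : ℂ).re) (K : ℕ) :
    HasSum (fun d : ℕ => f d / d * (poissonWeight η K (Real.log d) : ℂ))
      (∑ n ∈ Finset.range K, (n ! : ℂ)⁻¹ * (1 - ((1 + η : ℝ) : ℂ)) ^ n *
        iteratedDeriv n (LSeries f) ((1 + η : ℝ) : ℂ)) := by
  have h1 : ∀ n ∈ Finset.range K, HasSum (fun d : ℕ => (n ! : ℂ)⁻¹ * (1 - ((1 + η : ℝ) : ℂ)) ^ n *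
      ((-1) ^ n * LSeries.term (LSeries.logMul^[n] f) ((1 + η : ℝ) : ℂ) d))
      ((n ! : ℂ)⁻¹ * (1 - ((1 + η : ℝ) : ℂ)) ^ n *
        iteratedDeriv n (LSeries f) ((1 + η : ℝ) : ℂ)) := by
    intro n _
    rw [LSeries_iteratedDeriv n hf]
    have h2 : LSeriesSummable (LSeries.logMul^[n] f) ((1 + η : ℝ) : ℂ) :=
      LSeriesSummable_of_abscissaOfAbsConv_lt_re (by rwa [LSeries.absicssaOfAbsConv_logPowMul])
    exact (h2.hasSum.mul_left _).mul_left _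
  refine (hasSum_sum h1).congr_fun fun d => ?_
  rcases eq_or_ne d 0 with rfl | hd
  · simp
  have hd0 : (0 : ℝ) < d := by exact_mod_cast Nat.pos_of_ne_zero hd
  have hcp : (d : ℂ) ^ (((1 + η : ℝ) : ℂ)) = d * (Real.exp (η * Real.log d) : ℂ) := by
    rw [← Complex.ofReal_natCast, ← Complex.ofReal_cpow hd0.le, Real.rpow_add hd0, Real.rpow_one,
      mul_comm η, ← Real.rpow_def_of_pos hd0]
    push_cast
    rfl
  simp_rw [LSeries.term_of_ne_zero hd, iterate_logMul, hcp, poissonWeight]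
  have he : (Real.exp (η * Real.log d) : ℂ) ≠ 0 := by
    exact_mod_cast (Real.exp_pos _).ne'
  rw [Real.exp_neg]
  push_cast at he ⊢
  rw [Finset.mul_sum, Finset.mul_sum]
  refine Finset.sum_congr rfl fun n _ => ?_
  have : (-1 : ℂ) ^ n * (1 - (1 + η)) ^ n = η ^ n := by
    rw [← mul_pow]; ring
  field_simp
  rw [mul_pow, ← this]
  ring

open ArithmeticFunction in
lemma summable_vonMangoldt_div_mul_poissonWeight {η : ℝ} (hη : 0 < η) (K : ℕ) :
    Summable fun d : ℕ => vonMangoldt d / d * poissonWeight η K (Real.log d) := by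
  have h : LSeries.abscissaOfAbsConv (fun n => (vonMangoldt n : ℂ)) <
      ((1 + η : ℝ) : ℂ).re := by
    refine lt_of_le_of_lt (LSeries.abscissaOfAbsConv_le_of_forall_lt_LSeriesSummable (x := 1)
      fun y hy => LSeriesSummable_vonMangoldt (by simpa)) ?_
    rw [Complex.ofReal_re]
    exact_mod_cast (by linarith : (1 : ℝ) < 1 + η)
  have h2 := (hasSum_mul_poissonWeight h K).summable
  exact_mod_cast h2

open ArithmeticFunction in
lemma hasSum_twist_mul_poissonWeight {m : ℕ} [NeZero m] (χ : DirichletCharacter ℂ m) {η : ℝ}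
    (hη : 0 < η) (K : ℕ) :
    HasSum (fun d : ℕ => χ (d : ZMod m) * vonMangoldt d / d *
        (poissonWeight η K (Real.log d) : ℂ))
      (-∑ n ∈ Finset.range K, (n ! : ℂ)⁻¹ * (1 - ((1 + η : ℝ) : ℂ)) ^ n *
        iteratedDeriv n (logDeriv χ.LFunction) ((1 + η : ℝ) : ℂ)) := by
  set f : ℕ → ℂ := (fun n : ℕ => χ (n : ZMod m)) * (fun n => (vonMangoldt n : ℂ)) with hfd
  have hf : LSeries.abscissaOfAbsConv f < ((1 + η : ℝ) : ℂ).re := by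
    refine lt_of_le_of_lt (LSeries.abscissaOfAbsConv_le_of_forall_lt_LSeriesSummable (x := 1)
      fun y hy => DirichletCharacter.LSeriesSummable_twist_vonMangoldt χ (by simpa)) ?_
    rw [Complex.ofReal_re]
    exact_mod_cast (by linarith : (1 : ℝ) < 1 + η)
  convert hasSum_mul_poissonWeight hf K using 1
  · rfl
  rw [← Finset.sum_neg_distrib]
  refine Finset.sum_congr rfl fun n _ => ?_
  rw [← mul_neg, ← iteratedDeriv_neg]
  congr 1
  refine Filter.EventuallyEq.iteratedDeriv_eq n ?_
  have hopen : IsOpen {z : ℂ | 1 < z.re} := isOpen_lt continuous_const Complex.continuous_re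
  filter_upwards [hopen.mem_nhds (show ((1 + η : ℝ) : ℂ) ∈ {z : ℂ | 1 < z.re} by simpa)] with z hz
  rw [DirichletCharacter.LSeries_twist_vonMangoldt_eq χ hz, Pi.neg_apply, logDeriv_apply,
    DirichletCharacter.deriv_LFunction_eq_deriv_LSeries χ hz,
    DirichletCharacter.LFunction_eq_LSeries χ hz, neg_div]

lemma norm_LFunction_ge {m : ℕ} [NeZero m] (χ : DirichletCharacter ℂ m) {c : ℝ} (hc : 5 ≤ c) :
    0.919 ≤ ‖χ.LFunction (c : ℂ)‖ := by
  have hre : 1 < (c : ℂ).re := by rw [Complex.ofReal_re]; linarith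
  rw [DirichletCharacter.LFunction_eq_LSeries χ hre, LSeries]
  have hs : Summable (LSeries.term (fun n : ℕ => χ (n : ZMod m)) (c : ℂ)) :=
    DirichletCharacter.LSeriesSummable_of_one_lt_re χ hre
  rw [← hs.sum_add_tsum_nat_add 2]
  have h1 : ∑ i ∈ Finset.range 2, LSeries.term (fun n : ℕ => χ (n : ZMod m)) (c : ℂ) i = 1 := by
    simp [Finset.sum_range_succ, LSeries.term]
  rw [h1]
  have hz : HasSum (fun n : ℕ => (1 / 8 : ℝ) * (1 / ((n + 2 : ℕ) : ℝ) ^ 2))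
      (1 / 8 * (π ^ 2 / 6 - 1)) := by
    have := (hasSum_nat_add_iff' 2).2 hasSum_zeta_two
    simpa [Finset.sum_range_succ] using this.mul_left (8 : ℝ)⁻¹
  have h2 : ‖∑' i, LSeries.term (fun n : ℕ => χ (n : ZMod m)) (c : ℂ) (i + 2)‖ ≤
      1 / 8 * (π ^ 2 / 6 - 1) := by
    refine tsum_of_norm_bounded hz fun n => ?_
    have hn : (2 : ℝ) ≤ (n + 2 : ℕ) := by push_cast; linarith [(n.cast_nonneg : (0 : ℝ) ≤ n)]
    rw [LSeries.term_of_ne_zero (by omega), norm_div, Complex.norm_natCast_cpow_of_pos (by omega),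
      Complex.ofReal_re]
    calc _ ≤ 1 / ((n + 2 : ℕ) : ℝ) ^ c := by
          gcongr
          exact χ.norm_le_one _
      _ ≤ 1 / ((n + 2 : ℕ) : ℝ) ^ (5 : ℝ) := by
          gcongr
          linarith
      _ = 1 / ((n + 2 : ℕ) : ℝ) ^ 5 := by norm_cast
      _ ≤ 1 / (2 ^ 3 * ((n + 2 : ℕ) : ℝ) ^ 2) := by
          rw [show ((n + 2 : ℕ) : ℝ) ^ 5 = ((n + 2 : ℕ) : ℝ) ^ 3 * ((n + 2 : ℕ) : ℝ) ^ 2 by ring]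
          gcongr
      _ = _ := by field_simp; norm_num
  have h3 := norm_sub_norm_le (1 : ℂ)
    (-∑' i, LSeries.term (fun n : ℕ => χ (n : ZMod m)) (c : ℂ) (i + 2))
  rw [norm_neg, norm_one, sub_neg_eq_add] at h3
  have h4 : π ^ 2 < 3.1416 ^ 2 := by
    have := Real.pi_lt_d4
    have := Real.pi_pos
    gcongr
  linarith

lemma norm_div_re_le {η : ℝ} (hη : 4 ≤ η) {s : ℂ}
    (hs : s ∈ Metric.ball ((1 + η : ℝ) : ℂ) (η + 1 / 2)) :
    1 / 2 < s.re ∧ ‖s‖ / s.re ≤ √(η + 1.27) := by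
  rw [Metric.mem_ball, Complex.dist_eq] at hs
  have h1 : (s.re - (1 + η)) ^ 2 + s.im ^ 2 < (η + 1 / 2) ^ 2 := by
    have := Complex.sq_norm (s - ((1 + η : ℝ) : ℂ))
    rw [Complex.normSq_apply] at this
    simp only [Complex.sub_re, Complex.sub_im, Complex.ofReal_re, Complex.ofReal_im, sub_zero]
      at this
    have h2 : ‖s - ((1 + η : ℝ) : ℂ)‖ ^ 2 < (η + 1 / 2) ^ 2 := by gcongr
    nlinarith
  have h2 : 1 / 2 < s.re := by
    nlinarith [sq_nonneg s.im]
  refine ⟨h2, ?_⟩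
  rw [div_le_iff₀ (by linarith)]
  refine abs_le_of_sq_le_sq' ?_ (by positivity) |>.2
  rw [mul_pow, Real.sq_sqrt (by linarith), Complex.sq_norm, Complex.normSq_apply]
  nlinarith [sq_nonneg ((η + 0.75) * 1 - (1 + η) * s.re), sq_nonneg s.im, sq_nonneg s.re]

open ArithmeticFunction in
/-- Under GRH, smoothed sums of `χ Λ` are close to the logarithmic derivative at one. -/
lemma norm_logDeriv_add_tsum_le {m : ℕ} [NeZero m] (hm : 1 < m) (hG : GRH m)
    {χ : DirichletCharacter ℂ m} (hχ : χ ≠ 1) {η B : ℝ} (hη : 4 ≤ η)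
    (hB : (φ m : ℝ) / 2 * √(η + 1.27) ≤ 0.919 * Real.exp B) (K : ℕ) :
    ‖logDeriv χ.LFunction 1 + ∑' d : ℕ, χ (d : ZMod m) * vonMangoldt d / d *
        (poissonWeight η K (Real.log d) : ℂ)‖ ≤
      4 * B * ((η / (η + 1 / 2)) ^ K * (K + 1 + 2 * η)) := by
  rw [(hasSum_twist_mul_poissonWeight χ (by linarith) K).tsum_eq, ← sub_eq_add_neg]
  have hR : 0 < η + 1 / 2 := by linarith
  have hn : ‖(1 : ℂ) - ((1 + η : ℝ) : ℂ)‖ = η := by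
    push_cast
    rw [sub_add_cancel_left, norm_neg, Complex.norm_real, Real.norm_eq_abs,
      abs_of_nonneg (by linarith)]
  refine (norm_logDeriv_sub_taylor_le hR
    (DirichletCharacter.differentiable_LFunction hχ).differentiableOn ?_ (B := B) ?_ ?_ K).trans ?_
  · intro z hz h0
    have h1 := (norm_div_re_le hη hz).1
    rcases lt_or_ge z.re 1 with h | h
    · have := hG inferInstance χ z h0 (by linarith) h
      linarith
    · exact DirichletCharacter.LFunction_ne_zero_of_one_le_re χ (.inl hχ) h h0
  · intro z hz
    obtain ⟨h1, h2⟩ := norm_div_re_le hη hz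
    calc ‖χ.LFunction z‖ ≤ ‖z‖ * ((φ m : ℝ) / 2 / z.re) := norm_LFunction_le hm hχ (by linarith)
      _ = (φ m : ℝ) / 2 * (‖z‖ / z.re) := by ring
      _ ≤ (φ m : ℝ) / 2 * √(η + 1.27) := by gcongr
      _ ≤ _ := hB
      _ ≤ _ := by
        gcongr
        exact norm_LFunction_ge χ (by linarith)
  · rw [Metric.mem_ball, dist_eq_norm, hn]
    linarith
  · rw [hn]
    apply le_of_eq
    have : 1 - η / (η + 1 / 2) = (1 / 2) / (η + 1 / 2) := by field_simp; ring
    rw [this]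
    field_simp
    ring

variable {η t : ℝ}

lemma poissonWeight_nonneg (hη : 0 ≤ η) (ht : 0 ≤ t) (K : ℕ) : 0 ≤ poissonWeight η K t := by
  unfold poissonWeight
  positivity

lemma hasSum_pow_div_factorial (y : ℝ) : HasSum (fun j : ℕ => y ^ j / j !) (Real.exp y) := by
  rw [Real.exp_eq_exp_ℝ]
  exact NormedSpace.expSeries_div_hasSum_exp y

lemma poissonWeight_le_one (hη : 0 ≤ η) (ht : 0 ≤ t) (K : ℕ) : poissonWeight η K t ≤ 1 := by
  unfold poissonWeight
  rw [Real.exp_neg, inv_mul_le_iff₀ (Real.exp_pos _), mul_one]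
  exact sum_le_hasSum _ (fun j _ => by positivity) (hasSum_pow_div_factorial _)

lemma poissonWeight_le (hη : 1 < η) (ht : 0 ≤ t) (K : ℕ) :
    poissonWeight η K t ≤ Real.exp (-t) / (1 - 1 / η) ^ K := by
  have hη0 : 0 < η := by linarith
  set ρ : ℝ := 1 - 1 / η with hρ
  have hρ0 : 0 < ρ := by
    rw [hρ, sub_pos, div_lt_one hη0]; exact hη
  have hρ1 : ρ ≤ 1 := by
    rw [hρ]; have : 0 < 1 / η := by positivity
    linarith
  have h1 : ∑ j ∈ Finset.range K, (η * t) ^ j / j ! ≤ Real.exp (ρ * (η * t)) / ρ ^ K := by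
    rw [le_div_iff₀ (by positivity), Finset.sum_mul]
    refine le_trans (Finset.sum_le_sum fun j hj => ?_)
      (sum_le_hasSum (Finset.range K) (fun j _ => by positivity)
        (hasSum_pow_div_factorial (ρ * (η * t))))
    have : ρ ^ K ≤ ρ ^ j := pow_le_pow_of_le_one hρ0.le hρ1 (Finset.mem_range.1 hj).le
    calc (η * t) ^ j / j ! * ρ ^ K ≤ (η * t) ^ j / j ! * ρ ^ j := by gcongr
      _ = _ := by rw [mul_pow ρ]; ring
  calc poissonWeight η K t ≤ Real.exp (-(η * t)) * (Real.exp (ρ * (η * t)) / ρ ^ K) := by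
        unfold poissonWeight
        gcongr
    _ = Real.exp (-t) / ρ ^ K := by
        rw [← mul_div_assoc, ← Real.exp_add]
        congr 2
        rw [hρ]
        field_simp
        ring

lemma one_sub_poissonWeight_le {a : ℝ} (hη : 0 < η) (ht : 0 ≤ t) (ha : 0 ≤ a) (K : ℕ) :
    1 - poissonWeight η K t ≤ Real.exp (a * t) / (1 + a / η) ^ K := by
  set ρ : ℝ := 1 + a / η with hρ
  have hρ1 : 1 ≤ ρ := by
    rw [hρ]; have : 0 ≤ a / η := by positivity
    linarith
  have h1 : Real.exp (η * t) - ∑ j ∈ Finset.range K, (η * t) ^ j / j ! ≤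
      Real.exp (ρ * (η * t)) / ρ ^ K := by
    have e1 := (hasSum_nat_add_iff' K).2 (hasSum_pow_div_factorial (η * t))
    have e2 := ((hasSum_pow_div_factorial (ρ * (η * t))).div_const (ρ ^ K))
    have e3 := (hasSum_nat_add_iff' K).2 e2
    refine (hasSum_le (fun j => ?_) e1 e3).trans
      (sub_le_self _ (Finset.sum_nonneg fun j _ => by positivity))
    rw [le_div_iff₀ (by positivity)]
    have : ρ ^ K ≤ ρ ^ (j + K) := pow_le_pow_right₀ hρ1 (by omega)
    calc (η * t) ^ (j + K) / (j + K)! * ρ ^ K ≤ (η * t) ^ (j + K) / (j + K)! * ρ ^ (j + K) := by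
          gcongr
      _ = _ := by rw [mul_pow ρ]; ring
  calc 1 - poissonWeight η K t =
        Real.exp (-(η * t)) * (Real.exp (η * t) - ∑ j ∈ Finset.range K, (η * t) ^ j / j !) := by
        unfold poissonWeight
        rw [mul_sub, ← Real.exp_add]
        simp
    _ ≤ Real.exp (-(η * t)) * (Real.exp (ρ * (η * t)) / ρ ^ K) := by gcongr
    _ = Real.exp (a * t) / ρ ^ K := by
        rw [← mul_div_assoc, ← Real.exp_add]
        congr 2
        rw [hρ]
        field_simp
        ring

end EulerPade

namespace EulerPade

open ArithmeticFunction Finset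

lemma sum_vonMangoldt_mul_div_eq_log_factorial (n : ℕ) :
    ∑ d ∈ Ioc 0 n, vonMangoldt d * ((n / d : ℕ) : ℝ) = Real.log (n !) := by
  rw [← sum_Ioc_mul_zeta_eq_sum, vonMangoldt_mul_zeta]
  induction n with
  | zero => simp
  | succ n ih =>
    rw [sum_Ioc_succ_top (by omega), ih, Nat.factorial_succ, Nat.cast_mul, Real.log_mul
      (by positivity) (by positivity), log_apply, add_comm]

lemma psi_le_of_le_log {n : ℕ} (hn : 16 ≤ Real.log n) : Chebyshev.psi n ≤ 1.4 * n := by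
  have hn0 : (0 : ℝ) < n := by
    rcases Nat.eq_zero_or_pos n with rfl | h
    · norm_num at hn
    · exact_mod_cast h
  have hn1 : (1 : ℝ) ≤ n := by exact_mod_cast Nat.cast_pos.1 hn0
  have h1 := Chebyshev.theta_le_log4_mul_x hn0.le
  have h2 := Chebyshev.psi_sub_theta_le hn1
  have h3 : 2 * √(n : ℝ) * Real.log n ≤ 0.0135 * n := by
    have e1 : √(n : ℝ) = Real.exp (Real.log n / 2) := by
      rw [Real.exp_half, Real.exp_log hn0]
    have e2 : (n : ℝ) = √(n : ℝ) * √(n : ℝ) := (Real.mul_self_sqrt hn0.le).symm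
    have e3 : Real.log n ≤ 0.00675 * √(n : ℝ) := by
      rw [e1]
      have : Real.exp (Real.log n / 2) = Real.exp 1 ^ 8 * Real.exp (Real.log n / 2 - 8) := by
        rw [← Real.exp_nat_mul, ← Real.exp_add]
        congr 1
        push_cast
        ring
      rw [this]
      have h4 := Real.add_one_le_exp (Real.log n / 2 - 8)
      have h5 : (2.7 : ℝ) ^ 8 ≤ Real.exp 1 ^ 8 := by
        have := Real.exp_one_gt_d9
        gcongr
        linarith
      have h6 : (2.7 : ℝ) ^ 8 * (Real.log n / 2 - 8 + 1) ≤
          Real.exp 1 ^ 8 * Real.exp (Real.log n / 2 - 8) := by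
        gcongr
        linarith
      norm_num at h6 ⊢
      linarith
    calc 2 * √(n : ℝ) * Real.log n ≤ 2 * √(n : ℝ) * (0.00675 * √(n : ℝ)) := by gcongr
      _ = 0.0135 * (√(n : ℝ) * √(n : ℝ)) := by ring
      _ = _ := by rw [← e2]
  have h4 : Real.log 4 ≤ 1.3864 := by
    rw [show (4 : ℝ) = 2 ^ 2 by norm_num, Real.log_pow]
    have := Real.log_two_lt_d9
    push_cast
    linarith
  nlinarith

lemma psi_natCast (n : ℕ) : Chebyshev.psi n = ∑ d ∈ Ioc 0 n, vonMangoldt d := by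
  rw [Chebyshev.psi, Nat.floor_natCast]

/-- Mertens-type lower bound for the sum of `Λ d / d`. -/
lemma log_sub_one_le_sum_vonMangoldt_div {n : ℕ} (hn : 1 ≤ n) :
    Real.log n - 1 ≤ ∑ d ∈ Ioc 0 n, vonMangoldt d / d := by
  have hn0 : (0 : ℝ) < n := by exact_mod_cast hn
  have h1 := Stirling.le_log_factorial_stirling (n := n) (by omega)
  have h2 : 0 ≤ Real.log n := Real.log_natCast_nonneg n
  have h3 : 0 ≤ Real.log (2 * π) := Real.log_nonneg (by linarith [Real.pi_gt_three])
  have h4 : Real.log (n !) ≤ n * ∑ d ∈ Ioc 0 n, vonMangoldt d / d := by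
    rw [← sum_vonMangoldt_mul_div_eq_log_factorial, mul_sum]
    refine sum_le_sum fun d _ => ?_
    calc vonMangoldt d * ((n / d : ℕ) : ℝ) ≤ vonMangoldt d * (n / d) := by
          gcongr
          exact Nat.cast_div_le
      _ = _ := by ring
  refine le_of_mul_le_mul_left ?_ hn0
  nlinarith

lemma sum_vonMangoldt_div_mul_le {n : ℕ} (hn : 1 ≤ n) :
    n * ∑ d ∈ Ioc 0 n, vonMangoldt d / d ≤
      (n + 1) * Real.log n - n + 1 + Chebyshev.psi n := by
  have h4 : n * ∑ d ∈ Ioc 0 n, vonMangoldt d / d ≤ Real.log (n !) + Chebyshev.psi n := by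
    rw [← sum_vonMangoldt_mul_div_eq_log_factorial, mul_sum, psi_natCast, ← sum_add_distrib]
    refine sum_le_sum fun d _ => ?_
    have h : (n : ℝ) / d ≤ (n / d : ℕ) + 1 := by
      rw [← Nat.floor_div_eq_div (K := ℝ)]
      exact (Nat.lt_floor_add_one _).le
    calc n * (vonMangoldt d / d) = vonMangoldt d * (n / d) := by ring
      _ ≤ vonMangoldt d * ((n / d : ℕ) + 1) := by
          gcongr
      _ = _ := by ring
  linarith [log_factorial_le hn]

lemma sum_vonMangoldt_div_le {n : ℕ} (hn : 18 ≤ Real.log n) :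
    ∑ d ∈ Ioc 0 n, vonMangoldt d / d ≤ Real.log n + 0.41 := by
  have hn0 : (0 : ℝ) < n := by
    rcases Nat.eq_zero_or_pos n with rfl | h
    · norm_num at hn
    · exact_mod_cast h
  have h1 := sum_vonMangoldt_div_mul_le (Nat.cast_pos.1 hn0)
  have h2 := psi_le_of_le_log (by linarith : 16 ≤ Real.log n)
  have h3 : Real.log n + 1 ≤ 0.01 * n := by
    have e := Real.quadratic_le_exp_of_nonneg (x := Real.log n / 2) (by linarith)
    have e2 : (n : ℝ) = Real.exp (Real.log n / 2) * Real.exp (Real.log n / 2) := by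
      rw [← Real.exp_add, add_halves, Real.exp_log hn0]
    have e3 : (50.5 : ℝ) ≤ Real.exp (Real.log n / 2) := by nlinarith
    have e4 := mul_le_mul e3 e (by positivity) (by positivity)
    rw [← e2] at e4
    nlinarith
  refine le_of_mul_le_mul_left ?_ hn0
  linarith

lemma sum_vonMangoldt_div_sq_le {z : ℕ} (hz : 16 ≤ Real.log z) (N : ℕ) :
    ∑ d ∈ Ioc z N, vonMangoldt d / (d : ℝ) ^ 2 ≤ 2.8 / z := by
  have hz0 : (0 : ℝ) < z := by
    rcases Nat.eq_zero_or_pos z with rfl | h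
    · norm_num at hz
    · exact_mod_cast h
  rcases le_total N z with h | h
  · rw [Ioc_eq_empty_of_le h, sum_empty]
    positivity
  suffices H : ∑ d ∈ Ioc z N, vonMangoldt d / (d : ℝ) ^ 2 ≤
      Chebyshev.psi N / N ^ 2 + (2.8 / z - 2.8 / N) by
    have hN : Real.log z ≤ Real.log N := Real.log_le_log hz0 (by exact_mod_cast h)
    have h1 := psi_le_of_le_log (hz.trans hN)
    have hN0 : (0 : ℝ) < N := hz0.trans_le (by exact_mod_cast h)
    have h2 : Chebyshev.psi N / N ^ 2 ≤ 1.4 / N := by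
      rw [div_le_div_iff₀ (by positivity) hN0]
      nlinarith
    have h3 : 1.4 / (N : ℝ) ≤ 2.8 / N := by gcongr; norm_num
    linarith
  induction N, h using Nat.le_induction with
  | base =>
    rw [Ioc_self, sum_empty]
    have := Chebyshev.psi_nonneg z
    simp only [sub_self, add_zero]
    positivity
  | succ N h ih =>
    have hN : Real.log z ≤ Real.log N := Real.log_le_log hz0 (by exact_mod_cast h)
    have h1 := psi_le_of_le_log (hz.trans hN)
    have hN0 : (0 : ℝ) < N := hz0.trans_le (by exact_mod_cast h)
    have h2 : Chebyshev.psi ((N + 1 : ℕ) : ℝ) = Chebyshev.psi N + vonMangoldt (N + 1) := by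
      rw [psi_natCast, psi_natCast, sum_Ioc_succ_top (by omega)]
    rw [sum_Ioc_succ_top h, h2]
    have h3 : Chebyshev.psi N * (1 / (N : ℝ) ^ 2 - 1 / ((N + 1 : ℕ) : ℝ) ^ 2) ≤
        2.8 / N - 2.8 / (N + 1 : ℕ) := by
      have e1 : 1 / (N : ℝ) ^ 2 - 1 / ((N + 1 : ℕ) : ℝ) ^ 2 =
          (2 * N + 1) / ((N : ℝ) ^ 2 * (N + 1) ^ 2) := by
        push_cast
        field_simp
        ring
      have e2 : 2.8 / (N : ℝ) - 2.8 / (N + 1 : ℕ) = 2.8 / (N * (N + 1)) := by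
        push_cast
        field_simp
        ring
      rw [e1, e2]
      calc _ ≤ 1.4 * N * ((2 * N + 1) / ((N : ℝ) ^ 2 * (N + 1) ^ 2)) := by gcongr
        _ = 1.4 * (2 * N + 1) / (N * (N + 1) ^ 2) := by field_simp
        _ ≤ _ := by
          rw [div_le_div_iff₀ (by positivity) (by positivity)]
          nlinarith [mul_pos hN0 hN0, mul_pos hN0 (mul_pos hN0 hN0)]
    have h4 : (Chebyshev.psi N + vonMangoldt (N + 1)) / ((N + 1 : ℕ) : ℝ) ^ 2 =
        Chebyshev.psi N / N ^ 2 - Chebyshev.psi N * (1 / (N : ℝ) ^ 2 - 1 / ((N + 1 : ℕ) : ℝ) ^ 2) +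
        vonMangoldt (N + 1) / ((N + 1 : ℕ) : ℝ) ^ 2 := by ring
    rw [h4]
    linarith

lemma sum_vonMangoldt_mul_not_prime_le {σ : ℝ} (hσ : 0 < σ) (N : ℕ) :
    ∑ d ∈ Ioc 0 N with ¬ d.Prime, vonMangoldt d * Real.exp (-(σ * Real.log d)) ≤
      ∑ p ∈ Ioc 0 N with p.Prime, Real.log p *
        (Real.exp (-(σ * Real.log p)) ^ 2 / (1 - Real.exp (-(σ * Real.log p)))) := by
  set f : ℕ → ℝ := fun d => Real.exp (-(σ * Real.log d)) with hf
  have hf0 (d) : 0 ≤ f d := (Real.exp_pos _).le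
  have hpow (p j : ℕ) : f (p ^ j) = f p ^ j := by
    simp only [hf]
    rw [← Real.exp_nat_mul, Nat.cast_pow, Real.log_pow]
    congr 1
    ring
  set P := (Ioc 0 N).filter Nat.Prime
  have hinj : Set.InjOn (fun x : ℕ × ℕ => x.1 ^ (x.2 + 2)) (P ×ˢ range N : Finset (ℕ × ℕ)) := by
    rintro ⟨p, i⟩ hp ⟨q, j⟩ hq h
    simp only [coe_product, Set.mem_prod, mem_coe, P, mem_filter] at hp hq h
    have h1 : p = q := by
      have : p ∣ q ^ (j + 2) := h ▸ dvd_pow_self p (by omega)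
      exact (Nat.prime_dvd_prime_iff_eq hp.1.2 hq.1.2).1 (hp.1.2.dvd_of_dvd_pow this)
    subst h1
    have := Nat.pow_right_injective hp.1.2.two_le h
    simp only [Prod.mk.injEq, true_and]
    omega
  have hsub : (((Ioc 0 N).filter (fun d => ¬ d.Prime)).filter (fun d => vonMangoldt d ≠ 0)) ⊆
      (P ×ˢ range N).image (fun x : ℕ × ℕ => x.1 ^ (x.2 + 2)) := by
    intro d hd
    simp only [mem_filter, mem_Ioc, ne_eq, vonMangoldt_eq_zero_iff, not_not] at hd
    obtain ⟨⟨⟨hd0, hdN⟩, hnp⟩, hpp⟩ := hd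
    obtain ⟨p, j, hp, hj, rfl⟩ := (isPrimePow_nat_iff d).1 hpp
    have hj2 : 2 ≤ j := by
      by_contra hlt
      have : j = 1 := by omega
      subst this
      rw [pow_one] at hnp
      exact hnp hp
    refine mem_image.2 ⟨(p, j - 2), ?_, ?_⟩
    · have h1 : p ≤ p ^ j := Nat.le_self_pow (by omega) p
      have h2 : j < p ^ j := Nat.lt_pow_self hp.one_lt
      simp only [mem_product, P, mem_filter, mem_Ioc, mem_range]
      exact ⟨⟨⟨hp.pos, h1.trans hdN⟩, hp⟩, by omega⟩
    · simp only
      congr 1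
      omega
  rw [← sum_filter_of_ne (p := fun d => vonMangoldt d ≠ 0) (fun d _ h => left_ne_zero_of_mul h)]
  refine (sum_le_sum_of_subset_of_nonneg hsub fun d _ _ =>
    mul_nonneg vonMangoldt_nonneg (hf0 d)).trans ?_
  rw [sum_image hinj, sum_product]
  refine sum_le_sum fun p hp => ?_
  simp only [P, mem_filter, mem_Ioc] at hp
  have hlog : 0 < Real.log p := Real.log_pos (by exact_mod_cast hp.2.one_lt)
  have h1 : f p < 1 := by
    simp only [hf]
    rw [Real.exp_lt_one_iff]
    nlinarith
  calc ∑ j ∈ range N, vonMangoldt (p ^ (j + 2)) * f (p ^ (j + 2))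
      = Real.log p * f p ^ 2 * ∑ j ∈ range N, f p ^ j := by
        rw [mul_sum]
        refine sum_congr rfl fun j _ => ?_
        rw [vonMangoldt_apply_pow (by omega), vonMangoldt_apply_prime hp.2, hpow]
        ring
    _ ≤ Real.log p * f p ^ 2 * (1 - f p)⁻¹ := by
        gcongr
        rw [← tsum_geometric_of_lt_one (hf0 p) h1]
        exact (summable_geometric_of_lt_one (hf0 p) h1).sum_le_tsum _
          (fun j _ => pow_nonneg (hf0 p) j)
    _ = _ := by rw [mul_assoc, div_eq_mul_inv]

lemma sum_Ioc_le_of_sub_le {f F : ℕ → ℝ} (h : ∀ n, 1 ≤ n → f (n + 1) ≤ F n - F (n + 1))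
    (hF : ∀ n, 1 ≤ n → 0 ≤ F n) (N : ℕ) : ∑ n ∈ Ioc 1 N, f n ≤ F 1 := by
  rcases Nat.lt_or_ge N 1 with hN | hN
  · rw [Ioc_eq_empty (by omega), sum_empty]
    exact hF 1 le_rfl
  suffices H : ∑ n ∈ Ioc 1 N, f n ≤ F 1 - F N by linarith [hF N hN]
  induction N, hN using Nat.le_induction with
  | base => simp
  | succ N hN ih =>
    rw [sum_Ioc_succ_top hN]
    linarith [h N hN]

lemma log_succ_sub_log_le {n : ℕ} (hn : 1 ≤ n) :
    Real.log (n + 1 : ℕ) - Real.log n ≤ 1 / n := by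
  have hn0 : (0 : ℝ) < n := by exact_mod_cast hn
  rw [← Real.log_div (by positivity) hn0.ne']
  have := Real.log_le_sub_one_of_pos (x := ((n + 1 : ℕ) : ℝ) / n) (by positivity)
  refine this.trans (le_of_eq ?_)
  push_cast
  field_simp
  ring

lemma sum_log_div_mul_pred_le (N : ℕ) :
    ∑ n ∈ Ioc 1 N, Real.log n / (n * (n - 1)) ≤ 2 := by
  have := sum_Ioc_le_of_sub_le (f := fun n => Real.log n / (n * (n - 1)))
    (F := fun n => (Real.log n + 2) / n) ?_ ?_ N
  · simpa using this
  · intro n hn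
    have hn0 : (1 : ℝ) ≤ n := by exact_mod_cast hn
    have h1 := log_succ_sub_log_le hn
    rw [le_div_iff₀ (by positivity)] at h1
    have h2 : (Real.log n + 2) / n - (Real.log (n + 1 : ℕ) + 2) / (n + 1 : ℕ) -
        Real.log (n + 1 : ℕ) / ((n + 1 : ℕ) * ((n + 1 : ℕ) - 1)) =
        (2 - (Real.log (n + 1 : ℕ) - Real.log n) * (n + 1)) / (n * (n + 1)) := by
      have : (n : ℝ) ≠ 0 := by positivity
      push_cast
      field_simp
      ring_nf
      field_simp
    have h3 : 0 ≤ (2 - (Real.log (n + 1 : ℕ) - Real.log n) * (n + 1)) / (n * (n + 1)) := by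
      have : (Real.log (n + 1 : ℕ) - Real.log n) ≤ 1 := by
        have := log_succ_sub_log_le hn
        refine this.trans ?_
        rw [div_le_one (by positivity)]
        exact hn0
      apply div_nonneg _ (by positivity)
      linarith
    linarith
  · intro n _
    have := Real.log_natCast_nonneg n
    positivity

lemma sum_vonMangoldt_div_not_prime_le (N : ℕ) :
    ∑ d ∈ Ioc 0 N with ¬ d.Prime, vonMangoldt d / d ≤ 2 := by
  have h := sum_vonMangoldt_mul_not_prime_le one_pos N
  have e (d : ℕ) (hd : 0 < d) : Real.exp (-(1 * Real.log d)) = (d : ℝ)⁻¹ := by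
    rw [one_mul, Real.exp_neg, Real.exp_log (by exact_mod_cast hd)]
  calc _ = ∑ d ∈ Ioc 0 N with ¬ d.Prime, vonMangoldt d * Real.exp (-(1 * Real.log d)) := by
        refine sum_congr rfl fun d hd => ?_
        rw [e d (mem_Ioc.1 (mem_filter.1 hd).1).1, div_eq_mul_inv]
    _ ≤ _ := h
    _ ≤ ∑ n ∈ Ioc 1 N, Real.log n / (n * (n - 1)) := by
        rw [sum_congr rfl fun p hp => by
          rw [e p (mem_Ioc.1 (mem_filter.1 hp).1).1]]
        have hsub : (Ioc 0 N).filter Nat.Prime ⊆ Ioc 1 N := by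
          intro p hp
          simp only [mem_filter, mem_Ioc] at hp ⊢
          exact ⟨hp.2.one_lt, hp.1.2⟩
        refine le_trans (le_of_eq (sum_congr rfl fun p hp => ?_))
          (sum_le_sum_of_subset_of_nonneg hsub fun n hn _ => ?_)
        · have h2 : (1 : ℝ) < p := by exact_mod_cast (mem_filter.1 hp).2.one_lt
          have h3 : (p : ℝ) - 1 ≠ 0 := by linarith
          have h4 : 1 - (p : ℝ)⁻¹ ≠ 0 := by
            rw [sub_ne_zero]
            exact (inv_lt_one_of_one_lt₀ h2).ne'
          field_simp
        · have h2 : (1 : ℝ) < n := by exact_mod_cast (mem_Ioc.1 hn).1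
          have h3 : (0 : ℝ) < n - 1 := by linarith
          have := Real.log_natCast_nonneg n
          positivity
    _ ≤ 2 := sum_log_div_mul_pred_le N

lemma sum_log_div_mul_sqrt_le (N : ℕ) :
    ∑ n ∈ Ioc 1 N, Real.log n / (n * √n) ≤ 8 := by
  have := sum_Ioc_le_of_sub_le (f := fun n => Real.log n / (n * √n))
    (F := fun n => 2 * (Real.log n + 4) / √n) ?_ ?_ N
  · norm_num at this ⊢
    exact this
  · intro n hn
    have hn0 : (1 : ℝ) ≤ n := by exact_mod_cast hn
    have h1 := log_succ_sub_log_le hn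
    have hL := Real.log_natCast_nonneg (n + 1)
    set L := Real.log (n + 1 : ℕ) with hLdef
    set s := √(n : ℝ) with hs
    set t := √((n + 1 : ℕ) : ℝ) with ht
    have hs0 : 0 < s := Real.sqrt_pos.2 (by linarith)
    have hst : s ≤ t := Real.sqrt_le_sqrt (by push_cast; linarith)
    have ht0 : 0 < t := hs0.trans_le hst
    have hs2 : s ^ 2 = n := Real.sq_sqrt (by linarith)
    have ht2 : t ^ 2 = n + 1 := by
      rw [ht, Real.sq_sqrt (by positivity)]
      push_cast
      ring
    have h2 : L / (t ^ 2 * t) ≤ 2 * L / (s * t * (s + t)) := by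
      rw [div_le_div_iff₀ (by positivity) (by positivity)]
      have : s * t * (s + t) ≤ 2 * (t ^ 2 * t) := by
        calc s * t * (s + t) ≤ t * t * (t + t) := by gcongr
          _ = _ := by ring
      nlinarith
    have h3 : 2 / (s ^ 2 * s) ≤ 8 / (s * t * (s + t)) := by
      rw [div_le_div_iff₀ (by positivity) (by positivity)]
      have h5 : t ≤ 3 / 2 * s := by
        refine le_of_sq_le_sq ?_ (by positivity)
        nlinarith
      have h6 : t * (s + t) ≤ 4 * s ^ 2 := by nlinarith
      nlinarith
    have h4 : 1 / s - 1 / t = 1 / (s * t * (s + t)) := by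
      have h5 : (t - s) * (s + t) = 1 := by nlinarith
      rw [div_sub_div _ _ hs0.ne' ht0.ne', div_eq_div_iff (by positivity) (by positivity)]
      linear_combination s * t * h5
    calc L / (((n + 1 : ℕ) : ℝ) * t) = L / (t ^ 2 * t) := by
          rw [ht2]
          push_cast
          rfl
      _ ≤ 2 * (L + 4) * (1 / (s * t * (s + t))) - 2 / (s ^ 2 * s) := by
          have : 2 * (L + 4) * (1 / (s * t * (s + t))) =
            2 * L / (s * t * (s + t)) + 8 / (s * t * (s + t)) := by ring
          linarith
      _ = 2 * (L - 1 / n + 4) / s - 2 * (L + 4) / t := by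
          rw [← h4, ← hs2]
          field_simp
          ring
      _ ≤ _ := by
          gcongr
          linarith
  · intro n _
    have := Real.log_natCast_nonneg n
    positivity

lemma sum_vonMangoldt_mul_exp_not_prime_le (N : ℕ) :
    ∑ d ∈ Ioc 0 N with ¬ d.Prime, vonMangoldt d * Real.exp (-(3 / 4 * Real.log d)) ≤ 20 := by
  have h := sum_vonMangoldt_mul_not_prime_le (σ := 3 / 4) (by norm_num) N
  refine h.trans ?_
  have hsub : (Ioc 0 N).filter Nat.Prime ⊆ Ioc 1 N := by
    intro p hp
    simp only [mem_filter, mem_Ioc] at hp ⊢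
    exact ⟨hp.2.one_lt, hp.1.2⟩
  calc _ ≤ ∑ p ∈ Ioc 0 N with p.Prime, 2.5 * (Real.log p / (p * √p)) := by
        refine sum_le_sum fun p hp => ?_
        have h2 : (2 : ℝ) ≤ p := by exact_mod_cast (mem_filter.1 hp).2.two_le
        have hp0 : (0 : ℝ) < p := by linarith
        have h3 : Real.exp (-(3 / 4 * Real.log p)) ^ 2 = 1 / (p * √p) := by
          rw [← Real.exp_nat_mul, show ((2 : ℕ) : ℝ) * -(3 / 4 * Real.log p) =
            -(Real.log p + Real.log p / 2) by push_cast; ring, Real.exp_neg, Real.exp_add,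
            Real.exp_half, Real.exp_log hp0, one_div]
        have h4 : Real.exp (-(3 / 4 * Real.log p)) ≤ 0.6 := by
          have : Real.exp (-(3 / 4 * Real.log p)) ^ 4 ≤ 0.6 ^ 4 := by
            have e : Real.exp (-(3 / 4 * Real.log p)) ^ 4 = ((p : ℝ) ^ 3)⁻¹ := by
              rw [← Real.exp_nat_mul, show ((4 : ℕ) : ℝ) * -(3 / 4 * Real.log p) =
                -(3 * Real.log p) by push_cast; ring, Real.exp_neg]
              rw [show (3 : ℝ) * Real.log p = Real.log ((p : ℝ) ^ 3) by
                rw [Real.log_pow]; push_cast; rfl, Real.exp_log (by positivity)]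
            rw [e]
            calc ((p : ℝ) ^ 3)⁻¹ ≤ ((2 : ℝ) ^ 3)⁻¹ := by gcongr
              _ ≤ _ := by norm_num
          exact le_of_pow_le_pow_left₀ (by norm_num) (by norm_num) this
        have hl := Real.log_natCast_nonneg p
        rw [h3]
        calc _ ≤ Real.log p * (1 / (p * √p) / (1 - 0.6)) := by gcongr
          _ = _ := by ring
    _ ≤ ∑ n ∈ Ioc 1 N, 2.5 * (Real.log n / (n * √n)) := by
        refine sum_le_sum_of_subset_of_nonneg hsub fun n hn _ => ?_
        have := Real.log_natCast_nonneg n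
        positivity
    _ ≤ 20 := by
        rw [← mul_sum]
        linarith [sum_log_div_mul_sqrt_le N]

lemma card_mul_tsum_coprime_sub_le {m : ℕ} [NeZero m] {A : Finset ℕ}
    (hA : ∀ a ∈ A, a < m ∧ Nat.Coprime a m) {x : ℕ → ℝ} (hx : Summable x) {ε : ℝ}
    (hε : ∀ χ : DirichletCharacter ℂ m, χ ≠ 1 → ‖∑' d : ℕ, χ d * (x d : ℂ)‖ ≤ ε) :
    A.card * (∑' d : ℕ, (if d.Coprime m then x d else 0) - (m.totient - 1) * ε) ≤
      m.totient * ∑' d : ℕ, (if d % m ∈ A then x d else 0) := by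
  classical
  have hsum (a : ℕ) : Summable fun d : ℕ => if d % m = a then x d else 0 :=
    Summable.of_norm_bounded hx.norm fun d => by split_ifs <;> simp
  have hA' : ∑' d : ℕ, (if d % m ∈ A then x d else 0) =
      ∑ a ∈ A, ∑' d : ℕ, (if d % m = a then x d else 0) := by
    rw [← Summable.tsum_finsetSum fun a _ => hsum a]
    refine tsum_congr fun d => ?_
    rw [sum_ite_eq]
  rw [hA', mul_sum, ← nsmul_eq_mul, ← sum_const]
  refine sum_le_sum fun a ha => ?_
  obtain ⟨ham, hac⟩ := hA a ha
  have hχsum (χ : DirichletCharacter ℂ m) : Summable fun d : ℕ => χ d * (x d : ℂ) :=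
    Summable.of_norm_bounded hx.norm fun d => by
      rw [norm_mul, Complex.norm_real]
      exact mul_le_of_le_one_left (norm_nonneg _) (χ.norm_le_one _)
  have hunit : IsUnit (a : ZMod m) := (ZMod.isUnit_iff_coprime a m).2 hac
  have hpt (d : ℕ) : (m.totient : ℂ) * ((if d % m = a then x d else 0 : ℝ) : ℂ) =
      ∑ χ : DirichletCharacter ℂ m, χ (a : ZMod m)⁻¹ * (χ d * (x d : ℂ)) := by
    simp_rw [← mul_assoc]
    rw [← sum_mul, DirichletCharacter.sum_char_inv_mul_char_eq ℂ hunit]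
    have : ((a : ZMod m) = d) ↔ d % m = a := by
      rw [ZMod.natCast_eq_natCast_iff', Nat.mod_eq_of_lt ham, eq_comm]
    by_cases h : d % m = a
    · simp [this.2 h, h]
    · simp [mt this.1 h, h]
  have htot : (m.totient : ℂ) * ((∑' d : ℕ, (if d % m = a then x d else 0) : ℝ) : ℂ) =
      ∑ χ : DirichletCharacter ℂ m, χ (a : ZMod m)⁻¹ * ∑' d : ℕ, χ d * (x d : ℂ) := by
    rw [Complex.ofReal_tsum, ← tsum_mul_left]
    simp_rw [hpt]
    rw [Summable.tsum_finsetSum fun χ _ => (hχsum χ).mul_left _]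
    exact sum_congr rfl fun χ _ => tsum_mul_left
  have hone : (1 : DirichletCharacter ℂ m) (a : ZMod m)⁻¹ *
      ∑' d : ℕ, (1 : DirichletCharacter ℂ m) d * (x d : ℂ) =
      ((∑' d : ℕ, (if d.Coprime m then x d else 0) : ℝ) : ℂ) := by
    have h1 : IsUnit (a : ZMod m)⁻¹ :=
      IsUnit.of_mul_eq_one _ (ZMod.inv_mul_of_unit _ hunit)
    rw [MulChar.one_apply h1, one_mul, Complex.ofReal_tsum]
    refine tsum_congr fun d => ?_
    by_cases h : d.Coprime m
    · rw [MulChar.one_apply ((ZMod.isUnit_iff_coprime d m).2 h), if_pos h, one_mul]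
    · rw [MulChar.map_nonunit _ (mt (ZMod.isUnit_iff_coprime d m).1 h), if_neg h]
      simp
  rw [← add_sum_erase _ _ (mem_univ (1 : DirichletCharacter ℂ m)), hone] at htot
  have hnorm : ‖∑ χ ∈ univ.erase (1 : DirichletCharacter ℂ m),
      χ (a : ZMod m)⁻¹ * ∑' d : ℕ, χ d * (x d : ℂ)‖ ≤ (m.totient - 1) * ε := by
    refine (norm_sum_le_of_le (f := fun χ : DirichletCharacter ℂ m =>
      χ (a : ZMod m)⁻¹ * ∑' d : ℕ, χ d * (x d : ℂ)) (n := fun _ => ε) _ fun χ hχ => ?_).trans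
      (le_of_eq ?_)
    · rw [norm_mul]
      exact (mul_le_of_le_one_left (norm_nonneg _) (χ.norm_le_one _)).trans
        (hε χ (ne_of_mem_erase hχ))
    · rw [sum_const, card_erase_of_mem (mem_univ _), card_univ, nsmul_eq_mul,
        ← Nat.card_eq_fintype_card, DirichletCharacter.card_eq_totient_of_hasEnoughRootsOfUnity,
        Nat.cast_pred (Nat.totient_pos.2 (NeZero.pos m))]
  have hre := congrArg Complex.re htot
  rw [Complex.add_re, Complex.ofReal_re, ← Complex.ofReal_natCast, Complex.re_ofReal_mul,
    Complex.ofReal_re] at hre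
  rw [hre]
  have := (Complex.abs_re_le_norm _).trans hnorm
  rw [abs_le] at this
  linarith [this.1]

lemma sub_theta_le_logPart_factorial {S : Finset ℕ} {n : ℕ} {Q : ℕ → Prop} [DecidablePred Q]
    (hS : ∀ p : ℕ, p.Prime → p ≤ n → Q p → p ∈ S) :
    n * ∑ p ∈ Ioc 0 n with p.Prime ∧ Q p, vonMangoldt p / p - Chebyshev.theta n ≤
      logPart S (n !) := by
  have hsub : ((Ioc 0 n).filter fun p => p.Prime ∧ Q p) ⊆ S := by
    intro p hp
    simp only [mem_filter, mem_Ioc] at hp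
    exact hS p hp.2.1 hp.1.2 hp.2.2
  have h1 : ∑ p ∈ Ioc 0 n with p.Prime ∧ Q p, Real.log p ≤ Chebyshev.theta n := by
    rw [Chebyshev.theta, Nat.floor_natCast]
    refine sum_le_sum_of_subset_of_nonneg (fun p hp => ?_) fun p _ _ => Real.log_natCast_nonneg p
    simp only [mem_filter] at hp ⊢
    exact ⟨hp.1, hp.2.1⟩
  have h2 : ∑ p ∈ Ioc 0 n with p.Prime ∧ Q p, (n * (vonMangoldt p / p) - Real.log p) ≤
      logPart S (n !) := by
    refine le_trans (sum_le_sum fun p hp => ?_) (sum_le_sum_of_subset_of_nonneg hsub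
      fun p _ _ => mul_nonneg (Nat.cast_nonneg _) (Real.log_natCast_nonneg p))
    simp only [mem_filter, mem_Ioc] at hp
    obtain ⟨⟨hp0, hpn⟩, hpp, -⟩ := hp
    have h3 : n / p ≤ (n !).factorization p := by
      rw [← hpp.pow_dvd_iff_le_factorization (Nat.factorial_ne_zero n),
        hpp.pow_dvd_factorial_iff (b := Nat.log p n + 2) (by omega)]
      have := single_le_sum (f := fun i => n / p ^ i) (fun i _ => Nat.zero_le _)
        (show 1 ∈ Ico 1 (Nat.log p n + 2) by simp)
      simpa using this
    have h4 : (n : ℝ) / p - 1 ≤ (n !).factorization p := by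
      have : (n : ℝ) / p < (n / p : ℕ) + 1 := by
        rw [← Nat.floor_div_eq_div (K := ℝ)]
        exact Nat.lt_floor_add_one _
      have h5 : ((n / p : ℕ) : ℝ) ≤ (n !).factorization p := by exact_mod_cast h3
      linarith
    rw [vonMangoldt_apply_prime hpp]
    calc _ = (n / p - 1) * Real.log p := by ring
      _ ≤ _ := by gcongr
  rw [sum_sub_distrib, ← mul_sum] at h2
  linarith

lemma theta_natCast_le (n : ℕ) : Chebyshev.theta n ≤ 1.3864 * n := by
  have h4 : Real.log 4 ≤ 1.3864 := by
    rw [show (4 : ℝ) = 2 ^ 2 by norm_num, Real.log_pow]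
    have := Real.log_two_lt_d9
    push_cast
    linarith
  exact (Chebyshev.theta_le_log4_mul_x (Nat.cast_nonneg n)).trans (by gcongr)

lemma sum_log_prime_not_coprime_le {m : ℕ} (hm : m ≠ 0) (n : ℕ) :
    ∑ p ∈ Ioc 0 n with p.Prime ∧ ¬ p.Coprime m, vonMangoldt p ≤ Real.log m := by
  have hsub : ((Ioc 0 n).filter fun p => p.Prime ∧ ¬ p.Coprime m) ⊆ m.primeFactors := by
    intro p hp
    simp only [mem_filter, mem_Ioc] at hp
    rw [Nat.mem_primeFactors]
    exact ⟨hp.2.1, not_not.1 (mt hp.2.1.coprime_iff_not_dvd.2 hp.2.2), hm⟩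
  calc _ ≤ ∑ p ∈ m.primeFactors, vonMangoldt p :=
        sum_le_sum_of_subset_of_nonneg hsub fun _ _ _ => vonMangoldt_nonneg
    _ = ∑ p ∈ m.primeFactors, Real.log p :=
        sum_congr rfl fun p hp => vonMangoldt_apply_prime (Nat.prime_of_mem_primeFactors hp)
    _ = Real.log (∏ p ∈ m.primeFactors, p : ℕ) := by
        rw [Nat.cast_prod, Real.log_prod]
        intro p hp
        exact_mod_cast (Nat.prime_of_mem_primeFactors hp).ne_zero
    _ ≤ Real.log m := by
        refine Real.log_le_log ?_ ?_
        · exact_mod_cast prod_pos fun p hp => (Nat.prime_of_mem_primeFactors hp).pos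
        · exact_mod_cast Nat.le_of_dvd (Nat.pos_of_ne_zero hm) (Nat.prod_primeFactors_dvd m)

/-- Abel summation for a sequence whose partial sums lie in `[0, 1]`. -/
lemma sum_Ioc_mul_bounds {c h : ℕ → ℝ} (hc0 : ∀ n, 0 ≤ ∑ d ∈ Ioc 0 n, c d)
    (hc1 : ∀ n, ∑ d ∈ Ioc 0 n, c d ≤ 1) {a b : ℕ} (hab : a ≤ b)
    (hh : ∀ n, a < n → h (n + 1) ≤ h n) (hpos : ∀ n, 0 ≤ h n) :
    -(∑ d ∈ Ioc 0 a, c d) * h (a + 1) ≤ ∑ d ∈ Ioc a b, c d * h d ∧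
      ∑ d ∈ Ioc a b, c d * h d ≤ (1 - ∑ d ∈ Ioc 0 a, c d) * h (a + 1) := by
  suffices H : -(∑ d ∈ Ioc 0 a, c d) * h (a + 1) ≤
      ∑ d ∈ Ioc a b, c d * h d - (∑ d ∈ Ioc 0 b, c d) * h (b + 1) ∧
      ∑ d ∈ Ioc a b, c d * h d - (∑ d ∈ Ioc 0 b, c d) * h (b + 1) + h (b + 1) ≤
        (1 - ∑ d ∈ Ioc 0 a, c d) * h (a + 1) by
    have h1 := mul_nonneg (hc0 b) (hpos (b + 1))
    have h2 := mul_nonneg (sub_nonneg.2 (hc1 b)) (hpos (b + 1))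
    constructor <;> linarith [H.1, H.2]
  induction b, hab using Nat.le_induction with
  | base =>
    rw [Ioc_self, sum_empty]
    constructor <;> linarith
  | succ b hab ih =>
    have hstep := hh (b + 1) (by omega)
    have h1 := mul_nonneg (hc0 (b + 1)) (sub_nonneg.2 hstep)
    have h2 := mul_nonneg (sub_nonneg.2 (hc1 (b + 1))) (sub_nonneg.2 hstep)
    have e : ∑ d ∈ Ioc a (b + 1), c d * h d - (∑ d ∈ Ioc 0 (b + 1), c d) * h (b + 1 + 1) =
        ∑ d ∈ Ioc a b, c d * h d - (∑ d ∈ Ioc 0 b, c d) * h (b + 1) +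
          (∑ d ∈ Ioc 0 (b + 1), c d) * (h (b + 1) - h (b + 1 + 1)) := by
      rw [sum_Ioc_succ_top hab, sum_Ioc_succ_top (Nat.zero_le b)]
      ring
    rw [e]
    constructor <;> linarith [ih.1, ih.2]

lemma abs_sum_mul_vonMangoldt_div_le {c : ℕ → ℝ} (h1 : c 1 = 1)
    (hmul : ∀ d e, c (d * e) = c d * c e) (habs : ∀ d, |c d| ≤ 1)
    (hc0 : ∀ n, 0 ≤ ∑ d ∈ Ioc 0 n, c d) (hc1 : ∀ n, ∑ d ∈ Ioc 0 n, c d ≤ 1)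
    {n : ℕ} (hn : 16 ≤ Real.log n) :
    |∑ d ∈ Ioc 0 n, c d * vonMangoldt d / d| ≤ 4.8 := by
  have hn0 : 0 < n := by
    rcases Nat.eq_zero_or_pos n with rfl | h
    · norm_num at hn
    · exact h
  have hn3 : 3 ≤ n := by
    by_contra hlt
    have : Real.log n ≤ n - 1 := Real.log_le_sub_one_of_pos (by exact_mod_cast hn0)
    have : (n : ℝ) < 3 := by exact_mod_cast not_le.1 hlt
    linarith
  have hn0' : (0 : ℝ) < n := by exact_mod_cast hn0
  have hA1 : ∑ d ∈ Ioc 0 1, c d = 1 := by simp [h1]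
  have hmono (k : ℕ) : 0 < k → (1 : ℝ) / (k + 1 : ℕ) ≤ 1 / k := fun hk => by
    have : (0 : ℝ) < k := by exact_mod_cast hk
    gcongr
    omega
  set s : ℕ → ℝ := fun y => ∑ e ∈ Ioc 0 y, c e * (1 / e) with hs
  have hs_half (y : ℕ) (hy : 1 ≤ y) : 1 / 2 ≤ s y := by
    have := (sum_Ioc_mul_bounds (h := fun k => 1 / (k : ℝ)) hc0 hc1 hy
      (fun k hk => hmono k (by omega)) (fun k => by positivity)).1
    simp only [hs]
    rw [← sum_Ioc_consecutive _ (Nat.zero_le 1) hy]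
    rw [hA1] at this
    norm_num [h1] at this ⊢
    linarith
  have hs_sub (y x : ℕ) (hy : y ≤ x) : |s x - s y| ≤ 1 / (y + 1 : ℕ) := by
    have := sum_Ioc_mul_bounds (h := fun k => 1 / (k : ℝ)) hc0 hc1 hy
      (fun k hk => hmono k (by omega)) (fun k => by positivity)
    have e : s x - s y = ∑ d ∈ Ioc y x, c d * (1 / d) := by
      simp only [hs]
      rw [← sum_Ioc_consecutive _ (Nat.zero_le y) hy]
      ring
    have hp : (0 : ℝ) ≤ 1 / (y + 1 : ℕ) := by positivity
    rw [e, abs_le]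
    constructor
    · nlinarith [this.1, hc1 y]
    · nlinarith [this.2, hc0 y]
  have hB : |∑ d ∈ Ioc 0 n, c d * (Real.log d / d)| ≤ 1 := by
    have hb := sum_Ioc_mul_bounds (h := fun k : ℕ => Real.log k / (k : ℝ)) hc0 hc1
      (show 2 ≤ n by omega) (fun k hk => by
        have h3 : (3 : ℝ) ≤ k := by exact_mod_cast hk
        have he : Real.exp 1 ≤ k := Real.exp_one_lt_three.le.trans h3
        refine Real.log_div_self_antitoneOn he (Set.mem_Ici.2 ?_) ?_
        · push_cast
          linarith
        · push_cast
          linarith) (fun k => div_nonneg (Real.log_natCast_nonneg k) (Nat.cast_nonneg k))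
    rw [← sum_Ioc_consecutive _ (Nat.zero_le 2) (show 2 ≤ n by omega)]
    have e2 : ∑ d ∈ Ioc 0 2, c d * (Real.log d / d) = c 2 * (Real.log 2 / 2) := by
      rw [show Ioc 0 2 = {1, 2} by decide]
      simp
    have h3 : Real.log 3 ≤ 1.12 := by
      have : Real.log 3 = Real.log (3 / 2) + Real.log 2 := by
        rw [← Real.log_mul (by norm_num) (by norm_num)]
        norm_num
      have h4 := Real.log_two_lt_d9
      have h5 : Real.log (9 / 8) ≤ 9 / 8 - 1 := Real.log_le_sub_one_of_pos (by norm_num)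
      have h6 : Real.log (9 / 8) = 2 * Real.log 3 - 3 * Real.log 2 := by
        rw [Real.log_div (by norm_num) (by norm_num), show (9 : ℝ) = 3 ^ 2 by norm_num,
          show (8 : ℝ) = 2 ^ 3 by norm_num, Real.log_pow, Real.log_pow]
        push_cast
        ring
      linarith
    have h30 : 0 ≤ Real.log 3 := Real.log_nonneg (by norm_num)
    have h4 := Real.log_two_lt_d9
    have h40 : 0 ≤ Real.log 2 := Real.log_nonneg (by norm_num)
    have hc2 := abs_le.1 (habs 2)
    have hA := hc0 2
    have hA' := hc1 2
    rw [e2]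
    push_cast at hb
    norm_num at hb
    rw [abs_le]
    constructor
    · nlinarith [hb.1]
    · nlinarith [hb.2]
  have hid : ∑ d ∈ Ioc 0 n, c d * vonMangoldt d / d * s (n / d) =
      ∑ d ∈ Ioc 0 n, c d * (Real.log d / d) := by
    let f : ArithmeticFunction ℝ := ⟨fun d => c d * vonMangoldt d / d, by simp⟩
    let g : ArithmeticFunction ℝ := ⟨fun d => c d * (1 / d), by simp⟩
    have := sum_Ioc_mul_eq_sum_sum f g n
    change _ = ∑ d ∈ Ioc 0 n, c d * vonMangoldt d / d * s (n / d) at this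
    rw [← this]
    refine sum_congr rfl fun d hd => ?_
    rw [mul_apply, ← vonMangoldt_sum,
      ← Nat.sum_divisorsAntidiagonal (fun i _ => vonMangoldt i), Finset.sum_div, mul_sum]
    refine sum_congr rfl fun x hx => ?_
    obtain ⟨hx1, hx2⟩ := Nat.mem_divisorsAntidiagonal.1 hx
    change c x.1 * vonMangoldt x.1 / x.1 * (c x.2 * (1 / x.2)) = _
    rw [← hx1, hmul]
    push_cast
    have h0 : (x.1 : ℝ) ≠ 0 := by
      rintro h
      rw [Nat.cast_eq_zero] at h
      simp [h] at hx1
      exact hx2 hx1.symm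
    have h0' : (x.2 : ℝ) ≠ 0 := by
      rintro h
      rw [Nat.cast_eq_zero] at h
      simp [h] at hx1
      exact hx2 hx1.symm
    field_simp
  have hdiff : |∑ d ∈ Ioc 0 n, c d * vonMangoldt d / d * (s n - s (n / d))| ≤ 1.4 := by
    have hpsi := psi_le_of_le_log hn
    calc _ ≤ ∑ d ∈ Ioc 0 n, |c d * vonMangoldt d / d * (s n - s (n / d))| :=
          abs_sum_le_sum_abs _ _
      _ ≤ ∑ d ∈ Ioc 0 n, vonMangoldt d / n := by
          refine sum_le_sum fun d hd => ?_
          have hd0 : (0 : ℝ) < d := by exact_mod_cast (mem_Ioc.1 hd).1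
          have hq : (n : ℝ) / d < (n / d : ℕ) + 1 := by
            rw [← Nat.floor_div_eq_div (K := ℝ)]
            exact Nat.lt_floor_add_one _
          have hs1 : |s n - s (n / d)| ≤ d / n := by
            refine (hs_sub _ _ (Nat.div_le_self n d)).trans ?_
            push_cast
            calc _ ≤ 1 / ((n : ℝ) / d) := by gcongr
              _ = _ := by rw [one_div_div]
          rw [abs_mul, abs_div, abs_mul, abs_of_nonneg vonMangoldt_nonneg, abs_of_pos hd0]
          calc _ ≤ 1 * vonMangoldt d / d * (d / n) := by
                gcongr
                exact habs d
            _ = _ := by field_simp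
      _ = Chebyshev.psi n / n := by rw [← sum_div, psi_natCast]
      _ ≤ 1.4 := by
          rw [div_le_iff₀ hn0']
          exact hpsi
  have hsplit : s n * ∑ d ∈ Ioc 0 n, c d * vonMangoldt d / d =
      ∑ d ∈ Ioc 0 n, c d * (Real.log d / d) +
        ∑ d ∈ Ioc 0 n, c d * vonMangoldt d / d * (s n - s (n / d)) := by
    rw [← hid, ← sum_add_distrib, mul_sum]
    exact sum_congr rfl fun d _ => by ring
  have hmul' : s n * |∑ d ∈ Ioc 0 n, c d * vonMangoldt d / d| ≤ 2.4 := by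
    have hsn := hs_half n hn0
    rw [← abs_of_nonneg (a := s n) (by linarith), ← abs_mul, hsplit]
    exact (abs_add_le _ _).trans (by linarith)
  have := hs_half n hn0
  nlinarith [abs_nonneg (∑ d ∈ Ioc 0 n, c d * vonMangoldt d / d)]

lemma apply_eq_ite_of_totient_eq_two {m : ℕ} [NeZero m] (hm : 3 ≤ m) (h2 : m.totient = 2)
    {χ : DirichletCharacter ℂ m} (hχ : χ ≠ 1) (a : ZMod m) :
    χ a = if a = 1 then 1 else if a = -1 then -1 else 0 := by
  have : Fact (2 < m) := ⟨hm⟩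
  have hne : (-1 : ZMod m) ≠ 1 := ZMod.neg_one_ne_one
  have hunits (u : (ZMod m)ˣ) : u = 1 ∨ u = -1 := by
    by_contra! h
    have hcard : Fintype.card (ZMod m)ˣ = 2 := by rw [ZMod.card_units_eq_totient, h2]
    have h3 : ({1, -1, u} : Finset (ZMod m)ˣ).card = 3 := by
      refine card_eq_three.2 ⟨1, -1, u, ?_, h.1.symm, h.2.symm, rfl⟩
      intro h
      exact hne (by simpa using (congrArg Units.val h).symm)
    have := card_le_univ ({1, -1, u} : Finset (ZMod m)ˣ)
    omega
  have hneg : χ (-1) = -1 := by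
    have hsq : χ (-1) * χ (-1) = 1 := by rw [← map_mul, neg_mul_neg, one_mul, map_one]
    rcases mul_self_eq_one_iff.1 hsq with h | h
    · refine absurd (MulChar.ext fun u => ?_) hχ
      rw [MulChar.one_apply_coe]
      rcases hunits u with rfl | rfl
      · simp
      · simpa using h
    · exact h
  split_ifs with h1 h2
  · rw [h1, map_one]
  · rw [h2, hneg]
  · refine MulChar.map_nonunit _ fun hu => ?_
    obtain ⟨u, rfl⟩ := hu
    rcases hunits u with rfl | rfl
    · exact h1 rfl
    · exact h2 rfl

lemma norm_sum_mul_vonMangoldt_div_le_of_totient_eq_two {m : ℕ} [NeZero m] (hm : 3 ≤ m)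
    (h2 : m.totient = 2) {χ : DirichletCharacter ℂ m} (hχ : χ ≠ 1) {n : ℕ}
    (hn : 16 ≤ Real.log n) :
    ‖∑ d ∈ Ioc 0 n, χ d * ((vonMangoldt d / d : ℝ) : ℂ)‖ ≤ 4.8 := by
  have hval := apply_eq_ite_of_totient_eq_two hm h2 hχ
  have : Fact (2 < m) := ⟨hm⟩
  have hne : (-1 : ZMod m) ≠ 1 := ZMod.neg_one_ne_one
  have h20 : (2 : ZMod m) ≠ 0 := fun h => hne (by linear_combination -h)
  have h10 : (1 : ZMod m) ≠ 0 := fun h => h20 (by linear_combination 2 * h)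
  set c : ℕ → ℝ := fun d => if (d : ZMod m) = 1 then 1 else if (d : ZMod m) = -1 then -1 else 0
    with hc
  have hcχ (d : ℕ) : χ d = (c d : ℂ) := by
    rw [hval]
    simp only [hc]
    split_ifs <;> simp
  have hsum (n : ℕ) : ∑ d ∈ Ioc 0 n, c d =
      if (n : ZMod m) = 0 ∨ (n : ZMod m) = -1 then 0 else 1 := by
    induction n with
    | zero => simp
    | succ n ih =>
      rw [sum_Ioc_succ_top (Nat.zero_le n), ih]
      simp only [hc, Nat.cast_add, Nat.cast_one]
      generalize (n : ZMod m) = x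
      by_cases hx0 : x = 0
      · subst hx0
        simp [h10, hne.symm]
      by_cases hx1 : x = -1
      · subst hx1
        simp [h10.symm, h10]
      by_cases hx2 : x = -2
      · subst hx2
        have e : (-2 : ZMod m) + 1 = -1 := by ring
        simp [h20, e, hne, hx1]
      · have h3 : x + 1 ≠ 1 := by simpa using hx0
        have h4 : x + 1 ≠ -1 := fun h => hx2 (by linear_combination h)
        have h5 : x + 1 ≠ 0 := fun h => hx1 (by linear_combination h)
        simp [hx0, hx1, h4, h5]
  have := abs_sum_mul_vonMangoldt_div_le (c := c) (by simp [hc]) (fun d e => by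
      have := map_mul χ (d : ZMod m) e
      rw [← Nat.cast_mul, hcχ, hcχ, hcχ] at this
      exact_mod_cast this) (fun d => by
      simp only [hc]
      split_ifs <;> simp) (fun n => by
      rw [hsum]
      split_ifs <;> simp) (fun n => by
      rw [hsum]
      split_ifs <;> simp) hn
  rw [← Real.norm_eq_abs, ← Complex.norm_real] at this
  refine le_of_eq_of_le ?_ this
  congr 1
  push_cast
  refine sum_congr rfl fun d _ => ?_
  rw [hcχ]
  ring

lemma tsum_ite_mem_Ioc {n : ℕ} {Q : ℕ → Prop} [DecidablePred Q] (f : ℕ → ℝ) :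
    ∑' d : ℕ, (if Q d then (if d ∈ Ioc 0 n then f d else 0) else 0) =
      ∑ d ∈ Ioc 0 n with Q d, f d := by
  rw [tsum_eq_sum (s := Ioc 0 n) fun d hd => by simp [hd], sum_filter]
  exact sum_congr rfl fun d hd => by simp [hd]

/-- The lower bound for the part of `n!` composed of primes in given residue classes, for moduli
with two reduced residue classes. -/
lemma le_logPart_factorial_of_totient_eq_two {m : ℕ} (hm : 3 ≤ m) (h2 : m.totient = 2)
    {A : Finset ℕ} (hA : ∀ a ∈ A, a < m ∧ Nat.Coprime a m) {κ : ℝ} (hκ : 1 / 2 ≤ κ)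
    (hκA : κ * m.totient ≤ A.card) {S : Finset ℕ} {n : ℕ}
    (hS : ∀ p : ℕ, p.Prime → p ≤ n → p % m ∈ A → p ∈ S)
    (hn : 2 * Real.log m + 15 ≤ Real.log n) :
    κ * n * (Real.log n - (2 * Real.log m + 15)) ≤ logPart S (n !) := by
  classical
  have : NeZero m := ⟨by omega⟩
  have hlogm : 1 ≤ Real.log m := by
    rw [Real.le_log_iff_exp_le (by positivity)]
    have : (3 : ℝ) ≤ m := by exact_mod_cast hm
    linarith [Real.exp_one_lt_three]
  have hn0 : 0 < n := by
    rcases Nat.eq_zero_or_pos n with rfl | h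
    · norm_num at hn
      linarith
    · exact h
  have hn0' : (0 : ℝ) < n := by exact_mod_cast hn0
  set x : ℕ → ℝ := fun d => if d ∈ Ioc 0 n then vonMangoldt d / d else 0 with hx
  have hxs : Summable x := summable_of_ne_finset_zero (s := Ioc 0 n) fun d hd => by
    simp only [hx, hd, if_false]
  have horth := card_mul_tsum_coprime_sub_le hA hxs (ε := 4.8) fun χ hχ => by
    refine le_of_eq_of_le ?_
      (norm_sum_mul_vonMangoldt_div_le_of_totient_eq_two hm h2 hχ (n := n) (by linarith))
    rw [tsum_eq_sum (s := Ioc 0 n) fun d hd => by simp only [hx, hd, if_false]; simp]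
    congr 1
    exact sum_congr rfl fun d hd => by simp only [hx, hd, if_true]
  simp only [hx, tsum_ite_mem_Ioc] at horth
  rw [h2] at horth hκA
  have hΛ (d : ℕ) : 0 ≤ vonMangoldt d / d := div_nonneg vonMangoldt_nonneg (Nat.cast_nonneg d)
  have hpp := sum_vonMangoldt_div_not_prime_le n
  have hsplit (Q : ℕ → Prop) [DecidablePred Q] : ∑ d ∈ Ioc 0 n with Q d, vonMangoldt d / d ≤
      ∑ d ∈ Ioc 0 n with d.Prime ∧ Q d, vonMangoldt d / d + 2 := by
    refine le_trans ?_ (add_le_add_right hpp _)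
    rw [← sum_filter_add_sum_filter_not _ Nat.Prime, filter_filter, filter_filter]
    simp_rw [and_comm (a := Q _)]
    refine add_le_add_right (sum_le_sum_of_subset_of_nonneg (fun d hd => ?_)
      fun d _ _ => hΛ d) _
    simp only [mem_filter] at hd ⊢
    exact ⟨hd.1, hd.2.1⟩
  have hcop : Real.log n - 1 - (Real.log m + 2) ≤
      ∑ d ∈ Ioc 0 n with d.Coprime m, vonMangoldt d / d := by
    have h1 := log_sub_one_le_sum_vonMangoldt_div hn0
    rw [← sum_filter_add_sum_filter_not _ (fun d => d.Coprime m)] at h1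
    have h3 := hsplit fun d => ¬ d.Coprime m
    have h4 : ∑ d ∈ Ioc 0 n with d.Prime ∧ ¬ d.Coprime m, vonMangoldt d / d ≤ Real.log m := by
      refine le_trans (sum_le_sum fun d hd => ?_) (sum_log_prime_not_coprime_le (by omega) n)
      exact div_le_self vonMangoldt_nonneg
        (by exact_mod_cast (mem_Ioc.1 (mem_filter.1 hd).1).1)
    linarith
  have h5 := sub_theta_le_logPart_factorial (Q := fun p => p % m ∈ A) hS
  have h6 := theta_natCast_le n
  have h7 := hsplit fun d => d % m ∈ A
  have hT : κ * (Real.log n - (Real.log m + 7.8)) - 2 ≤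
      ∑ d ∈ Ioc 0 n with d.Prime ∧ d % m ∈ A, vonMangoldt d / d := by
    have h8 : κ * 2 * (Real.log n - (Real.log m + 7.8)) ≤ A.card *
        (∑ d ∈ Ioc 0 n with d.Coprime m, vonMangoldt d / d - ((2 : ℕ) - 1) * 4.8) := by
      push_cast at hκA ⊢
      refine mul_le_mul hκA ?_ ?_ (Nat.cast_nonneg _) <;> linarith
    push_cast at h8 horth
    linarith
  have h9 := mul_le_mul_of_nonneg_left hT hn0'.le
  nlinarith [mul_le_mul_of_nonneg_right hκ hn0'.le]

lemma hasSum_le_of_sum_Ioc_le {f : ℕ → ℝ} (hf : ∀ d, 0 ≤ f d) (hf0 : f 0 = 0) {C : ℝ}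
    (h : ∀ N, ∑ d ∈ Ioc 0 N, f d ≤ C) : Summable f ∧ ∑' d, f d ≤ C := by
  have h' (N : ℕ) : ∑ d ∈ range N, f d ≤ C := by
    refine le_trans ?_ (h N)
    have hsub : (range N).erase 0 ⊆ Ioc 0 N := fun d hd => by
      simp only [mem_erase, mem_range, mem_Ioc] at hd ⊢
      omega
    rw [← sum_erase _ hf0]
    exact sum_le_sum_of_subset_of_nonneg hsub fun d _ _ => hf d
  exact ⟨summable_of_sum_range_le hf h', Real.tsum_le_of_sum_range_le hf h'⟩

/-- A smoothed lower bound for the sum of `log p / p` over primes in given residue classes. -/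
lemma le_sum_prime_add_of_smoothing {m : ℕ} [NeZero m] {A : Finset ℕ}
    (hA : ∀ a ∈ A, a < m ∧ Nat.Coprime a m) {κ : ℝ} (hκA : κ * m.totient ≤ A.card)
    {η : ℝ} (hη : 0 < η) (K₀ K₁ n : ℕ) {ε : ℝ}
    (hε : ∀ χ : DirichletCharacter ℂ m, χ ≠ 1 → ‖∑' d : ℕ, χ d * ((vonMangoldt d / d *
      (poissonWeight η K₁ (Real.log d) - poissonWeight 4 K₀ (Real.log d)) : ℝ) : ℂ)‖ ≤ ε)
    (hnonneg : 0 ≤ ∑' d : ℕ, vonMangoldt d / d * poissonWeight η K₁ (Real.log d) -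
      ∑' d : ℕ, vonMangoldt d / d * poissonWeight 4 K₀ (Real.log d) -
      (20 + Real.log m) * (16 / 17) ^ K₀ - (m.totient - 1) * ε) :
    κ * (∑' d : ℕ, vonMangoldt d / d * poissonWeight η K₁ (Real.log d) -
      ∑' d : ℕ, vonMangoldt d / d * poissonWeight 4 K₀ (Real.log d) -
      (20 + Real.log m) * (16 / 17) ^ K₀ - (m.totient - 1) * ε) ≤
    ∑ p ∈ Ioc 0 n with p.Prime ∧ p % m ∈ A, vonMangoldt p / p + 20 * (16 / 17) ^ K₀ +
      ∑' d : ℕ, (if n < d then vonMangoldt d / d * poissonWeight η K₁ (Real.log d) else 0) := by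
  classical
  set q : ℝ := (16 / 17) ^ K₀ with hq
  have hq0 : 0 ≤ q := by positivity
  set v₁ : ℕ → ℝ := fun d => poissonWeight η K₁ (Real.log d) with hv₁
  set v₀ : ℕ → ℝ := fun d => poissonWeight 4 K₀ (Real.log d) with hv₀
  have hlog (d : ℕ) : 0 ≤ Real.log d := Real.log_natCast_nonneg d
  have hv₁0 (d : ℕ) : 0 ≤ v₁ d := poissonWeight_nonneg hη.le (hlog d) K₁
  have hv₀0 (d : ℕ) : 0 ≤ v₀ d := poissonWeight_nonneg (by norm_num) (hlog d) K₀
  have hv₁1 (d : ℕ) : v₁ d ≤ 1 := poissonWeight_le_one hη.le (hlog d) K₁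
  have hu₀ (d : ℕ) : 1 - v₀ d ≤ Real.exp (1 / 4 * Real.log d) * q := by
    have := one_sub_poissonWeight_le (η := 4) (by norm_num) (hlog d)
      (by norm_num : (0 : ℝ) ≤ 1 / 4) K₀
    refine this.trans (le_of_eq ?_)
    rw [hq, div_eq_mul_inv, ← inv_pow]
    norm_num
  have hs₁ : Summable fun d : ℕ => vonMangoldt d / d * v₁ d :=
    summable_vonMangoldt_div_mul_poissonWeight hη K₁
  have hs₀ : Summable fun d : ℕ => vonMangoldt d / d * v₀ d :=
    summable_vonMangoldt_div_mul_poissonWeight (by norm_num) K₀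
  set x : ℕ → ℝ := fun d => vonMangoldt d / d * (v₁ d - v₀ d) with hx
  have hxs : Summable x := by
    simp only [hx, mul_sub]
    exact hs₁.sub hs₀
  have htx : ∑' d, x d = ∑' d, vonMangoldt d / d * v₁ d - ∑' d, vonMangoldt d / d * v₀ d := by
    simp only [hx, mul_sub]
    exact hs₁.tsum_sub hs₀
  have hΛ (d : ℕ) : 0 ≤ vonMangoldt d / d := div_nonneg vonMangoldt_nonneg (Nat.cast_nonneg d)
  have horth := card_mul_tsum_coprime_sub_le hA hxs hε
  -- the contribution of proper prime powers
  set b : ℕ → ℝ := fun d => if d.Prime then 0 else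
    q * (vonMangoldt d * Real.exp (-(3 / 4 * Real.log d))) with hb
  have hb0 (d : ℕ) : 0 ≤ b d := by
    simp only [hb]
    split_ifs
    · exact le_rfl
    · exact mul_nonneg hq0 (mul_nonneg vonMangoldt_nonneg (Real.exp_pos _).le)
  obtain ⟨hbs, hbt⟩ := hasSum_le_of_sum_Ioc_le (C := 20 * q) hb0 (by simp [hb]) fun N => by
    have := mul_le_mul_of_nonneg_left (sum_vonMangoldt_mul_exp_not_prime_le N) hq0
    rw [mul_sum, sum_filter] at this
    refine le_trans (le_of_eq (sum_congr rfl fun d _ => ?_)) (this.trans_eq (mul_comm _ _))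
    simp only [hb]
    split_ifs <;> simp_all
  -- the contribution of primes dividing the modulus
  set e : ℕ → ℝ := fun d => if d.Prime ∧ ¬ d.Coprime m then q * vonMangoldt d else 0 with he
  have he0 (d : ℕ) : 0 ≤ e d := by
    simp only [he]
    split_ifs
    · exact mul_nonneg hq0 vonMangoldt_nonneg
    · exact le_rfl
  obtain ⟨hes, het⟩ := hasSum_le_of_sum_Ioc_le (C := Real.log m * q) he0 (by simp [he])
    fun N => by
      have := mul_le_mul_of_nonneg_left (sum_log_prime_not_coprime_le (NeZero.ne m) N) hq0
      rw [mul_sum, sum_filter, mul_comm _ (Real.log m)] at this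
      exact this
  have hxu (d : ℕ) : x d ≤ q * (vonMangoldt d * Real.exp (-(3 / 4 * Real.log d))) := by
    rcases Nat.eq_zero_or_pos d with rfl | hd
    · simp [hx]
    have hd0 : (0 : ℝ) < d := by exact_mod_cast hd
    have h1 : v₁ d - v₀ d ≤ Real.exp (1 / 4 * Real.log d) * q := by linarith [hv₁1 d, hu₀ d]
    have h2 : (d : ℝ)⁻¹ * Real.exp (1 / 4 * Real.log d) = Real.exp (-(3 / 4 * Real.log d)) := by
      conv_lhs => rw [← Real.exp_log hd0, Real.log_exp, ← Real.exp_neg, ← Real.exp_add]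
      congr 1
      ring
    calc x d ≤ vonMangoldt d / d * (Real.exp (1 / 4 * Real.log d) * q) :=
          mul_le_mul_of_nonneg_left h1 (hΛ d)
      _ = _ := by
          rw [← h2]
          ring
  have hcop : ∑' d, x d - (20 + Real.log m) * q ≤
      ∑' d : ℕ, (if d.Coprime m then x d else 0) := by
    have hcs : Summable fun d : ℕ => if d.Coprime m then x d else 0 :=
      Summable.of_norm_bounded hxs.norm fun d => by split_ifs <;> simp
    have h1 : ∑' d, x d ≤ ∑' d : ℕ, ((if d.Coprime m then x d else 0) + b d + e d) := by
      refine hxs.tsum_le_tsum (fun d => ?_) ((hcs.add hbs).add hes)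
      by_cases hc : d.Coprime m
      · rw [if_pos hc]
        linarith [hb0 d, he0 d]
      · have := hxu d
        rw [if_neg hc, zero_add]
        by_cases hp : d.Prime
        · have h2 : e d = q * vonMangoldt d := if_pos ⟨hp, hc⟩
          have h3 : vonMangoldt d * Real.exp (-(3 / 4 * Real.log d)) ≤ vonMangoldt d := by
            refine mul_le_of_le_one_right vonMangoldt_nonneg ?_
            rw [Real.exp_le_one_iff]
            linarith [hlog d]
          linarith [hb0 d, mul_le_mul_of_nonneg_left h3 hq0]
        · have h2 : b d = q * (vonMangoldt d * Real.exp (-(3 / 4 * Real.log d))) := if_neg hp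
          linarith [he0 d]
    rw [(hcs.add hbs).tsum_add hes, hcs.tsum_add hbs] at h1
    linarith
  have hmain : ∑' d : ℕ, (if d % m ∈ A then x d else 0) ≤
      ∑ p ∈ Ioc 0 n with p.Prime ∧ p % m ∈ A, vonMangoldt p / p + 20 * q +
      ∑' d : ℕ, (if n < d then vonMangoldt d / d * v₁ d else 0) := by
    have has : Summable fun d : ℕ => if d % m ∈ A then x d else 0 :=
      Summable.of_norm_bounded hxs.norm fun d => by split_ifs <;> simp
    have hts : Summable fun d : ℕ => if n < d then vonMangoldt d / d * v₁ d else 0 :=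
      Summable.of_norm_bounded hs₁.norm fun d => by
        split_ifs
        · exact le_rfl
        · rw [norm_zero]
          exact norm_nonneg _
    set g : ℕ → ℝ := fun d => if d.Prime ∧ d % m ∈ A then
      (if d ∈ Ioc 0 n then vonMangoldt d / d else 0) else 0 with hg
    have hgs : Summable g := summable_of_ne_finset_zero (s := Ioc 0 n) fun d hd => by
      simp only [hg, hd, if_false, ite_self]
    have hg0 (d : ℕ) : 0 ≤ g d := by
      simp only [hg]
      split_ifs
      · exact hΛ d
      all_goals exact le_rfl
    rw [← tsum_ite_mem_Ioc (fun d => vonMangoldt d / d)]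
    have h1 : ∑' d : ℕ, (if d % m ∈ A then x d else 0) ≤
        ∑' d : ℕ, (g d + b d + if n < d then vonMangoldt d / d * v₁ d else 0) := by
      refine has.tsum_le_tsum (fun d => ?_) ((hgs.add hbs).add hts)
      have ht0 : 0 ≤ if n < d then vonMangoldt d / d * v₁ d else 0 := by
        split_ifs
        · exact mul_nonneg (hΛ d) (hv₁0 d)
        · exact le_rfl
      by_cases hdA : d % m ∈ A
      · rw [if_pos hdA]
        by_cases hp : d.Prime
        · by_cases hnd : n < d
          · rw [if_pos hnd]
            have : x d ≤ vonMangoldt d / d * v₁ d :=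
              mul_le_mul_of_nonneg_left (by linarith [hv₀0 d]) (hΛ d)
            linarith [hg0 d, hb0 d]
          · have h2 : g d = vonMangoldt d / d := by
              simp only [hg, hp, hdA, true_and, if_true]
              rw [if_pos (mem_Ioc.2 ⟨hp.pos, not_lt.1 hnd⟩)]
            have : x d ≤ vonMangoldt d / d :=
              mul_le_of_le_one_right (hΛ d) (by linarith [hv₀0 d, hv₁1 d])
            linarith [hb0 d]
        · have h2 : x d ≤ b d := by
            simp only [hb, hp, if_false]
            exact hxu d
          linarith [hg0 d]
      · rw [if_neg hdA]
        linarith [hg0 d, hb0 d]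
    rw [(hgs.add hbs).tsum_add hts, hgs.tsum_add hbs] at h1
    linarith
  have htot : (0 : ℝ) < m.totient := by exact_mod_cast Nat.totient_pos.2 (NeZero.pos m)
  rw [← htx] at hnonneg ⊢
  refine le_trans ?_ hmain
  refine le_of_mul_le_mul_left ?_ htot
  refine le_trans ?_ horth
  calc _ = κ * m.totient *
        (∑' d, x d - (20 + Real.log m) * q - (m.totient - 1) * ε) := by ring
    _ ≤ A.card * (∑' d, x d - (20 + Real.log m) * q - (m.totient - 1) * ε) :=
        mul_le_mul_of_nonneg_right hκA hnonneg
    _ ≤ _ := mul_le_mul_of_nonneg_left (by linarith) (Nat.cast_nonneg _)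

lemma log_sub_le_tsum_poissonWeight {η : ℝ} (hη : 0 < η) {x K : ℕ} (hx : 16 ≤ Real.log x)
    (hK : x ≤ (1 + 1 / η) ^ K) :
    Real.log x - 2.4 ≤ ∑' d : ℕ, vonMangoldt d / d * poissonWeight η K (Real.log d) := by
  have hx0 : 0 < x := by
    rcases Nat.eq_zero_or_pos x with rfl | h
    · norm_num at hx
    · exact h
  have hx0' : (0 : ℝ) < x := by exact_mod_cast hx0
  have hΛ (d : ℕ) : 0 ≤ vonMangoldt d / d := div_nonneg vonMangoldt_nonneg (Nat.cast_nonneg d)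
  have h1 := log_sub_one_le_sum_vonMangoldt_div hx0
  have h2 : Chebyshev.psi x / x ≤ 1.4 := by
    rw [div_le_iff₀ hx0']
    exact psi_le_of_le_log hx
  have h3 : ∑ d ∈ Ioc 0 x, vonMangoldt d / d - Chebyshev.psi x / x ≤
      ∑ d ∈ Ioc 0 x, vonMangoldt d / d * poissonWeight η K (Real.log d) := by
    rw [psi_natCast, sum_div, ← sum_sub_distrib]
    refine sum_le_sum fun d hd => ?_
    have hd0 : (0 : ℝ) < d := by exact_mod_cast (mem_Ioc.1 hd).1
    have h4 := one_sub_poissonWeight_le hη (Real.log_natCast_nonneg d) zero_le_one K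
    rw [one_mul, Real.exp_log hd0] at h4
    have h5 : (d : ℝ) / (1 + 1 / η) ^ K ≤ d / x := by gcongr
    calc vonMangoldt d / d - vonMangoldt d / x = vonMangoldt d / d * (1 - d / x) := by
          field_simp
      _ ≤ _ := mul_le_mul_of_nonneg_left (by linarith) (hΛ d)
  have h4 := (summable_vonMangoldt_div_mul_poissonWeight hη K).sum_le_tsum (Ioc 0 x)
    fun d _ => mul_nonneg (hΛ d) (poissonWeight_nonneg hη.le (Real.log_natCast_nonneg d) K)
  linarith

lemma tsum_ite_lt_poissonWeight_le {η : ℝ} (hη : 1 < η) {n K : ℕ} (hn : 16 ≤ Real.log n) :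
    ∑' d : ℕ, (if n < d then vonMangoldt d / d * poissonWeight η K (Real.log d) else 0) ≤
      ((1 - 1 / η) ^ K)⁻¹ * (2.8 / n) := by
  have hη' : 0 < 1 - 1 / η := by
    rw [sub_pos, div_lt_one (by linarith)]
    exact hη
  have hC : 0 ≤ ((1 - 1 / η) ^ K)⁻¹ := by positivity
  have hΛ (d : ℕ) : 0 ≤ vonMangoldt d / d := div_nonneg vonMangoldt_nonneg (Nat.cast_nonneg d)
  refine (hasSum_le_of_sum_Ioc_le (fun d => ?_) (by simp) fun N => ?_).2
  · split_ifs
    · exact mul_nonneg (hΛ d) (poissonWeight_nonneg (by linarith) (Real.log_natCast_nonneg d) K)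
    · exact le_rfl
  · have h1 := mul_le_mul_of_nonneg_left (sum_vonMangoldt_div_sq_le hn N) hC
    refine le_trans ?_ h1
    have hf : (Ioc 0 N).filter (fun d => n < d) = Ioc n N := by
      ext d
      simp only [mem_filter, mem_Ioc]
      omega
    rw [← sum_filter, hf, mul_sum]
    refine sum_le_sum fun d hd => ?_
    have hd0 : (0 : ℝ) < d := by exact_mod_cast (Nat.zero_le n).trans_lt (mem_Ioc.1 hd).1
    have h2 := poissonWeight_le hη (Real.log_natCast_nonneg d) K
    rw [Real.exp_neg, Real.exp_log hd0] at h2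
    calc _ ≤ vonMangoldt d / d * ((d : ℝ)⁻¹ / (1 - 1 / η) ^ K) :=
          mul_le_mul_of_nonneg_left h2 (hΛ d)
      _ = _ := by
          field_simp

lemma tsum_poissonWeight_le {η : ℝ} (hη : 1 < η) {z K : ℕ} (hz : 18 ≤ Real.log z) :
    ∑' d : ℕ, vonMangoldt d / d * poissonWeight η K (Real.log d) ≤
      Real.log z + 0.41 + ((1 - 1 / η) ^ K)⁻¹ * (2.8 / z) := by
  have hη0 : 0 < η := by linarith
  have hΛ (d : ℕ) : 0 ≤ vonMangoldt d / d := div_nonneg vonMangoldt_nonneg (Nat.cast_nonneg d)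
  set f : ℕ → ℝ := fun d => vonMangoldt d / d * poissonWeight η K (Real.log d) with hf
  have hs : Summable f := summable_vonMangoldt_div_mul_poissonWeight hη0 K
  have hts : Summable fun d : ℕ => if z < d then f d else 0 :=
    Summable.of_norm_bounded hs.norm fun d => by
      split_ifs
      · exact le_rfl
      · rw [norm_zero]
        exact norm_nonneg _
  set g : ℕ → ℝ := fun d => if d ∈ Ioc 0 z then f d else 0 with hg
  have hgs : Summable g := summable_of_ne_finset_zero (s := Ioc 0 z) fun d hd => by
    simp only [hg, hd, if_false]
  have hgt : ∑' d, g d ≤ Real.log z + 0.41 := by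
    rw [tsum_eq_sum (s := Ioc 0 z) fun d hd => by simp only [hg, hd, if_false]]
    refine le_trans (sum_le_sum fun d hd => ?_) (sum_vonMangoldt_div_le hz)
    simp only [hg, hd, if_true, hf]
    exact mul_le_of_le_one_right (hΛ d)
      (poissonWeight_le_one hη0.le (Real.log_natCast_nonneg d) K)
  have h1 : ∑' d, f d ≤ ∑' d : ℕ, (g d + if z < d then f d else 0) := by
    refine hs.tsum_le_tsum (fun d => ?_) (hgs.add hts)
    rcases Nat.eq_zero_or_pos d with rfl | hd
    · simp [hg, hf]
    by_cases hzd : z < d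
    · have : d ∉ Ioc 0 z := by
        simp only [mem_Ioc]
        omega
      simp only [hg, this, hzd, if_true, if_false, zero_add, le_refl]
    · have : d ∈ Ioc 0 z := mem_Ioc.2 ⟨hd, not_lt.1 hzd⟩
      simp only [hg, this, hzd, if_true, if_false, add_zero, le_refl]
  rw [hgs.tsum_add hts] at h1
  have h2 := tsum_ite_lt_poissonWeight_le hη (n := z) (K := K) (by linarith)
  linarith

lemma norm_tsum_mul_poissonWeight_sub_le {m : ℕ} [NeZero m] (hm : 1 < m) (hG : GRH m)
    {χ : DirichletCharacter ℂ m} (hχ : χ ≠ 1) {η₀ η₁ B₀ B₁ : ℝ} (hη₀ : 4 ≤ η₀) (hη₁ : 4 ≤ η₁)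
    (hB₀ : m.totient / 2 * √(η₀ + 1.27) ≤ 0.919 * Real.exp B₀)
    (hB₁ : m.totient / 2 * √(η₁ + 1.27) ≤ 0.919 * Real.exp B₁) (K₀ K₁ : ℕ) :
    ‖∑' d : ℕ, χ d * ((vonMangoldt d / d *
      (poissonWeight η₁ K₁ (Real.log d) - poissonWeight η₀ K₀ (Real.log d)) : ℝ) : ℂ)‖ ≤
      4 * B₀ * ((η₀ / (η₀ + 1 / 2)) ^ K₀ * (K₀ + 1 + 2 * η₀)) +
      4 * B₁ * ((η₁ / (η₁ + 1 / 2)) ^ K₁ * (K₁ + 1 + 2 * η₁)) := by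
  have h0 := norm_logDeriv_add_tsum_le hm hG hχ hη₀ hB₀ K₀
  have h1 := norm_logDeriv_add_tsum_le hm hG hχ hη₁ hB₁ K₁
  have hs0 := (hasSum_twist_mul_poissonWeight χ (by linarith : 0 < η₀) K₀).summable
  have hs1 := (hasSum_twist_mul_poissonWeight χ (by linarith : 0 < η₁) K₁).summable
  have e : ∑' d : ℕ, χ d * ((vonMangoldt d / d *
      (poissonWeight η₁ K₁ (Real.log d) - poissonWeight η₀ K₀ (Real.log d)) : ℝ) : ℂ) =
      ∑' d : ℕ, χ d * vonMangoldt d / d * (poissonWeight η₁ K₁ (Real.log d) : ℂ) -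
      ∑' d : ℕ, χ d * vonMangoldt d / d * (poissonWeight η₀ K₀ (Real.log d) : ℂ) := by
    rw [← hs1.tsum_sub hs0]
    refine tsum_congr fun d => ?_
    push_cast
    ring
  rw [e, ← add_sub_add_left_eq_sub _ _ (logDeriv χ.LFunction 1)]
  refine (norm_sub_le _ _).trans ?_
  linarith

lemma pow_mul_exp_neg_le {a c t : ℝ} (ha : 0 < a) (hat : a ≤ t) (j : ℕ) (hj : j ≤ c * a) :
    t ^ j * Real.exp (-(c * t)) ≤ a ^ j * Real.exp (-(c * a)) := by
  have h1 : t ≤ a * Real.exp ((t - a) / a) := by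
    have h := Real.add_one_le_exp ((t - a) / a)
    calc t = a * ((t - a) / a + 1) := by field_simp; ring
      _ ≤ _ := by gcongr
  have h2 : j * ((t - a) / a) ≤ c * (t - a) := by
    rw [mul_div_assoc', div_le_iff₀ ha]
    nlinarith
  calc t ^ j * Real.exp (-(c * t))
      ≤ (a * Real.exp ((t - a) / a)) ^ j * Real.exp (-(c * t)) := by
        gcongr
        linarith
    _ = a ^ j * Real.exp (j * ((t - a) / a) + -(c * t)) := by
        rw [mul_pow, ← Real.exp_nat_mul, Real.exp_add, mul_assoc]
    _ ≤ a ^ j * Real.exp (-(c * a)) := by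
        gcongr
        linarith

lemma tsum_poissonWeight_four_ceil_le {t : ℝ} (ht : 32.6 ≤ t) :
    ∑' d : ℕ, vonMangoldt d / d * poissonWeight 4 ⌈2 * t⌉₊ (Real.log d) ≤
      0.576 * t + 3.51 := by
  set K := ⌈2 * t⌉₊
  have hK1 : (K : ℝ) ≤ 2 * t + 1 := (Nat.ceil_lt_add_one (by linarith)).le
  have hK0 : 66 ≤ K := by
    have : 65 < K := Nat.lt_ceil.2 (by push_cast; linarith)
    omega
  set y : ℝ := (4 / 3 : ℝ) ^ K
  have hy66 : (170000000 : ℝ) ≤ y := by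
    calc (170000000 : ℝ) ≤ (4 / 3 : ℝ) ^ 66 := by norm_num
      _ ≤ y := pow_le_pow_right₀ (by norm_num) hK0
  set z := ⌊y⌋₊
  have hzy : (z : ℝ) ≤ y := Nat.floor_le (by linarith)
  have hyz : y < z + 1 := Nat.lt_floor_add_one y
  have hz : 18 ≤ Real.log z := by
    rw [Real.le_log_iff_exp_le (by linarith)]
    have h1 : Real.exp 18 ≤ 2.7182818286 ^ 18 := by
      rw [show (18 : ℝ) = (18 : ℕ) * 1 by norm_num, Real.exp_nat_mul]
      gcongr
      exact Real.exp_one_lt_d9.le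
    have h2 : (2.7182818286 : ℝ) ^ 18 ≤ 100000000 := by norm_num
    linarith
  have hlogz : Real.log z ≤ 0.288 * (2 * t + 1) := by
    have h43 : Real.log (4 / 3) ≤ 0.288 := by
      rw [Real.log_le_iff_le_exp (by norm_num)]
      refine le_trans ?_ (Real.sum_le_exp_of_nonneg (by norm_num) 4)
      norm_num [Finset.sum_range_succ, Nat.factorial]
    calc Real.log z ≤ Real.log y := Real.log_le_log (by linarith) hzy
      _ = K * Real.log (4 / 3) := Real.log_pow _ _
      _ ≤ (2 * t + 1) * 0.288 := by gcongr
      _ = _ := mul_comm _ _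
  have h := tsum_poissonWeight_le (η := 4) (by norm_num) (K := K) hz
  have h3 : ((1 - 1 / 4 : ℝ) ^ K)⁻¹ * (2.8 / z) ≤ 2.81 := by
    rw [← inv_pow, show ((1 - 1 / 4 : ℝ))⁻¹ = 4 / 3 by norm_num, ← mul_div_assoc,
      div_le_iff₀ (by linarith)]
    change y * 2.8 ≤ _
    linarith
  linarith

lemma exists_poissonWeight_params {n : ℕ} {L : ℝ} (hL : L = Real.log n) (hn : 34.5 ≤ L) :
    ∃ K : ℕ, L - 3.79 ≤ ∑' d : ℕ, vonMangoldt d / d * poissonWeight (10 * L) K (Real.log d) ∧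
      ∑' d : ℕ, (if n < d then vonMangoldt d / d * poissonWeight (10 * L) K (Real.log d) else 0)
        ≤ 0.882 ∧
      (10 * L / (10 * L + 1 / 2)) ^ K * (K + 1 + 2 * (10 * L)) ≤
        21.4 * L ^ 2 * Real.exp (-(L / 2)) := by
  have hn0 : (0 : ℝ) < n := by
    rcases Nat.eq_zero_or_pos n with rfl | h
    · norm_num at hL; linarith
    · exact_mod_cast h
  have hbig : (1000000 : ℝ) ≤ n := by
    have h1 : Real.exp 1 ^ 30 ≤ Real.exp L := by
      rw [← Real.exp_nat_mul]
      gcongr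
      push_cast
      linarith
    rw [hL, Real.exp_log hn0] at h1
    have h2 : (2 : ℝ) ^ 30 ≤ Real.exp 1 ^ 30 := by
      gcongr
      linarith [Real.exp_one_gt_d9]
    have h3 : (1000000 : ℝ) ≤ 2 ^ 30 := by norm_num
    linarith
  set x := n / 4
  have hx1 : (x : ℝ) ≤ n / 4 := Nat.cast_div_le
  have hx2 : (n : ℝ) * 0.2499 ≤ x := by
    have : n < 4 * (x + 1) := by omega
    have : (n : ℝ) < 4 * (x + 1) := by exact_mod_cast this
    linarith
  have hx0 : (0 : ℝ) < x := by linarith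
  set X := Real.log x
  have hX1 : X ≤ L := hL ▸ Real.log_le_log hx0 (by linarith)
  have hX2 : L - 1.39 ≤ X := by
    have h1 : Real.log (n * 0.2499) ≤ X := Real.log_le_log (by positivity) hx2
    rw [Real.log_mul hn0.ne' (by norm_num), ← hL] at h1
    have h2 : Real.log (0.2499 : ℝ) = Real.log 0.9996 - 2 * Real.log 2 := by
      rw [show (0.2499 : ℝ) = 0.9996 / 2 ^ 2 by norm_num, Real.log_div (by norm_num) (by norm_num),
        Real.log_pow]
      norm_num
    have h3 := Real.one_sub_inv_le_log_of_pos (x := (0.9996 : ℝ)) (by norm_num)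
    norm_num at h3
    have := Real.log_two_lt_d9
    linarith
  set η := 10 * L
  have hη : 345 ≤ η := by simp only [η]; linarith
  set K := ⌈(η + 1) * X⌉₊
  have hX0 : 0 ≤ X := by linarith
  have hK1 : (η + 1) * X ≤ K := Nat.le_ceil _
  have hK2 : (K : ℝ) ≤ (η + 1) * X + 1 := (Nat.ceil_lt_add_one (by positivity)).le
  have hxX : Real.exp X = x := Real.exp_log hx0
  refine ⟨K, ?_, ?_, ?_⟩
  · have h1 : (x : ℝ) ≤ (1 + 1 / η) ^ K := by
      have h2 : 1 / (η + 1) ≤ Real.log (1 + 1 / η) := by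
        refine le_trans (le_of_eq ?_) (Real.one_sub_inv_le_log_of_pos (by positivity))
        field_simp
        ring
      have h3 : X ≤ K * Real.log (1 + 1 / η) := by
        calc X = (η + 1) * X * (1 / (η + 1)) := by field_simp
          _ ≤ K * Real.log (1 + 1 / η) := by gcongr
      rw [← hxX, ← Real.exp_log (show (0 : ℝ) < 1 + 1 / η by positivity), ← Real.exp_nat_mul]
      exact Real.exp_le_exp.2 h3
    have := log_sub_le_tsum_poissonWeight (by linarith) (by change 16 ≤ X; linarith) h1
    change X - 2.4 ≤ _ at this
    linarith
  · refine (tsum_ite_lt_poissonWeight_le (by linarith) (by linarith)).trans ?_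
    have h1 : ((1 - 1 / η) ^ K)⁻¹ ≤ 1.26 * x := by
      have h0 : (0 : ℝ) < 1 - 1 / η := by
        rw [sub_pos, div_lt_one (by linarith)]; linarith
      have h2 : -(1 / (η - 1)) ≤ Real.log (1 - 1 / η) := by
        refine le_trans (le_of_eq ?_) (Real.one_sub_inv_le_log_of_pos h0)
        have : η - 1 ≠ 0 := by linarith
        have : η ≠ 0 := by linarith
        rw [show 1 - 1 / η = (η - 1) / η by field_simp, inv_div]
        field_simp
        ring
      have h3 : -(K * Real.log (1 - 1 / η)) ≤ X + 0.204 := by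
        calc -(K * Real.log (1 - 1 / η)) = K * -Real.log (1 - 1 / η) := by ring
          _ ≤ K * (1 / (η - 1)) := by
            gcongr
            linarith
          _ ≤ X + 0.204 := by
            rw [mul_one_div, div_le_iff₀ (by linarith)]
            simp only [η] at hK2 ⊢
            nlinarith
      have h4 : Real.exp 0.204 ≤ 1.26 := by
        have h := Real.one_sub_le_exp_neg (0.204 : ℝ)
        rw [Real.exp_neg] at h
        have h5 : Real.exp 0.204 ≤ (1 - 0.204 : ℝ)⁻¹ := by
          rw [← inv_inv (Real.exp 0.204)]
          exact inv_anti₀ (by norm_num) h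
        norm_num at h5 ⊢
        linarith
      calc ((1 - 1 / η) ^ K)⁻¹ = Real.exp (-(K * Real.log (1 - 1 / η))) := by
            rw [Real.exp_neg, Real.exp_nat_mul, Real.exp_log h0]
        _ ≤ Real.exp (X + 0.204) := Real.exp_le_exp.2 h3
        _ = Real.exp 0.204 * x := by rw [Real.exp_add, hxX, mul_comm]
        _ ≤ 1.26 * x := by gcongr
    calc ((1 - 1 / η) ^ K)⁻¹ * (2.8 / n) ≤ 1.26 * (n / 4) * (2.8 / n) := by
          gcongr
          linarith
      _ = 0.882 := by
          field_simp
          norm_num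
  · have h1 : (η / (η + 1 / 2)) ^ K ≤ Real.exp (0.695 - L / 2) := by
      have h2 : Real.log (η / (η + 1 / 2)) ≤ -(1 / 2 / (η + 1 / 2)) := by
        refine (Real.log_le_sub_one_of_pos (by positivity)).trans (le_of_eq ?_)
        field_simp
        ring
      have h3 : X / 2 ≤ K * (1 / 2 / (η + 1 / 2)) := by
        rw [← mul_div_assoc, le_div_iff₀ (by linarith)]
        nlinarith
      have h4 : (K : ℝ) * Real.log (η / (η + 1 / 2)) ≤ K * -(1 / 2 / (η + 1 / 2)) := by
        gcongr
      rw [← Real.exp_log (show (0 : ℝ) < η / (η + 1 / 2) by positivity), ← Real.exp_nat_mul]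
      apply Real.exp_le_exp.2
      linarith
    have h2 : Real.exp 0.695 ≤ 2.005 := by
      have := Real.exp_bound' (x := (0.695 : ℝ)) (by norm_num) (by norm_num) (n := 6) (by norm_num)
      norm_num [Finset.sum_range_succ, Nat.factorial] at this
      norm_num
      linarith
    have h3 : (K : ℝ) + 1 + 2 * η ≤ 10.66 * L ^ 2 := by
      have : (η + 1) * X ≤ (η + 1) * L := by gcongr
      simp only [η] at hK2 this ⊢
      nlinarith
    calc (η / (η + 1 / 2)) ^ K * (K + 1 + 2 * η)
        ≤ Real.exp (0.695 - L / 2) * (10.66 * L ^ 2) := by gcongr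
      _ = Real.exp 0.695 * (10.66 * L ^ 2 * Real.exp (-(L / 2))) := by
          rw [sub_eq_add_neg, Real.exp_add]; ring
      _ ≤ 2.005 * (10.66 * L ^ 2 * Real.exp (-(L / 2))) := by gcongr
      _ ≤ _ := by
          nlinarith [show 0 ≤ L ^ 2 * Real.exp (-(L / 2)) by positivity]

lemma inv_one_add_pow_le {a c : ℝ} (ha : 0 < a) (hc : c ≤ 2 * a / (a + 2)) (K : ℕ) :
    ((1 + a)⁻¹) ^ K ≤ Real.exp (-(c * K)) := by
  have h := Real.le_log_one_add_of_nonneg ha.le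
  rw [← Real.exp_log (show 0 < ((1 + a)⁻¹) ^ K by positivity), Real.log_pow, Real.log_inv]
  apply Real.exp_le_exp.2
  nlinarith [Nat.cast_nonneg (α := ℝ) K]

lemma exp_neg_le_of_natCast_add_le {a b C : ℝ} (j : ℕ) (ha : j + b ≤ a)
    (hC : 1 ≤ C * (2.718281828 ^ j * (1 + b))) (hC0 : 0 < C) :
    Real.exp (-a) ≤ C := by
  have h1 : (2.718281828 : ℝ) ^ j * (1 + b) ≤ Real.exp a := by
    calc (2.718281828 : ℝ) ^ j * (1 + b) ≤ 2.718281828 ^ j * Real.exp b := by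
          gcongr
          linarith [Real.add_one_le_exp b]
      _ ≤ Real.exp 1 ^ j * Real.exp b := by
          gcongr
          have := Real.exp_one_gt_d9
          norm_num at this ⊢
          linarith
      _ = Real.exp (j + b) := by rw [← Real.exp_nat_mul, mul_one, Real.exp_add]
      _ ≤ Real.exp a := Real.exp_le_exp.2 ha
  rw [Real.exp_neg, inv_le_iff_one_le_mul₀ (Real.exp_pos a)]
  exact hC.trans (by gcongr)

lemma principal_error_le {t u : ℝ} (ht : 32.6 ≤ t) (hu : u ≤ t / 4 - 6.55) {K : ℕ}
    (hK : 2 * t ≤ K) : (60 + u) * (16 / 17) ^ K ≤ 1.25 := by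
  have h1 : (16 / 17 : ℝ) ^ K ≤ Real.exp (-(0.12 * t)) := by
    have h := inv_one_add_pow_le (a := 1 / 16) (c := 0.06) (by norm_num) (by norm_num) K
    rw [show ((1 + 1 / 16 : ℝ))⁻¹ = 16 / 17 by norm_num] at h
    refine h.trans (Real.exp_le_exp.2 ?_)
    linarith
  have h3 := pow_mul_exp_neg_le (a := 32.6) (c := 0.12) (by norm_num) ht 1 (by norm_num)
  have h4 : Real.exp (-(0.12 * 32.6)) ≤ 0.0202 :=
    exp_neg_le_of_natCast_add_le (b := -0.088) 4 (by norm_num) (by norm_num) (by norm_num)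
  rw [pow_one, pow_one] at h3
  calc (60 + u) * (16 / 17) ^ K ≤ (1.892 * t) * Real.exp (-(0.12 * t)) := by
        gcongr
        linarith
    _ = 1.892 * (t * Real.exp (-(0.12 * t))) := by ring
    _ ≤ 1.892 * (32.6 * 0.0202) := by
        have : t * Real.exp (-(0.12 * t)) ≤ 32.6 * 0.0202 := h3.trans (by gcongr)
        gcongr
    _ ≤ 1.25 := by norm_num

lemma character_error_zero_le {t f : ℝ} (ht : 32.6 ≤ t) (hf : 4 ≤ f) (hft : 8.159 * f ≤ t)
    {K : ℕ} (hK : 2 * t ≤ K) :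
    (f - 1) * (4 * Real.log (1.25 * f) * ((4 / (4 + 1 / 2)) ^ K * (K + 1 + 2 * 4))) ≤ 1 := by
  have h1 : (4 / (4 + 1 / 2) : ℝ) ^ K * (K + 1 + 2 * 4) ≤
      2.277 * t * Real.exp (-(4 / 17 * t)) := by
    have h := inv_one_add_pow_le (a := 1 / 8) (c := 2 / 17) (by norm_num) (by norm_num) K
    rw [show ((1 + 1 / 8 : ℝ))⁻¹ = 4 / (4 + 1 / 2) by norm_num] at h
    have h' := pow_mul_exp_neg_le (a := 2 * t + 9) (c := 2 / 17) (t := K + 9) (by linarith)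
      (by linarith) 1 (by push_cast; linarith)
    rw [pow_one, pow_one] at h'
    have e1 : Real.exp (-(2 / 17 * (K + 9))) =
        Real.exp (-(2 / 17 * K)) * Real.exp (-(18 / 17)) := by
      rw [← Real.exp_add]; ring_nf
    have e2 : Real.exp (-(2 / 17 * (2 * t + 9))) =
        Real.exp (-(4 / 17 * t)) * Real.exp (-(18 / 17)) := by
      rw [← Real.exp_add]; ring_nf
    rw [e1, e2, ← mul_assoc, ← mul_assoc] at h'
    have h'' := le_of_mul_le_mul_right h' (Real.exp_pos _)
    calc (4 / (4 + 1 / 2) : ℝ) ^ K * (K + 1 + 2 * 4)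
        ≤ Real.exp (-(2 / 17 * K)) * (K + 1 + 2 * 4) := by gcongr
      _ = (K + 9) * Real.exp (-(2 / 17 * K)) := by ring
      _ ≤ (2 * t + 9) * Real.exp (-(4 / 17 * t)) := h''
      _ ≤ _ := by
        gcongr
        linarith
  have h2 : Real.log (1.25 * f) ≤ 0.0495 * t := by
    have e : Real.log (1.25 * f) = Real.log (f / 4) + Real.log 5 := by
      rw [← Real.log_mul (by positivity) (by norm_num)]
      congr 1
      ring
    have h5 : Real.log 5 ≤ 1.61 := by
      rw [Real.log_le_iff_le_exp (by norm_num)]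
      have h6 : (1.61 : ℝ) = 1 + 0.61 := by norm_num
      have h7 := Real.sum_le_exp_of_nonneg (x := (0.61 : ℝ)) (by norm_num) 6
      norm_num [Finset.sum_range_succ, Nat.factorial] at h7
      rw [h6, Real.exp_add]
      have := Real.exp_one_gt_d9
      nlinarith
    have h6 := Real.log_le_sub_one_of_pos (x := f / 4) (by positivity)
    linarith
  have h2' : 0 ≤ Real.log (1.25 * f) := Real.log_nonneg (by linarith)
  have h3 := pow_mul_exp_neg_le (a := 32.6) (c := 4 / 17) (by norm_num) ht 3 (by norm_num)
  have h4 : Real.exp (-(4 / 17 * 32.6)) ≤ 0.000502 :=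
    exp_neg_le_of_natCast_add_le (b := -0.33) 8 (by norm_num) (by norm_num) (by norm_num)
  calc (f - 1) * (4 * Real.log (1.25 * f) * ((4 / (4 + 1 / 2)) ^ K * (K + 1 + 2 * 4)))
      ≤ (t / 8.159) * (4 * (0.0495 * t) * (2.277 * t * Real.exp (-(4 / 17 * t)))) := by
        gcongr
        rw [le_div_iff₀ (by norm_num)]
        linarith
    _ = (4 * 0.0495 * 2.277 / 8.159) * (t ^ 3 * Real.exp (-(4 / 17 * t))) := by ring
    _ ≤ (4 * 0.0495 * 2.277 / 8.159) * (32.6 ^ 3 * 0.000502) := by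
        have : t ^ 3 * Real.exp (-(4 / 17 * t)) ≤ 32.6 ^ 3 * 0.000502 := h3.trans (by gcongr)
        gcongr
    _ ≤ 1 := by norm_num

lemma character_error_one_le {L f E : ℝ} (hL : 34.5 ≤ L) (hf : 4 ≤ f) (hfL : 8.1 * f ≤ L)
    (hE : E ≤ 21.4 * L ^ 2 * Real.exp (-(L / 2))) : (f - 1) * (4 * L * E) ≤ 0.51 := by
  have h3 := pow_mul_exp_neg_le (a := 34.5) (c := 1 / 2) (by norm_num) hL 4 (by norm_num)
  have h4 : Real.exp (-(1 / 2 * 34.5)) ≤ 0.00000003313 :=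
    exp_neg_le_of_natCast_add_le (b := 0.25) 17 (by norm_num) (by norm_num) (by norm_num)
  calc (f - 1) * (4 * L * E)
      ≤ (f - 1) * (4 * L * (21.4 * L ^ 2 * Real.exp (-(L / 2)))) := by
        have : 0 ≤ f - 1 := by linarith
        gcongr
    _ ≤ (L / 8.1) * (4 * L * (21.4 * L ^ 2 * Real.exp (-(L / 2)))) := by
        gcongr
        rw [le_div_iff₀ (by norm_num)]
        linarith
    _ = (4 * 21.4 / 8.1) * (L ^ 4 * Real.exp (-(1 / 2 * L))) := by
        rw [show L / 2 = 1 / 2 * L by ring]; ring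
    _ ≤ (4 * 21.4 / 8.1) * (34.5 ^ 4 * 0.00000003313) := by
        have : L ^ 4 * Real.exp (-(1 / 2 * L)) ≤ 34.5 ^ 4 * 0.00000003313 :=
          h3.trans (by gcongr)
        gcongr
    _ ≤ 0.51 := by norm_num

lemma half_mul_sqrt_le_exp {L f : ℝ} (hL : 34.5 ≤ L) (hf : 8 * f ≤ L) :
    f / 2 * √(10 * L + 1.27) ≤ 0.919 * Real.exp L := by
  have h1 : √(10 * L + 1.27) ≤ 10 * L + 1.27 := by
    rw [Real.sqrt_le_left (by linarith)]
    nlinarith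
  have h2 : (L / 3 + 1) ^ 3 ≤ Real.exp L := by
    calc (L / 3 + 1) ^ 3 ≤ Real.exp (L / 3) ^ 3 := by
          gcongr
          exact Real.add_one_le_exp _
      _ = Real.exp L := by
          rw [← Real.exp_nat_mul]
          congr 1
          push_cast
          ring
  have h3 : f / 2 * √(10 * L + 1.27) ≤ L / 16 * (10 * L + 1.27) :=
    mul_le_mul (by linarith) h1 (Real.sqrt_nonneg _) (by linarith)
  have h4 : L / 16 * (10 * L + 1.27) ≤ 0.919 * (L / 3 + 1) ^ 3 := by
    have h5 : 0 ≤ L ^ 2 * (L - 34.5) := mul_nonneg (sq_nonneg L) (by linarith)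
    have h6 : 0 ≤ L * (L - 34.5) := mul_nonneg (by linarith) (by linarith)
    linarith
  linarith

lemma le_logPart_factorial_of_four_le_totient {m : ℕ} (hm : 5 ≤ m) (h4 : 4 ≤ m.totient)
    (hG : GRH m) {A : Finset ℕ} (hA : ∀ a ∈ A, a < m ∧ Nat.Coprime a m) {κ : ℝ}
    (hκ : 1 / 2 ≤ κ) (hκA : κ * m.totient ≤ A.card) {S : Finset ℕ} {n : ℕ}
    (hS : ∀ p : ℕ, p.Prime → p ≤ n → p % m ∈ A → p ∈ S)
    (hn : (Real.log m + 6.55) * m.totient + 1.9 ≤ Real.log n) :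
    κ * n * (Real.log n - ((Real.log m + 6.55) * m.totient + 1.9)) ≤ logPart S (n !) := by
  classical
  have : NeZero m := ⟨by omega⟩
  set L := Real.log n with hL
  set u := Real.log m
  set f : ℝ := (m.totient : ℝ)
  set t := (u + 6.55) * f
  have hf4 : 4 ≤ f := Nat.ofNat_le_cast.2 h4
  have hu : 1.609 ≤ u := by
    have h5 : Real.log 5 ≤ u := Real.log_le_log (by norm_num) (by exact_mod_cast hm)
    have h6 : (1.609 : ℝ) ≤ Real.log 5 := by
      rw [Real.le_log_iff_exp_le (by norm_num), show (1.609 : ℝ) = 1 + 0.609 by norm_num,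
        Real.exp_add]
      have h7 := Real.exp_bound' (x := (0.609 : ℝ)) (by norm_num) (by norm_num) (n := 8)
        (by norm_num)
      norm_num [Finset.sum_range_succ, Nat.factorial] at h7
      have := Real.exp_one_lt_d9
      norm_num
      nlinarith [Real.exp_pos 1]
    linarith
  have hut : 4 * (u + 6.55) ≤ t := by
    rw [mul_comm]
    exact mul_le_mul_of_nonneg_left hf4 (by linarith)
  have hft : 8.159 * f ≤ t := mul_le_mul_of_nonneg_right (by linarith) (by linarith)
  have ht : 32.6 ≤ t := by linarith
  have hL34 : 34.5 ≤ L := by linarith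
  have hn0 : (0 : ℝ) < n := by
    rcases Nat.eq_zero_or_pos n with rfl | h
    · simp [hL] at hL34; norm_num at hL34
    · exact_mod_cast h
  have hexpL : Real.exp L = n := Real.exp_log hn0
  obtain ⟨K, hV, htail, hE⟩ := exists_poissonWeight_params hL hL34
  have hV0 := tsum_poissonWeight_four_ceil_le ht
  set K₀ := ⌈2 * t⌉₊
  have hK₀ : 2 * t ≤ K₀ := Nat.le_ceil _
  have hq := principal_error_le (u := u) ht (by linarith) hK₀
  have hr0 := character_error_zero_le ht hf4 hft hK₀
  have hr1 := character_error_one_le hL34 hf4 (by linarith) hE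
  set q : ℝ := (16 / 17 : ℝ) ^ K₀
  have hq0 : 0 ≤ q := by positivity
  set V₁ := ∑' d : ℕ, vonMangoldt d / d * poissonWeight (10 * L) K (Real.log d)
  set V₀ := ∑' d : ℕ, vonMangoldt d / d * poissonWeight 4 K₀ (Real.log d)
  set ε := 4 * Real.log (1.25 * f) * ((4 / (4 + 1 / 2)) ^ K₀ * (K₀ + 1 + 2 * 4)) +
    4 * L * ((10 * L / (10 * L + 1 / 2)) ^ K * (K + 1 + 2 * (10 * L)))
  have hε : (f - 1) * ε ≤ 1.51 := by
    simp only [ε, mul_add (f - 1)]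
    linarith
  have huq : 0 ≤ u * q := by positivity
  have hmain : L - (t + 1.9) ≤
      V₁ - V₀ - (20 + u) * q - (f - 1) * ε - (40 * q + 2 * 0.882 + 2.7728) := by
    linarith
  have hbracket : 0 ≤ V₁ - V₀ - (20 + u) * q - (f - 1) * ε := by linarith
  have hsmooth := le_sum_prime_add_of_smoothing hA hκA (η := 10 * L) (by linarith) K₀ K n
    (ε := ε) (fun χ hχ => by
      refine norm_tsum_mul_poissonWeight_sub_le (by omega) hG hχ le_rfl (by linarith) ?_ ?_ K₀ K
      · rw [Real.exp_log (by positivity)]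
        have : √(4 + 1.27) ≤ 2.2975 := by
          rw [Real.sqrt_le_left (by norm_num)]; norm_num
        change f / 2 * _ ≤ _
        nlinarith
      · exact half_mul_sqrt_le_exp hL34 (by linarith)) hbracket
  have hpart := sub_theta_le_logPart_factorial (Q := fun p => p % m ∈ A) hS
  have htheta := theta_natCast_le n
  set T := ∑ p ∈ Ioc 0 n with p.Prime ∧ p % m ∈ A, vonMangoldt p / p
  have hT : κ * (L - (t + 1.9)) ≤ T - 1.3864 := by
    have h1 : κ * (L - (t + 1.9)) ≤
        κ * (V₁ - V₀ - (20 + u) * q - (f - 1) * ε - (40 * q + 2 * 0.882 + 2.7728)) := by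
      gcongr
    have h2 : 1 / 2 * (40 * q + 2 * 0.882 + 2.7728) ≤ κ * (40 * q + 2 * 0.882 + 2.7728) := by
      gcongr
    linarith
  calc κ * n * (L - (t + 1.9)) = n * (κ * (L - (t + 1.9))) := by ring
    _ ≤ n * (T - 1.3864) := by gcongr
    _ ≤ logPart S (n !) := by linarith

theorem le_logPart_factorial {k m : ℕ} (hk : 1 ≤ k) (hm : 3 ≤ m) (hG : GRH m) {A : Finset ℕ}
    (hA : ∀ a ∈ A, a < m ∧ Nat.Coprime a m)
    (hAcard : (k * m.totient : ℝ) / (k + 1) ≤ A.card) {S : Finset ℕ} {n : ℕ}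
    (hS : ∀ p : ℕ, p.Prime → p ≤ n → p % m ∈ A → p ∈ S) :
    (k : ℝ) / (k + 1) * n * (Real.log n - ((Real.log m + 6.550) * m.totient + 1.9)) ≤
      logPart S (n !) := by
  have hk' : (1 : ℝ) ≤ k := by exact_mod_cast hk
  have hκ : (1 / 2 : ℝ) ≤ k / (k + 1) := by
    rw [div_le_div_iff₀ (by norm_num) (by positivity)]
    linarith
  have hκA : (k : ℝ) / (k + 1) * m.totient ≤ A.card := by
    rwa [div_mul_eq_mul_div]
  rcases le_total ((Real.log m + 6.550) * m.totient + 1.9) (Real.log n) with hn | hn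
  · have heven := Nat.totient_even (n := m) (by omega)
    have hpos := Nat.totient_pos.2 (show 0 < m by omega)
    have hlt := Nat.totient_lt m (by omega)
    norm_num only at hn ⊢
    rcases Nat.lt_or_ge m.totient 4 with h | h
    · have h2 : m.totient = 2 := by
        obtain ⟨r, hr⟩ := heven
        omega
      have e : (Real.log m + 6.55) * m.totient + 1.9 = 2 * Real.log m + 15 := by
        rw [h2]
        push_cast
        ring
      norm_num only at e
      rw [e] at hn ⊢
      exact le_logPart_factorial_of_totient_eq_two hm h2 hA hκ hκA hS hn
    · have := le_logPart_factorial_of_four_le_totient (by omega) h hG hA hκ hκA hS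
        (by norm_num only; exact hn)
      norm_num only at this
      exact this
  · have h1 : (k : ℝ) / (k + 1) * n *
        (Real.log n - ((Real.log m + 6.550) * m.totient + 1.9)) ≤ 0 :=
      mul_nonpos_of_nonneg_of_nonpos (by positivity) (by linarith)
    refine h1.trans (Finset.sum_nonneg fun p _ => ?_)
    exact mul_nonneg (by positivity) (Real.log_natCast_nonneg p)

end EulerPade

/-- Simplified explicit `p`-adic lower bound
`|Λ_p|_p > H^{-(0.0008k² + 0.055k + 0.675)(log log H)²}` for some prime
`p ∈ R ∩ [2, 2k log H/D + 2k)`. -/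
theorem statement3 (k m : ℕ) (hk : 1 ≤ k) (hm : 3 ≤ m)
    (lam : Fin (k + 1) → ℤ) (hlam : ∃ i, lam i ≠ 0)
    (A : Finset ℕ) (hA : ∀ a ∈ A, a < m ∧ Nat.Coprime a m)
    (hAcard : (k * m.totient : ℝ) / (k + 1) ≤ A.card)
    (R : Set ℕ) (hR : R = {p : ℕ | p.Prime ∧ p % m ∈ A})
    (hRH : RH) (hGRH : GRH m)
    (α : Fin k → ℤ) (hα : ∀ j, α j ≠ 0) (hαinj : Function.Injective α)
    (R' : Set ℕ)
    (hR' : R' = R ∩ Set.Icc 2 (k * (max (max 1865 (m ^ m.totient)) (maxAbs α) + 2)))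
    (hc2 : c2val k α R' <
      ((k : ℝ) * Real.exp (1 + 6.550 * m.totient) * (m : ℝ) ^ m.totient) ^ (-(k : ℤ)))
    (D : ℝ) (hD : D = Dval m k α R')
    (H : ℝ) (hH : ∀ i, (|lam i| : ℝ) ≤ H)
    (hlogH : Real.log H / D ≥
      max (max 1866 ((m : ℝ) ^ m.totient + 1))
        (max ((maxAbs α : ℝ) + 1)
          (Real.exp (2 * (2.539 * k * m.totient + 5.724 * k + 0.054) / D) + 1))) :
    ∃ p ∈ R ∩ {p : ℕ | 2 ≤ p ∧ (p : ℝ) < 2 * k * Real.log H / D + 2 * k},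
      ∃ _ : Fact p.Prime,
      H ^ (-((0.0008 * k ^ 2 + 0.055 * k + 0.675) * Real.log (Real.log H) ^ 2)) <
        ‖(lam 0 : ℚ_[p]) + ∑ j : Fin k, (lam j.succ : ℚ_[p]) * eulerF p (α j)‖ := by
  refine EulerPade.exists_prime_of_logPart_ge k m hk hm lam hlam A R hR ?_ α hα hαinj R' hR' hc2
    D hD H hH hlogH
  intro S n _ hS _
  exact EulerPade.le_logPart_factorial hk hm hGRH hA hAcard hS
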